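/- Let k be an algebraic closure of the finite field 𝔽_p, let K = k(t) be the rational function field over k, and let E be a non-isotrivial elliptic curve over K, i.e., an elliptic curve whose j-invariant j(E) is transcendental over 𝔽_p. Then the group E(K) of K-rational points is a finitely generated abelian group. -/

import Mathlib

section MA
open WeierstrassCurve WeierstrassCurve.Affine in
open Classical in
theorem A_dbl {F : Type*} [Field F] (W : WeierstrassCurve F) {x y : F} (h : W.toAffine.Nonsingular x y) :
    ∃ c : F, c ≠ 0 ∧ (Point.some x y h + Point.some x y h).xRep 0 =
      c * ((x*x)^2 - W.b₄*(x*x) - W.b₆*(x+x) - W.b₈) ∧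
    (Point.some x y h + Point.some x y h).xRep 1 =
      c * (2*(x+x)*(x*x) + W.b₂*(x*x) + W.b₄*(x+x)+W.b₆) := by
  have e := (W.toAffine.equation_iff x y).1 h.1
  have hD : (2*y + W.a₁*x + W.a₃)^2 = 2*(x+x)*(x*x) + W.b₂*(x*x) + W.b₄*(x+x)+W.b₆ := by
    simp only [WeierstrassCurve.b₂, WeierstrassCurve.b₄, WeierstrassCurve.b₆]
    linear_combination 4 * e
  have hM : (3*x^2+2*W.a₂*x+W.a₄-W.a₁*y)^2 + W.a₁*(3*x^2+2*W.a₂*x+W.a₄-W.a₁*y)*(2*y + W.a₁*x + W.a₃)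
      - (W.a₂+2*x)*(2*y + W.a₁*x + W.a₃)^2 = (x*x)^2 - W.b₄*(x*x) - W.b₆*(x+x) - W.b₈ := by
    simp only [WeierstrassCurve.b₄, WeierstrassCurve.b₆, WeierstrassCurve.b₈]
    linear_combination (-W.a₁^2-4*W.a₂-8*x) * e
  rw [← hD, ← hM]
  have hd' : y - W.toAffine.negY x y = 2*y + W.a₁*x + W.a₃ := by
    rw [WeierstrassCurve.Affine.negY]; ring
  by_cases hy : y = W.toAffine.negY x y
  · have hd : 2*y + W.a₁*x + W.a₃ = 0 := by rw [← hd', sub_eq_zero]; exact hy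
    rw [Point.add_self_of_Y_eq hy, hd]
    have hne : 3*x^2+2*W.a₂*x+W.a₄-W.a₁*y ≠ 0 := by
      rcases ((W.toAffine.nonsingular_iff x y).1 h).2 with h' | h'
      · intro h0; apply h'; linear_combination -h0
      · exact absurd hy h'
    refine ⟨((3*x^2+2*W.a₂*x+W.a₄-W.a₁*y)^2)⁻¹, by positivity, ?_, ?_⟩
    · generalize 3*x^2+2*W.a₂*x+W.a₄-W.a₁*y = M at hne ⊢
      simp; field_simp
    · simp
  · have hd : 2*y + W.a₁*x + W.a₃ ≠ 0 := by rw [← hd']; exact sub_ne_zero.2 hy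
    refine ⟨((2*y + W.a₁*x + W.a₃)^2)⁻¹, by positivity, ?_, ?_⟩
    · rw [Point.add_self_of_Y_ne hy]
      simp only [Point.xRep_some, slope_of_Y_ne rfl hy, Affine.addX, hd', Matrix.cons_val_zero]
      generalize 3*x^2+2*W.a₂*x+W.a₄-W.a₁*y = M at *
      generalize 2*y+W.a₁*x+W.a₃ = D at *
      field_simp
      ring
    · rw [Point.add_self_of_Y_ne hy]
      simp
      field_simp

open WeierstrassCurve WeierstrassCurve.Affine in
open Classical in
theorem A_addsub {F : Type*} [Field F] (W : WeierstrassCurve F) (P Q : W.toAffine.Point) :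
    ∃ c : F, c ≠ 0 ∧
    (P+Q).xRep 0 * (P-Q).xRep 0 = c * ((P.xRep 0 * Q.xRep 0)^2
      - W.b₄ * (P.xRep 0 * Q.xRep 0) * (P.xRep 1 * Q.xRep 1)
      - W.b₆ * (P.xRep 0 * Q.xRep 1 + P.xRep 1 * Q.xRep 0) * (P.xRep 1 * Q.xRep 1)
      - W.b₈ * (P.xRep 1 * Q.xRep 1)^2) ∧
    (P+Q).xRep 0 * (P-Q).xRep 1 + (P+Q).xRep 1 * (P-Q).xRep 0 =
      c * (2 * (P.xRep 0 * Q.xRep 1 + P.xRep 1 * Q.xRep 0) * (P.xRep 0 * Q.xRep 0)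
      + W.b₂ * (P.xRep 0 * Q.xRep 0) * (P.xRep 1 * Q.xRep 1)
      + W.b₄ * (P.xRep 0 * Q.xRep 1 + P.xRep 1 * Q.xRep 0) * (P.xRep 1 * Q.xRep 1)
      + W.b₆ * (P.xRep 1 * Q.xRep 1)^2) ∧
    (P+Q).xRep 1 * (P-Q).xRep 1 = c * (P.xRep 0 * Q.xRep 1 - P.xRep 1 * Q.xRep 0)^2 := by
  rcases P with _ | ⟨x₁, y₁, h₁⟩
  · rw [← WeierstrassCurve.Affine.Point.zero_def, zero_add, zero_sub]
    refine ⟨1, one_ne_zero, ?_⟩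
    simp only [WeierstrassCurve.Affine.Point.xRep_neg]
    rcases Q with _ | ⟨x₂, y₂, h₂⟩
    · rw [← WeierstrassCurve.Affine.Point.zero_def]
      simp
    · simp; refine ⟨by ring, by ring⟩
  rcases Q with _ | ⟨x₂, y₂, h₂⟩
  · rw [← WeierstrassCurve.Affine.Point.zero_def, add_zero, sub_zero]
    refine ⟨1, one_ne_zero, ?_⟩
    simp; refine ⟨by ring, by ring⟩
  have e₁ := (W.toAffine.equation_iff x₁ y₁).1 h₁.1
  have e₂ := (W.toAffine.equation_iff x₂ y₂).1 h₂.1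
  by_cases hx : x₁ = x₂
  · subst hx
    obtain ⟨c, hc, h0, h1⟩ := A_dbl W h₁
    have : Point.some x₁ y₁ h₁ = Point.some x₁ y₂ h₂ ∨ Point.some x₁ y₁ h₁ = - Point.some x₁ y₂ h₂ :=
      Point.X_eq_iff.1 rfl
    refine ⟨c, hc, ?_⟩
    rcases this with hh | hh
    · rw [← hh, sub_self, h0, h1]
      simp
    · rw [← neg_eq_iff_eq_neg] at hh
      rw [← hh, add_neg_cancel, sub_neg_eq_add, h0, h1]
      simp only [WeierstrassCurve.Affine.Point.xRep_neg]
      simp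
  · rw [sub_eq_add_neg, WeierstrassCurve.Affine.Point.neg_some]
    rw [WeierstrassCurve.Affine.Point.add_of_X_ne hx, WeierstrassCurve.Affine.Point.add_of_X_ne hx]
    have hd : x₁ - x₂ ≠ 0 := sub_ne_zero.2 hx
    refine ⟨((x₁-x₂)^2)⁻¹, by positivity, ?_⟩
    simp [WeierstrassCurve.Affine.slope_of_X_ne hx, WeierstrassCurve.Affine.addX, WeierstrassCurve.Affine.negY]
    simp only [WeierstrassCurve.b₂, WeierstrassCurve.b₄, WeierstrassCurve.b₆, WeierstrassCurve.b₈]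
    refine ⟨?_, ?_, ?_⟩
    · field_simp
      clear hx hd h₁ h₂
      grind only
    · field_simp
      linear_combination 2 * e₁ + 2 * e₂
    · field_simp
end MA

section MT
open MvPolynomial in
theorem T_taylor {k : Type*} [Field k] {ι : Type*} [Fintype ι] (x : ι → k) (f : MvPolynomial ι k) :
    f - C (eval x f) - ∑ i, C (eval x (pderiv i f)) * (X i - C (x i)) ∈ (RingHom.ker (eval x))^2 := by
  classical
  induction f using MvPolynomial.induction_on with
  | C a => simp
  | add p q hp hq =>
    convert add_mem hp hq using 1
    simp only [map_add, add_mul, Finset.sum_add_distrib]; ring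
  | mul_X p j hp =>
    have hX : ∀ i, (X i - C (x i) : MvPolynomial ι k) ∈ RingHom.ker (eval x) := fun i => by
      simp [RingHom.mem_ker]
    have h2 : (∑ i, C (eval x (pderiv i p)) * (X i - C (x i))) * (X j - C (x j)) ∈ (RingHom.ker (eval x))^2 := by
      rw [sq]
      exact Ideal.mul_mem_mul (Ideal.sum_mem _ fun i _ => Ideal.mul_mem_left _ _ (hX i)) (hX j)
    convert add_mem (Ideal.mul_mem_right (X j) _ hp) h2 using 1
    simp only [pderiv_mul, pderiv_X, map_add, map_mul, eval_X, add_mul, Finset.sum_add_distrib]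
    have : ∑ i, C (eval x p) * C (eval x ((Pi.single i 1 : ι → MvPolynomial ι k) j)) * (X i - C (x i)) = 
        C (eval x p) * (X j - C (x j)) := by
      rw [Finset.sum_eq_single j]
      · simp
      · intro b _ hb; simp [Pi.single_apply, hb.symm]
      · simp
    rw [this]
    have : ∑ i, C (eval x (pderiv i p)) * C (x j) * (X i - C (x i)) = 
        C (x j) * ∑ i, C (eval x (pderiv i p)) * (X i - C (x i)) := by
      rw [Finset.mul_sum]; exact Finset.sum_congr rfl fun i _ => by ring
    rw [this]; ring

open MvPolynomial in
theorem T_finite {k : Type*} [Field k] {ι : Type*} [Fintype ι] (S : Set (MvPolynomial ι k)) (Z : Set (ι → k))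
    (h0 : ∀ x ∈ Z, ∀ f ∈ S, eval x f = 0)
    (h1 : ∀ x ∈ Z, ∀ v : ι → k, (∀ f ∈ S, ∑ i, v i * eval x (pderiv i f) = 0) → v = 0) : Z.Finite := by
  classical
  have hmin : ∀ x ∈ Z, RingHom.ker (eval x) ∈ (Ideal.span S).minimalPrimes := by
    intro x hx
    have hI : Ideal.span S ≤ RingHom.ker (eval x) := Ideal.span_le.2 fun f hf => h0 x hx f hf
    have hprime : (RingHom.ker (eval x)).IsPrime := RingHom.ker_isPrime _
    have htop : Submodule.span k ((fun (f : MvPolynomial ι k) (i : ι) => eval x (pderiv i f)) '' S) = ⊤ := by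
      by_contra hne
      obtain ⟨φ, hφ, hφ'⟩ := Submodule.exists_le_ker_of_lt_top _ (lt_top_iff_ne_top.2 hne)
      apply hφ
      have := h1 x hx (fun i => φ (Pi.single i 1)) (fun f hf => by
        have := hφ' (Submodule.subset_span ⟨f, hf, rfl⟩)
        rw [LinearMap.mem_ker, LinearMap.pi_apply_eq_sum_univ] at this
        rw [← this]
        refine Finset.sum_congr rfl fun i _ => ?_
        rw [smul_eq_mul, mul_comm]; congr 2
        ext j; simp [Pi.single_apply, eq_comm])
      ext i
      simpa using congrFun this i
    have key : RingHom.ker (eval x) ≤ Ideal.span S ⊔ (RingHom.ker (eval x))^2 := by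
      have hgen : ∀ v ∈ Submodule.span k ((fun (f : MvPolynomial ι k) (i : ι) => eval x (pderiv i f)) '' S),
          ∑ i, C (v i) * (X i - C (x i)) ∈ Ideal.span S ⊔ (RingHom.ker (eval x))^2 := by
        intro v hv
        induction hv using Submodule.span_induction with
        | mem v hv =>
          obtain ⟨f, hf, rfl⟩ := hv
          have := T_taylor x f
          rw [h0 x hx f hf, map_zero, sub_zero] at this
          have h3 := Submodule.sub_mem _ (Ideal.mem_sup_left (T := (RingHom.ker (eval x))^2) (Ideal.subset_span hf)) (Ideal.mem_sup_right (S := Ideal.span S) this)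
          simpa using h3
        | zero => simp
        | add v w _ _ hv hw =>
          simp only [Pi.add_apply, map_add, add_mul, Finset.sum_add_distrib]
          exact add_mem hv hw
        | smul a v _ hv =>
          simp only [Pi.smul_apply, smul_eq_mul, map_mul, mul_assoc, ← Finset.mul_sum]
          exact Ideal.mul_mem_left _ _ hv
      intro f hf
      have h4 := T_taylor x f
      rw [show eval x f = 0 from hf, map_zero, sub_zero] at h4
      have h5 := hgen (fun i => eval x (pderiv i f)) (by rw [htop]; trivial)
      have := add_mem (Ideal.mem_sup_right (S := Ideal.span S) h4) h5
      simpa using this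
    refine ⟨⟨hprime, hI⟩, ?_⟩
    rintro q ⟨hq, hIq⟩ hqm
    have : IsIdempotentElem ((RingHom.ker (eval x)).map (Ideal.Quotient.mk q)) := by
      rw [IsIdempotentElem, ← Ideal.map_mul]
      apply le_antisymm
      · exact Ideal.map_mono Ideal.mul_le_right
      · refine (Ideal.map_mono key).trans ?_
        rw [Ideal.map_sup, sq]
        refine sup_le ?_ le_rfl
        refine (Ideal.map_mono hIq).trans ?_
        simp
    rcases (Ideal.isIdempotentElem_iff_eq_bot_or_top _ (IsNoetherian.noetherian _)).1 this with h | h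
    · rw [Ideal.map_eq_bot_iff_le_ker, Ideal.mk_ker] at h; exact h
    · exfalso
      have h2 := congrArg (Ideal.comap (Ideal.Quotient.mk q)) h
      rw [Ideal.comap_map_of_surjective _ Ideal.Quotient.mk_surjective, ← RingHom.ker_eq_comap_bot, Ideal.mk_ker,
        sup_eq_left.2 hqm, Ideal.comap_top] at h2
      exact hprime.ne_top h2
  have hinj : Set.InjOn (fun x : ι → k => RingHom.ker (eval x)) Z := by
    intro x _ y _ hxy
    ext i
    have : (X i - C (x i) : MvPolynomial ι k) ∈ RingHom.ker (eval x) := by simp [RingHom.mem_ker]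
    rw [show RingHom.ker (eval x) = RingHom.ker (eval y) from hxy] at this
    simp [RingHom.mem_ker] at this
    exact (sub_eq_zero.1 this).symm
  exact Set.Finite.of_finite_image ((Ideal.finite_minimalPrimes_of_isNoetherianRing _ (Ideal.span S)).subset
    (by rintro _ ⟨x, hx, rfl⟩; exact hmin x hx)) hinj
end MT

section MT2
section T2
open MvPolynomial
variable {k A ι : Type*} [Field k] [CommRing A] [Algebra k A] [Fintype ι]

noncomputable def T_D (x v : ι → A) (f : MvPolynomial ι A) : A := ∑ i, v i * eval x (pderiv i f)

theorem T_D_add (x v : ι → A) (f g) : T_D x v (f + g) = T_D x v f + T_D x v g := by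
  simp [T_D, mul_add, Finset.sum_add_distrib]
theorem T_D_sub (x v : ι → A) (f g) : T_D x v (f - g) = T_D x v f - T_D x v g := by
  simp [T_D, mul_sub, Finset.sum_sub_distrib]
theorem T_D_mul (x v : ι → A) (f g) : T_D x v (f * g) = T_D x v f * eval x g + eval x f * T_D x v g := by
  simp only [T_D, Derivation.leibniz, smul_eq_mul, map_add, map_mul, mul_add, Finset.sum_add_distrib, Finset.sum_mul, Finset.mul_sum]
  rw [add_comm]
  congr 1 <;> exact Finset.sum_congr rfl fun i _ => by ring
theorem T_D_C (x v : ι → A) (a) : T_D x v (C a) = 0 := by simp [T_D]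
theorem T_D_X (x v : ι → A) (i) : T_D x v (X i) = v i := by
  classical
  simp [T_D, pderiv_X, Pi.single_apply, apply_ite]
theorem T_D_sum {κ : Type*} (x v : ι → A) (s : Finset κ) (f : κ → MvPolynomial ι A) : T_D x v (∑ j ∈ s, f j) = ∑ j ∈ s, T_D x v (f j) := by
  classical
  induction s using Finset.induction_on with
  | empty => simp [T_D]
  | insert a s ha ih => rw [Finset.sum_insert ha, Finset.sum_insert ha, T_D_add, ih]
theorem T_D_pow (x v : ι → A) (f) (m : ℕ) : T_D x v (f ^ (m+1)) = (m+1) * eval x f ^ m * T_D x v f := by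
  induction m with
  | zero => simp
  | succ m ih => rw [pow_succ, T_D_mul, ih]; push_cast; rw [map_pow]; ring

noncomputable def T_phi (φ : A →ₗ[k] k) : MvPolynomial ι A →+ MvPolynomial ι k :=
  ((AddMonoidAlgebra.coeffAddEquiv.symm : ((ι →₀ ℕ) →₀ k) ≃+ AddMonoidAlgebra k (ι →₀ ℕ)).toAddMonoidHom.comp
    (Finsupp.mapRange.addMonoidHom φ.toAddMonoidHom)).comp
    (AddMonoidAlgebra.coeffAddEquiv : AddMonoidAlgebra A (ι →₀ ℕ) ≃+ ((ι →₀ ℕ) →₀ A)).toAddMonoidHom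

theorem T_phi_monomial (φ : A →ₗ[k] k) (s : ι →₀ ℕ) (a : A) : T_phi φ (monomial s a) = monomial s (φ a) := by
  have : (Finsupp.mapRange.addMonoidHom φ.toAddMonoidHom) (Finsupp.single s a) = Finsupp.single s (φ a) :=
    Finsupp.mapRange_single (hf := φ.map_zero)
  exact congrArg (AddMonoidAlgebra.coeffAddEquiv.symm : ((ι →₀ ℕ) →₀ k) ≃+ AddMonoidAlgebra k (ι →₀ ℕ)) this

theorem T_phi_eval (φ : A →ₗ[k] k) (x : ι → k) (f : MvPolynomial ι A) :
    eval x (T_phi φ f) = φ (eval (fun i => algebraMap k A (x i)) f) := by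
  induction f using MvPolynomial.induction_on' with
  | monomial s a =>
    rw [T_phi_monomial, eval_monomial, eval_monomial]
    have : (s.prod fun n e => (algebraMap k A (x n))^e) = algebraMap k A (s.prod fun n e => x n ^ e) := by
      simp [Finsupp.prod]
    rw [this, mul_comm a, ← Algebra.smul_def, map_smul, smul_eq_mul, mul_comm]
  | add f g hf hg => rw [map_add, map_add, hf, hg, map_add, map_add]

theorem T_phi_pderiv (φ : A →ₗ[k] k) (i : ι) (f : MvPolynomial ι A) :
    pderiv i (T_phi φ f) = T_phi φ (pderiv i f) := by
  induction f using MvPolynomial.induction_on' with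
  | monomial s a =>
    rw [T_phi_monomial, pderiv_monomial, pderiv_monomial, T_phi_monomial]
    congr 1
    rw [mul_comm a, mul_comm (φ a), ← nsmul_eq_mul, ← nsmul_eq_mul, map_nsmul]
  | add f g hf hg => rw [map_add, map_add, hf, hg, map_add, map_add]

theorem T_finite' (S : Set (MvPolynomial ι A)) (Z : Set (ι → k))
    (h0 : ∀ x ∈ Z, ∀ f ∈ S, eval (fun i => algebraMap k A (x i)) f = 0)
    (h1 : ∀ x ∈ Z, ∀ v : ι → k, (∀ f ∈ S, T_D (fun i => algebraMap k A (x i)) (fun i => algebraMap k A (v i)) f = 0) → v = 0) :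
    Z.Finite := by
  apply T_finite {g | ∃ f ∈ S, ∃ φ : A →ₗ[k] k, g = T_phi φ f} Z
  · rintro x hx _ ⟨f, hf, φ, rfl⟩
    rw [T_phi_eval, h0 x hx f hf, map_zero]
  · intro x hx v hv
    apply h1 x hx v
    intro f hf
    rw [← Module.forall_dual_apply_eq_zero_iff k]
    intro φ
    have := hv _ ⟨f, hf, φ, rfl⟩
    rw [T_D, map_sum, ← this]
    refine Finset.sum_congr rfl fun i _ => ?_
    rw [T_phi_pderiv, T_phi_eval, ← Algebra.smul_def, map_smul, smul_eq_mul]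
end T2
end MT2

section MF
open WithZero
set_option linter.unusedSectionVars false

structure F1H (k O M : Type*) [Field k] [CommRing O] [Field M] [Algebra k O] [Algebra O M] [Algebra k M]
    (w : Valuation M (WithZero (Multiplicative ℤ))) (c₀ : ℕ) : Prop where
  d0 : ∀ l : k, l ≠ 0 → w (algebraMap k M l) = 1
  d1 : ∀ x : M, w x ≤ 1 → ∃ l : k, w (x - algebraMap k M l) < 1
  d2 : ∀ x : O, w (algebraMap O M x) < 1 → x = 0
  d3 : ∀ n : ℕ, c₀ ≤ n → ∃ x : O, w (algebraMap O M x) = exp (n : ℤ)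

section F1
variable {k O M : Type*} [Field k] [CommRing O] [Field M] [Algebra k O] [Algebra O M] [Algebra k M]
  [IsScalarTower k O M] {w : Valuation M (WithZero (Multiplicative ℤ))} {c₀ : ℕ}

def F1L (H : F1H k O M w c₀) (n : ℤ) : Submodule k O where
  carrier := {x | w (algebraMap O M x) ≤ exp n}
  add_mem' {a b} ha hb := by
    simp only [Set.mem_ofPred_eq, map_add] at *
    exact (w.map_add _ _).trans (max_le ha hb)
  zero_mem' := by simp
  smul_mem' c x hx := by
    simp only [Set.mem_ofPred_eq] at *
    rw [Algebra.smul_def, map_mul, map_mul, ← IsScalarTower.algebraMap_apply]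
    by_cases hc : c = 0
    · simp [hc]
    · rw [H.d0 c hc, one_mul]; exact hx

variable (H : F1H k O M w c₀)
include H

theorem F1_mem (n : ℤ) (x : O) : x ∈ F1L H n ↔ w (algebraMap O M x) ≤ exp n := Iff.rfl

theorem F1_lt (n : ℤ) (x : O) : x ∈ F1L H n ↔ w (algebraMap O M x) < exp (n+1) := by
  rw [F1_mem]
  by_cases hx : w (algebraMap O M x) = 0
  · simp [hx]
  · rw [← exp_log hx, exp_le_exp, exp_lt_exp]; omega

theorem F1_mono {m n : ℤ} (h : m ≤ n) : F1L H m ≤ F1L H n := fun x hx => by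
  rw [F1_mem] at *; exact hx.trans (exp_le_exp.2 h)

omit H in
theorem F1_smul (l : k) (x : O) : algebraMap O M (l • x) = l • algebraMap O M x := by
  rw [Algebra.smul_def, map_mul, ← IsScalarTower.algebraMap_apply, Algebra.smul_def]

theorem F1_deg (x : O) (hx : x ≠ 0) : ∃ d : ℕ, w (algebraMap O M x) = exp (d : ℤ) := by
  have h1 : ¬ w (algebraMap O M x) < 1 := fun h => hx (H.d2 x h)
  have h0 : w (algebraMap O M x) ≠ 0 := fun h => h1 (by rw [h]; exact zero_lt_one)
  rw [← exp_log h0, ← exp_zero, exp_lt_exp] at h1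
  refine ⟨(log (w (algebraMap O M x))).toNat, ?_⟩
  rw [Int.toNat_of_nonneg (by omega), exp_log h0]

theorem F1_sub (x y : M) (hy : y ≠ 0) (h : w x ≤ w y) : ∃ l : k, w (x - l • y) < w y := by
  have hy' : w y ≠ 0 := (Valuation.ne_zero_iff _).2 hy
  obtain ⟨l, hl⟩ := H.d1 (x / y) (by
    rw [map_div₀]; exact div_le_one_of_le₀ h zero_le)
  refine ⟨l, ?_⟩
  have : x - l • y = (x / y - algebraMap k M l) * y := by
    rw [Algebra.smul_def]; field_simp
  rw [this, map_mul]
  calc _ < 1 * w y := by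
        exact mul_lt_mul_of_pos_right hl (zero_lt_iff.2 hy')
    _ = _ := one_mul _

theorem F1_step (n : ℤ) : ∃ t : O, F1L H (n+1) ≤ F1L H n ⊔ Submodule.span k {t} := by
  by_cases h : F1L H (n+1) ≤ F1L H n
  · exact ⟨0, h.trans le_sup_left⟩
  obtain ⟨t, ht, ht'⟩ := SetLike.not_le_iff_exists.1 h
  refine ⟨t, fun x hx => ?_⟩
  rw [F1_lt, not_lt] at ht'
  have hw : w (algebraMap O M t) = exp (n+1) := le_antisymm ht ht'
  have ht0 : algebraMap O M t ≠ 0 := fun h => by rw [h, map_zero] at hw; exact exp_ne_zero hw.symm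
  obtain ⟨l, hl⟩ := F1_sub H (algebraMap O M x) _ ht0 (by rw [hw]; exact hx)
  have h2 : x - l • t ∈ F1L H n := by
    rw [F1_lt, ← hw, map_sub, F1_smul]; exact hl
  have := Submodule.add_mem_sup h2 (Submodule.smul_mem _ l (Submodule.mem_span_singleton_self (R := k) t))
  simpa using this

theorem F1_neg : F1L H (-1) = ⊥ := by
  rw [eq_bot_iff]
  intro x hx
  rw [F1_lt] at hx
  simpa using H.d2 x hx

theorem F1_fin (n : ℕ) : Module.Finite k (F1L H (n-1)) ∧ Module.finrank k (F1L H (n-1)) ≤ n := by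
  induction n with
  | zero =>
    have := F1_neg H
    rw [show ((0:ℕ):ℤ)-1 = -1 by simp, this]; exact ⟨inferInstance, by simp⟩
  | succ n ih =>
    obtain ⟨t, ht⟩ := F1_step H ((n:ℤ)-1)
    have h1 := ih.1
    rw [show ((n+1:ℕ):ℤ)-1 = (n:ℤ)-1+1 by push_cast; ring]
    refine ⟨Submodule.finiteDimensional_of_le ht, (Submodule.finrank_mono ht).trans ?_⟩
    refine (Submodule.finrank_add_le_finrank_add_finrank _ _).trans ?_
    exact add_le_add ih.2 ((finrank_span_le_card _).trans (by simp))

theorem F1_finite (n : ℤ) : Module.Finite k (F1L H n) := by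
  have := (F1_fin H (n+1).toNat).1
  refine Submodule.finiteDimensional_of_le (S₂ := F1L H ((n+1).toNat-1)) ?_
  intro x hx
  rw [F1_mem] at *
  exact hx.trans (exp_le_exp.2 (by omega))

theorem F1_ge (n : ℕ) : n ≤ Module.finrank k (F1L H (n-1)) + c₀ := by
  induction n with
  | zero => simp
  | succ n ih =>
    rw [show ((n+1:ℕ):ℤ)-1 = (n:ℤ)-1+1 by push_cast; ring]
    have hle : F1L H ((n:ℤ)-1) ≤ F1L H ((n:ℤ)-1+1) := fun x hx => by
      rw [F1_mem] at *; exact hx.trans (exp_le_exp.2 (by omega))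
    have := F1_finite H ((n:ℤ)-1+1)
    by_cases hn : c₀ ≤ n
    · obtain ⟨x, hx⟩ := H.d3 n hn
      have : F1L H ((n:ℤ)-1) < F1L H ((n:ℤ)-1+1) := lt_of_le_of_ne hle (fun h => by
        have h1 : x ∈ F1L H ((n:ℤ)-1+1) := by rw [F1_mem, hx]; simp
        rw [← h, F1_mem, hx, exp_le_exp] at h1; omega)
      have := Submodule.finrank_lt_finrank_of_lt this
      omega
    · omega

theorem F1_div (x : O) (d : ℕ) (hx : w (algebraMap O M x) = exp (d : ℤ)) (n : ℕ) :
    ∀ y ∈ F1L H n, ∃ z : O, y - x * z ∈ F1L H (d + c₀) := by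
  induction n with
  | zero => exact fun y hy => ⟨0, by simpa using F1_mono H (by simp; omega) hy⟩
  | succ n ih =>
    intro y hy
    by_cases hn : n + 1 ≤ d + c₀
    · exact ⟨0, by simpa using F1_mono H (by omega) hy⟩
    obtain ⟨t, ht⟩ := H.d3 (n+1-d) (by omega)
    have hw : w (algebraMap O M (x*t)) = exp ((n:ℤ)+1) := by
      rw [map_mul, map_mul, hx, ht, ← exp_add]; congr 1; omega
    have h0 : algebraMap O M (x*t) ≠ 0 := fun h => by rw [h, map_zero] at hw; exact exp_ne_zero hw.symm
    obtain ⟨l, hl⟩ := F1_sub H (algebraMap O M y) _ h0 (by rw [hw]; exact_mod_cast hy)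
    obtain ⟨z, hz⟩ := ih (y - l • (x*t)) (by rw [F1_lt, ← hw, map_sub, F1_smul]; exact hl)
    refine ⟨z + l • t, ?_⟩
    convert hz using 1
    rw [mul_add, mul_smul_comm]; ring

theorem F1_div' [FaithfulSMul O M] (x : O) (d : ℕ) (hx : w (algebraMap O M x) = exp (d : ℤ)) (y : O) :
    ∃ z : O, y - x * z ∈ F1L H (d + c₀) := by
  by_cases hy : y = 0
  · exact ⟨0, by simp [hy]⟩
  obtain ⟨n, hn⟩ := F1_deg H y hy
  exact F1_div H x d hx n y (by rw [F1_mem, hn])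

theorem F1_quot [FaithfulSMul O M] (I : Ideal O) (x : O) (hxI : x ∈ I) (d : ℕ) (hx : w (algebraMap O M x) = exp (d : ℤ)) :
    Module.Finite k (O ⧸ I) ∧ Module.finrank k (O ⧸ I) ≤ d + c₀ + 1 := by
  let f : F1L H (d + c₀) →ₗ[k] (O ⧸ I) := (Ideal.Quotient.mkₐ k I).toLinearMap ∘ₗ (F1L H (d+c₀)).subtype
  have hf : Function.Surjective f := by
    intro y
    obtain ⟨y, rfl⟩ := Ideal.Quotient.mk_surjective y
    obtain ⟨z, hz⟩ := F1_div' H x d hx y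
    refine ⟨⟨_, hz⟩, ?_⟩
    change Ideal.Quotient.mk I (y - x*z) = _
    rw [map_sub, map_mul, Ideal.Quotient.eq_zero_iff_mem.2 hxI]; simp
  have := F1_finite H (d + c₀)
  refine ⟨Module.Finite.of_surjective f hf, (LinearMap.finrank_le_finrank_of_surjective hf).trans ?_⟩
  have := (F1_fin H (d+c₀+1)).2
  rwa [show ((d + c₀ + 1 : ℕ) : ℤ) - 1 = d + c₀ by push_cast; ring] at this

theorem F1_quot_fin [FaithfulSMul O M] (I : Ideal O) (hI : I ≠ ⊥) : Module.Finite k (O ⧸ I) := by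
  obtain ⟨x, hx, hx0⟩ := Submodule.exists_mem_ne_zero_of_ne_bot hI
  obtain ⟨d, hd⟩ := F1_deg H x hx0
  exact (F1_quot H I x hx d hd).1

end F1
end MF

section MF2a
open WithZero
set_option linter.unusedSectionVars false

section F1b0
variable {k O : Type*} [Field k] [CommRing O] [Algebra k O] [IsDedekindDomain O] [IsAlgClosed k]
theorem F1_prime (hfin : ∀ I : Ideal O, I ≠ ⊥ → Module.Finite k (O ⧸ I)) (v I : Ideal O) (hv : v.IsPrime) (hv0 : v ≠ ⊥) (hI : I ≠ ⊥) :
    Module.finrank k (O ⧸ (v * I)) = Module.finrank k (O ⧸ I) + 1 := by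
  have hvm : v.IsMaximal := hv.isMaximal hv0
  have hfv := hfin v hv0
  have hf := hfin (v * I) (mul_ne_zero hv0 hI)
  have hfI := hfin I hI
  let _ := Ideal.Quotient.field v
  have hsurj : Function.Surjective (algebraMap k (O ⧸ v)) :=
    IsAlgClosed.algebraMap_bijective_of_isIntegral.2
  have hle : v * I ≤ I := Ideal.mul_le_right
  have hlt : ¬ I ≤ v * I := fun h => by
    have : v * I = 1 * I := by rw [one_mul]; exact le_antisymm hle h
    exact hv.ne_top ((mul_right_cancel₀ hI this).trans Ideal.one_eq_top)
  obtain ⟨b, hb, hb'⟩ := SetLike.not_le_iff_exists.1 hlt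
  have hJ : Ideal.span {b} ⊔ v * I = I := by
    have h1 : Ideal.span {b} ⊔ v * I ≤ I := sup_le ((Ideal.span_singleton_le_iff_mem _).2 hb) hle
    obtain ⟨J, hJ⟩ := Ideal.dvd_iff_le.2 h1
    have h2 : J ∣ v := by
      have : I * J ∣ I * v := by
        rw [← hJ, mul_comm I v]; exact Ideal.dvd_iff_le.2 le_sup_right
      exact (mul_dvd_mul_iff_left hI).1 this
    by_cases h : J = ⊤
    · rw [hJ, h, Ideal.mul_top]
    · exfalso; apply hb'
      have h3 := hvm.eq_of_le h (Ideal.dvd_iff_le.1 h2)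
      rw [h3, mul_comm, ← hJ]
      exact Ideal.mem_sup_left (Ideal.mem_span_singleton_self b)
  let g : (O ⧸ (v * I)) →ₐ[k] (O ⧸ I) := Ideal.Quotient.factorₐ k hle
  have hg : Function.Surjective g := Ideal.Quotient.factor_surjective hle
  have h1 := LinearMap.finrank_range_add_finrank_ker g.toLinearMap
  rw [LinearMap.range_eq_top.2 hg, finrank_top] at h1
  have h2 : LinearMap.ker g.toLinearMap = Submodule.span k {Ideal.Quotient.mk (v*I) b} := by
    apply le_antisymm
    · intro y hy
      obtain ⟨y, rfl⟩ := Ideal.Quotient.mk_surjective y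
      have hy : Ideal.Quotient.mk I y = 0 := hy
      rw [Ideal.Quotient.eq_zero_iff_mem, ← hJ, Ideal.mem_span_singleton_sup] at hy
      obtain ⟨r, m, hm, rfl⟩ := hy
      obtain ⟨l, hl⟩ := hsurj (Ideal.Quotient.mk v r)
      have hl : Ideal.Quotient.mk v (algebraMap k O l) = Ideal.Quotient.mk v r := hl
      rw [Ideal.Quotient.eq] at hl
      rw [Submodule.mem_span_singleton]
      refine ⟨l, ?_⟩
      rw [← Ideal.Quotient.mkₐ_eq_mk k, ← map_smul, Ideal.Quotient.mkₐ_eq_mk, Ideal.Quotient.eq, Algebra.smul_def]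
      have := sub_mem (Ideal.mul_mem_mul hl hb) hm
      convert this using 1; ring
    · rw [Submodule.span_singleton_le_iff_mem]
      change Ideal.Quotient.mk I b = 0
      exact Ideal.Quotient.eq_zero_iff_mem.2 hb
  rw [h2, finrank_span_singleton (by rwa [Ne, Ideal.Quotient.eq_zero_iff_mem])] at h1
  exact h1.symm

theorem F1_mul (hfin : ∀ I : Ideal O, I ≠ ⊥ → Module.Finite k (O ⧸ I)) (I J : Ideal O) (hI : I ≠ ⊥) (hJ : J ≠ ⊥) :
    Module.finrank k (O ⧸ (I * J)) = Module.finrank k (O ⧸ I) + Module.finrank k (O ⧸ J) := by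
  induction I using UniqueFactorizationMonoid.induction_on_prime with
  | h₁ => exact absurd rfl hI
  | h₂ I h =>
    rw [Ideal.isUnit_iff.1 h, Ideal.top_mul]
    have : Module.finrank k (O ⧸ (⊤ : Ideal O)) = 0 := Module.finrank_zero_of_subsingleton
    rw [this, zero_add]
  | h₃ I v hI0 hv ih =>
    have hvp := Ideal.isPrime_of_prime hv
    rw [mul_assoc, F1_prime hfin v _ hvp hv.ne_zero (mul_ne_zero hI0 hJ), ih hI0, F1_prime hfin v _ hvp hv.ne_zero hI0]
    ring

theorem F1_pow (hfin : ∀ I : Ideal O, I ≠ ⊥ → Module.Finite k (O ⧸ I)) (I : Ideal O) (hI : I ≠ ⊥) (n : ℕ) :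
    Module.finrank k (O ⧸ (I ^ n)) = n * Module.finrank k (O ⧸ I) := by
  induction n with
  | zero =>
    rw [pow_zero, Ideal.one_eq_top, zero_mul]
    exact Module.finrank_zero_of_subsingleton
  | succ n ih => rw [pow_succ, F1_mul hfin _ _ (pow_ne_zero _ hI) hI, ih]; ring

end F1b0

section F1b
variable {k O M : Type*} [Field k] [CommRing O] [Field M] [Algebra k O] [Algebra O M] [Algebra k M]
  [IsScalarTower k O M] {w : Valuation M (WithZero (Multiplicative ℤ))} {c₀ : ℕ}
  [IsDedekindDomain O] [IsFractionRing O M] [IsAlgClosed k]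
open IsDedekindDomain


variable (H : F1H k O M w c₀)
include H

theorem F1_small (I : Ideal O) (hI : I ≠ ⊥) :
    ∃ x ∈ I, x ≠ 0 ∧ x ∈ F1L H (Module.finrank k (O ⧸ I) + c₀) := by
  have hfI := F1_quot_fin H I hI
  let f : F1L H (Module.finrank k (O ⧸ I) + c₀) →ₗ[k] (O ⧸ I) :=
    (Ideal.Quotient.mkₐ k I).toLinearMap ∘ₗ (F1L H (Module.finrank k (O ⧸ I) +c₀)).subtype
  have := F1_finite H (Module.finrank k (O ⧸ I) + c₀)
  have h1 := F1_ge H (Module.finrank k (O ⧸ I) + c₀ + 1)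
  rw [show ((Module.finrank k (O ⧸ I) + c₀ + 1 : ℕ) : ℤ) - 1 = Module.finrank k (O ⧸ I) + c₀ by push_cast; ring] at h1
  have h2 : LinearMap.ker f ≠ ⊥ := LinearMap.ker_ne_bot_of_finrank_lt (by omega)
  obtain ⟨⟨x, hx⟩, hx1, hx2⟩ := Submodule.exists_mem_ne_zero_of_ne_bot h2
  refine ⟨x, Ideal.Quotient.eq_zero_iff_mem.1 hx1, fun h => hx2 (by simpa using h), hx⟩

theorem F1_delta (a : O) (I : Ideal O) (ha : a ≠ 0) (ℓ : ℕ) (hℓ : ℓ ≠ 0) (h : Ideal.span {a} = I ^ ℓ)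
    (d : ℕ) (hd : w (algebraMap O M a) = exp (d : ℤ)) :
    I ≠ ⊥ ∧ ℓ * Module.finrank k (O ⧸ I) ≤ d + c₀ + 1 := by
  have hI : I ≠ ⊥ := by
    rintro rfl
    rw [← Ideal.zero_eq_bot, zero_pow hℓ] at h
    simp at h; exact ha h
  refine ⟨hI, ?_⟩
  rw [← F1_pow (F1_quot_fin H) I hI, ← h]
  exact (F1_quot H _ a (Ideal.mem_span_singleton_self a) d hd).2

theorem F1_rep (a : O) (I : Ideal O) (ha : a ≠ 0) (ℓ : ℕ) (hℓ : ℓ ≠ 0) (h : Ideal.span {a} = I ^ ℓ) :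
    ∃ x b : O, x ≠ 0 ∧ a * b = x ^ ℓ ∧ b ∈ F1L H ((ℓ + 1) * c₀ + 1) := by
  obtain ⟨d, hd⟩ := F1_deg H a ha
  obtain ⟨hI, hδ⟩ := F1_delta H a I ha ℓ hℓ h d hd
  obtain ⟨x, hx, hx0, hxL⟩ := F1_small H I hI
  have h1 : x ^ ℓ ∈ Ideal.span {a} := by rw [h]; exact Ideal.pow_mem_pow hx ℓ
  obtain ⟨b, hb⟩ := Ideal.mem_span_singleton.1 h1
  refine ⟨x, b, hx0, hb.symm, ?_⟩
  rw [F1_mem] at *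
  have hb0 : b ≠ 0 := by rintro rfl; rw [mul_zero] at hb; exact pow_ne_zero _ hx0 hb
  obtain ⟨db, hdb⟩ := F1_deg H b hb0
  obtain ⟨dx, hdx⟩ := F1_deg H x hx0
  have := congrArg (fun z => w (algebraMap O M z)) hb
  simp only [map_mul, map_pow, hd, hdb, hdx, ← exp_add, ← exp_nsmul, exp_inj] at this
  rw [hdb, exp_le_exp]
  rw [hdx, exp_le_exp] at hxL
  simp only [nsmul_eq_mul] at this
  have h3 : (ℓ:ℤ) * dx ≤ ℓ * (Module.finrank k (O ⧸ I) + c₀) := mul_le_mul_of_nonneg_left hxL (by positivity)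
  zify at hδ
  nlinarith

end F1b
end MF2a

section MF2b
open WithZero
set_option linter.unusedSectionVars false

section F1c
variable {k O M : Type*} [Field k] [CommRing O] [Field M] [Algebra k O] [Algebra O M] [Algebra k M]
  [IsScalarTower k O M] {w : Valuation M (WithZero (Multiplicative ℤ))} {c₀ : ℕ}
  [IsDedekindDomain O] [IsFractionRing O M] [IsAlgClosed k]
open IsDedekindDomain

def F1C (O : Type*) {M : Type*} [CommRing O] [IsDedekindDomain O] [Field M] [Algebra O M] [IsFractionRing O M] (ℓ : ℕ) (a : M) : Prop :=
  ∀ v : HeightOneSpectrum O, ∃ n : ℤ, v.valuation M a = exp (ℓ * n)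

theorem F1C_mul (ℓ : ℕ) (a c : M) (hc : c ≠ 0) (h : F1C O ℓ a) : F1C O ℓ (a * c ^ ℓ) := by
  intro v
  obtain ⟨n, hn⟩ := h v
  refine ⟨n + log (v.valuation M c), ?_⟩
  rw [map_mul, map_pow, hn, mul_add, exp_add]
  congr 1
  conv_lhs => rw [← exp_log ((Valuation.ne_zero_iff _).2 hc : v.valuation M c ≠ 0)]
  rw [← exp_nsmul, nsmul_eq_mul]

theorem F1C_inv (ℓ : ℕ) (a : M) (h : F1C O ℓ a) : F1C O ℓ a⁻¹ := by
  intro v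
  obtain ⟨n, hn⟩ := h v
  exact ⟨-n, by rw [map_inv₀, hn, ← exp_neg]; congr 1; ring⟩

theorem F1C_pow (ℓ : ℕ) (a : O) (ha : a ≠ 0) (h : F1C O ℓ (algebraMap O M a)) :
    ∃ I : Ideal O, Ideal.span {a} = I ^ ℓ := by
  classical
  have h0 : Associates.mk (Ideal.span {a}) ≠ 0 := by simpa using ha
  obtain ⟨b, hb⟩ := Associates.is_pow_of_dvd_count h0 (k := ℓ) (fun p hp => by
    obtain ⟨P, rfl⟩ := Associates.mk_surjective p
    rw [Associates.irreducible_mk] at hp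
    obtain ⟨n, hn⟩ := h ⟨P, Ideal.isPrime_of_prime hp.prime, hp.ne_zero⟩
    rw [HeightOneSpectrum.valuation_of_algebraMap, HeightOneSpectrum.intValuation_if_neg _ ha, exp_inj] at hn
    have : (ℓ : ℤ) ∣ ((Associates.mk P).count (Associates.mk (Ideal.span {a})).factors : ℤ) :=
      ⟨-n, by rw [mul_neg, ← hn]; simp⟩
    exact_mod_cast this)
  obtain ⟨I, rfl⟩ := Associates.mk_surjective b
  refine ⟨I, ?_⟩
  rw [← Associates.mk_pow, Associates.mk_eq_mk_iff_associated, associated_iff_eq] at hb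
  exact hb

variable (H : F1H k O M w c₀)
include H

theorem F1_bdd (ℓ : ℕ) (hℓ : ℓ ≠ 0) (a : M) (ha : a ≠ 0) (h : F1C O ℓ a) :
    ∃ b : O, b ≠ 0 ∧ b ∈ F1L H ((ℓ+1)*c₀+1) ∧ ∃ c : M, c ≠ 0 ∧ a = algebraMap O M b * c ^ ℓ := by
  obtain ⟨n, d, hd, hnd⟩ := IsFractionRing.div_surjective (A := O) a⁻¹
  have hd0 : algebraMap O M d ≠ 0 := IsFractionRing.to_map_ne_zero_of_mem_nonZeroDivisors hd
  have hn0 : algebraMap O M n ≠ 0 := by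
    intro h0; rw [h0, zero_div] at hnd; exact inv_ne_zero ha hnd.symm
  have h1 : algebraMap O M (n * d^(ℓ-1)) = a⁻¹ * (algebraMap O M d)^ℓ := by
    rw [← hnd, map_mul, map_pow]
    obtain ⟨m, rfl⟩ := Nat.exists_eq_succ_of_ne_zero hℓ
    simp [pow_succ]; field_simp
  have h0 : n * d^(ℓ-1) ≠ 0 := by
    intro h0; rw [h0, map_zero] at h1
    exact mul_ne_zero (inv_ne_zero ha) (pow_ne_zero _ hd0) h1.symm
  obtain ⟨I, hI⟩ := F1C_pow ℓ _ h0 (by rw [h1]; exact F1C_mul ℓ _ _ hd0 (F1C_inv ℓ a h))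
  obtain ⟨x, b, hx, hxb, hb⟩ := F1_rep H _ I h0 ℓ hℓ hI
  have h2 := congrArg (algebraMap O M) hxb
  rw [map_mul, h1, map_pow] at h2
  have hx' : algebraMap O M x ≠ 0 := by simpa using hx
  refine ⟨b, ?_, hb, algebraMap O M d / algebraMap O M x, div_ne_zero hd0 hx', ?_⟩
  · rintro rfl; rw [mul_zero] at hxb; exact pow_ne_zero _ hx hxb.symm
  · rw [div_pow, ← h2]
    have : algebraMap O M b ≠ 0 := fun h => by
      rw [h, mul_zero] at h2; exact pow_ne_zero _ hx' h2.symm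
    field_simp

theorem F1_upow (u : M) (I : Ideal O) (h : ∀ b ∈ I, ∃ r : O, u * algebraMap O M b = algebraMap O M r) (m : ℕ) :
    ∀ b ∈ I ^ m, ∃ r : O, u ^ m * algebraMap O M b = algebraMap O M r := by
  induction m with
  | zero => exact fun b _ => ⟨b, by simp⟩
  | succ m ih =>
    intro b hb
    rw [pow_succ] at hb
    induction hb using Submodule.mul_induction_on' with
    | mem_mul_mem x hx y hy =>
      obtain ⟨r, hr⟩ := ih x hx
      obtain ⟨s, hs⟩ := h y hy
      refine ⟨r * s, ?_⟩
      rw [map_mul, map_mul, ← hr, ← hs]; ring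
    | add x _ y _ hx hy =>
      obtain ⟨r, hr⟩ := hx
      obtain ⟨s, hs⟩ := hy
      exact ⟨r + s, by rw [map_add, map_add, mul_add, hr, hs]⟩

theorem F1_min (ℓ : ℕ) (hℓ : ℓ ≠ 0) (a : M) (ha : a ≠ 0) (h : F1C O ℓ a) :
    ∃ b : O, b ≠ 0 ∧ b ∈ F1L H ((ℓ+1)*c₀+1) ∧ (∃ c : M, c ≠ 0 ∧ a = algebraMap O M b * c ^ ℓ) ∧
      ∃ I : Ideal O, Ideal.span {b} = I ^ ℓ ∧ ∀ c : M, w c ≤ 1 →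
        (∀ y ∈ I, ∃ r : O, c * algebraMap O M y = algebraMap O M r) → ∃ l : k, c = algebraMap k M l := by
  classical
  have hex : ∃ n : ℕ, ∃ b : O, w (algebraMap O M b) = exp (n:ℤ) ∧ ∃ c : M, c ≠ 0 ∧ a = algebraMap O M b * c ^ ℓ := by
    obtain ⟨b, hb, _, hc⟩ := F1_bdd H ℓ hℓ a ha h
    obtain ⟨d, hd⟩ := F1_deg H b hb
    exact ⟨d, b, hd, hc⟩
  obtain ⟨b, hb, c, hc, hac⟩ := Nat.find_spec hex
  have hb0 : b ≠ 0 := by rintro rfl; simp at hac; exact ha hac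
  have hbC : F1C O ℓ (algebraMap O M b) := by
    have : algebraMap O M b = a * (c⁻¹)^ℓ := by rw [hac, mul_assoc, ← mul_pow, mul_inv_cancel₀ hc, one_pow, mul_one]
    rw [this]; exact F1C_mul ℓ _ _ (inv_ne_zero hc) h
  obtain ⟨I, hI⟩ := F1C_pow ℓ b hb0 hbC
  refine ⟨b, hb0, ?_, ⟨c, hc, hac⟩, I, hI, ?_⟩
  · obtain ⟨b', hb', hbL, hc'⟩ := F1_bdd H ℓ hℓ a ha h
    obtain ⟨d, hd⟩ := F1_deg H b' hb'
    have := Nat.find_min' hex ⟨b', hd, hc'⟩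
    rw [F1_mem] at *
    rw [hb]; rw [hd] at hbL
    exact (exp_le_exp.2 (by exact_mod_cast this)).trans hbL
  · intro z hz hzI
    obtain ⟨l, hl⟩ := H.d1 z hz
    refine ⟨l, ?_⟩
    by_contra hne
    have hu0 : z - algebraMap k M l ≠ 0 := sub_ne_zero.2 hne
    obtain ⟨r, hr⟩ := F1_upow H (z - algebraMap k M l) I (fun y hy => by
      obtain ⟨r, hr⟩ := hzI y hy
      refine ⟨r - algebraMap k O l * y, ?_⟩
      rw [map_sub, map_mul, ← hr, ← IsScalarTower.algebraMap_apply]; ring) ℓ b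
        (by rw [← hI]; exact Ideal.mem_span_singleton_self b)
    have hr0 : r ≠ 0 := by
      rintro rfl
      rw [map_zero] at hr
      exact mul_ne_zero (pow_ne_zero _ hu0) (by simpa using hb0) hr
    obtain ⟨d, hd⟩ := F1_deg H r hr0
    have h1 := Nat.find_min' hex ⟨r, hd, c * (z - algebraMap k M l)⁻¹, mul_ne_zero hc (inv_ne_zero hu0), by
      rw [← hr, mul_pow, hac, inv_pow]
      have := pow_ne_zero ℓ hu0
      generalize (z - algebraMap k M l) ^ ℓ = q at *
      field_simp⟩
    have h2 : w (algebraMap O M r) < w (algebraMap O M b) := by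
      rw [← hr, map_mul, map_pow]
      have : w (algebraMap O M b) ≠ 0 := by rw [hb]; exact exp_ne_zero
      calc _ < 1 * w (algebraMap O M b) := 
            mul_lt_mul_of_pos_right (pow_lt_one₀ zero_le hl hℓ) (zero_lt_iff.2 this)
        _ = _ := one_mul _
    rw [hd, hb, exp_lt_exp] at h2
    omega

end F1c
end MF2b

section MF2c
open WithZero
set_option linter.unusedSectionVars false

section F2c
variable {k O M : Type*} [Field k] [CommRing O] [Field M] [Algebra k O] [Algebra O M] [Algebra k M]
  [IsScalarTower k O M] {w : Valuation M (WithZero (Multiplicative ℤ))} {c₀ : ℕ}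
  [IsDedekindDomain O] [IsFractionRing O M] [IsAlgClosed k]

theorem F1_unit {J : Type*} (I : Ideal O) (a : O) (ha : a ≠ 0) (ℓ : ℕ) (hℓ : ℓ ≠ 0) (hI : Ideal.span {a} = I ^ ℓ)
    (n c : J → O) (hn : Ideal.span (Set.range n) = I) (h : ∀ j, n j ^ ℓ = a * c j) :
    Ideal.span (Set.range c) = ⊤ := by
  by_contra hne
  have hI0 : I ≠ ⊥ := by
    rintro rfl
    rw [← Ideal.zero_eq_bot, zero_pow hℓ] at hI
    simp at hI; exact ha hI
  obtain ⟨P, hP, hcP⟩ := Ideal.exists_le_maximal _ hne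
  have h1 : ∀ j, n j ∈ I * P := by
    intro j
    have hj : n j ∈ I := by rw [← hn]; exact Ideal.subset_span ⟨j, rfl⟩
    obtain ⟨K, hK⟩ := Ideal.dvd_span_singleton.2 hj
    have hc : c j ∈ P := hcP (Ideal.subset_span ⟨j, rfl⟩)
    have h2 : I ^ ℓ * K ^ ℓ ≤ I ^ ℓ * P := by
      rw [← mul_pow, ← hK, Ideal.span_singleton_pow, h j, ← Ideal.span_singleton_mul_span_singleton, hI]
      exact Ideal.mul_mono le_rfl ((Ideal.span_singleton_le_iff_mem _).2 hc)
    rw [← Ideal.dvd_iff_le, mul_dvd_mul_iff_left (pow_ne_zero ℓ hI0), Ideal.dvd_iff_le] at h2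
    have h3 : K ≤ P := hP.isPrime.le_of_pow_le h2
    have : n j ∈ I * K := by rw [← hK]; exact Ideal.mem_span_singleton_self _
    exact Ideal.mul_mono le_rfl h3 this
  have h2 : I ≤ I * P := by
    conv_lhs => rw [← hn]
    rw [Ideal.span_le]; rintro _ ⟨j, rfl⟩; exact h1 j
  have h3 : I * P ∣ I * ⊤ := by rw [Ideal.dvd_iff_le, Ideal.mul_top]; exact h2
  rw [mul_dvd_mul_iff_left hI0, Ideal.dvd_iff_le, top_le_iff] at h3
  exact hP.ne_top h3

theorem F1_unit' {J : Type*} (c : J → O) (h : Ideal.span (Set.range c) = ⊤) (Q : Ideal O) (y : O)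
    (hy : ∀ j, c j * y ∈ Q) : y ∈ Q := by
  have : Ideal.span (Set.range c) ≤ Submodule.comap (LinearMap.mulRight O y) Q := by
    rw [Ideal.span_le]
    rintro _ ⟨j, rfl⟩
    exact hy j
  rw [h] at this
  simpa using this (Submodule.mem_top (x := (1:O)))

theorem F1_rigid (H : F1H k O M w c₀) {J : Type*} (I : Ideal O) (a : O) (ha : a ≠ 0) (m : ℕ) (hm : ((m + 2 : ℕ) : k) ≠ 0)
    (hI : Ideal.span {a} = I ^ (m+2))
    (hmin : ∀ c : M, w c ≤ 1 →
        (∀ y ∈ I, ∃ r : O, c * algebraMap O M y = algebraMap O M r) → ∃ l : k, c = algebraMap k M l)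
    (n n' : J → O) (c c' : J → J → O) (a' : O) (hn : Ideal.span (Set.range n) = I)
    (h : ∀ i j, n i * n j ^ (m+1) = a * c i j) (ha' : w (algebraMap O M a') < w (algebraMap O M a))
    (h' : ∀ i j, n' i * n j ^ (m+1) + n i * ((m+1) * n j ^ m * n' j) = a' * c i j + a * c' i j) :
    a' = 0 ∧ (∀ i, n' i ∈ I) := by
  have ha0 : algebraMap O M a ≠ 0 := by simpa using ha
  have hnI : ∀ j, n j ∈ I := fun j => by rw [← hn]; exact Ideal.subset_span ⟨j, rfl⟩
  have hc := F1_unit I a ha (m+2) (by omega) hI n (fun j => c j j) hn (fun j => by rw [← h]; ring)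
  have h1 : ∀ y ∈ I, a' * y ∈ Ideal.span {a} := by
    intro y hy
    refine F1_unit' _ hc _ _ fun j => ?_
    have h2 : n j ^ (m+1) * y ∈ Ideal.span {a} := by
      rw [hI, pow_succ]; exact Ideal.mul_mem_mul (Ideal.pow_mem_pow (hnI j) _) hy
    have : c j j * (a' * y) = ((m+2) * n' j) * (n j ^ (m+1) * y) - (c' j j * y) * a := by
      linear_combination (-y) * h' j j
    rw [this]
    exact sub_mem (Ideal.mul_mem_left _ _ h2) (Ideal.mul_mem_left _ _ (Ideal.mem_span_singleton_self a))
  have h2 : a' = 0 := by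
    have hw : w (algebraMap O M a' / algebraMap O M a) < 1 := by
      rw [map_div₀, div_lt_one₀ (zero_lt_iff.2 ((Valuation.ne_zero_iff _).2 ha0))]; exact ha'
    obtain ⟨l, hl⟩ := hmin (algebraMap O M a' / algebraMap O M a) hw.le (fun y hy => by
      obtain ⟨r, hr⟩ := Ideal.mem_span_singleton.1 (h1 y hy)
      refine ⟨r, ?_⟩
      have := congrArg (algebraMap O M) hr
      rw [map_mul, map_mul] at this
      field_simp
      linear_combination this)
    by_cases hl0 : l = 0
    · rw [hl0, map_zero, div_eq_zero_iff] at hl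
      rcases hl with hl | hl
      · simpa using hl
      · exact absurd hl ha0
    · rw [hl, H.d0 l hl0] at hw; exact absurd hw (lt_irrefl _)
  refine ⟨h2, ?_⟩
  subst h2
  have hu : IsUnit ((m + 2 : ℕ) : O) := by
    have := (IsUnit.mk0 _ hm).map (algebraMap k O)
    rwa [map_natCast] at this
  have h3 : ∀ j, n j ^ (m+1) * n' j ∈ I ^ (m+2) := by
    intro j
    rw [← hI, ← Ideal.unit_mul_mem_iff_mem _ hu, Ideal.mem_span_singleton]
    exact ⟨c' j j, by push_cast; linear_combination h' j j⟩
  intro i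
  refine F1_unit' _ hc _ _ fun j => ?_
  have h4 : a * (c j j * n' i) ∈ I ^ (m + 2 + 1) := by
    have : a * (c j j * n' i) = (c' i j * a) * n j - ((m+1) * (n j ^ (m+1) * n' j)) * n i := by
      linear_combination (n j) * h' i j - n' i * h j j
    rw [this, pow_succ]
    refine sub_mem (Ideal.mul_mem_mul ?_ (hnI j)) (Ideal.mul_mem_mul (Ideal.mul_mem_left _ _ (h3 j)) (hnI i))
    rw [← hI]; exact Ideal.mul_mem_left _ _ (Ideal.mem_span_singleton_self a)
  rw [pow_succ, ← hI, Ideal.mem_span_singleton_mul] at h4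
  obtain ⟨z, hz, hz'⟩ := h4
  rw [← mul_left_cancel₀ ha hz']; exact hz

/-- coordinate selection -/
theorem F1_coord {d : Type*} [Finite d] {V : Type*} [AddCommGroup V] [Module k V] (φ : d → V →ₗ[k] k)
    (N : Submodule k V) (hφ : ∀ x ∈ N, (∀ i, φ i x = 0) → x = 0) :
    ∃ (J : Set d) (n : d → V), (∀ j, n j ∈ N) ∧ (∀ j ∉ J, n j = 0) ∧ (∀ j ∈ J, φ j (n j) = 1) ∧
      (∀ j ∈ J, ∀ i ∈ J, i ≠ j → φ i (n j) = 0) ∧ (∀ x ∈ N, (∀ i ∈ J, φ i x = 0) → x = 0) ∧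
      Submodule.span k (Set.range n) = N := by
  classical
  have := Fintype.ofFinite d
  obtain ⟨J, hJ⟩ := Set.Finite.exists_minimal (s := {J : Set d | ∀ x ∈ N, (∀ i ∈ J, φ i x = 0) → x = 0})
    (Set.toFinite _) ⟨Set.univ, fun x hx h => hφ x hx fun i => h i trivial⟩
  have h1 : ∀ j : d, ∃ n ∈ N, (j ∉ J → n = 0) ∧ (j ∈ J → φ j n = 1 ∧ ∀ i ∈ J, i ≠ j → φ i n = 0) := by
    intro j
    by_cases hj : j ∈ J
    · have : ¬ (J \ {j}) ∈ {J : Set d | ∀ x ∈ N, (∀ i ∈ J, φ i x = 0) → x = 0} := fun h => by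
        have := hJ.2 h Set.sdiff_subset hj
        exact this.2 rfl
      simp only [Set.mem_ofPred_eq, not_forall] at this
      obtain ⟨x, hx, h, hx0⟩ := this
      have hxj : φ j x ≠ 0 := fun h0 => hx0 (hJ.1 x hx fun i hi => by
        by_cases hij : i = j
        · rw [hij, h0]
        · exact h i ⟨hi, hij⟩)
      refine ⟨(φ j x)⁻¹ • x, N.smul_mem _ hx, fun h => absurd hj h, fun _ => ⟨by simp [hxj], fun i hi hij => ?_⟩⟩
      rw [map_smul, h i ⟨hi, hij⟩, smul_zero]
    · exact ⟨0, N.zero_mem, fun _ => rfl, fun h => absurd h hj⟩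
  choose n hnN hn0 hn1 using h1
  refine ⟨J, n, hnN, hn0, fun j hj => (hn1 j hj).1, fun j hj => (hn1 j hj).2, hJ.1, ?_⟩
  apply le_antisymm
  · rw [Submodule.span_le]; rintro _ ⟨j, rfl⟩; exact hnN j
  · intro x hx
    have : x - ∑ j, φ j x • n j = 0 := by
      refine hJ.1 _ (N.sub_mem hx (N.sum_mem fun j _ => N.smul_mem _ (hnN j))) fun i hi => ?_
      rw [map_sub, map_sum, Finset.sum_eq_single i]
      · simp [(hn1 i hi).1]
      · intro j _ hj
        by_cases hjJ : j ∈ J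
        · simp [(hn1 j hjJ).2 i hi (Ne.symm hj)]
        · simp [hn0 j hjJ]
      · simp
    rw [sub_eq_zero.1 this]
    exact Submodule.sum_mem _ fun j _ => Submodule.smul_mem _ _ (Submodule.subset_span ⟨j, rfl⟩)
end F2c
end MF2c

section MF2d
open WithZero
set_option linter.unusedSectionVars false

section F2d
variable {k O M : Type*} [Field k] [CommRing O] [Field M] [Algebra k O] [Algebra O M] [Algebra k M]
  [IsScalarTower k O M] {w : Valuation M (WithZero (Multiplicative ℤ))} {c₀ : ℕ}
  [IsDedekindDomain O] [IsFractionRing O M] [IsAlgClosed k]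

/-- goodness -/
def F1G (_H : F1H k O M w c₀) (m : ℕ) (I : Ideal O) (b : O) : Prop := Ideal.span {b} = I ^ (m+2) ∧ ∀ c : M, w c ≤ 1 →
        (∀ y ∈ I, ∃ r : O, c * algebraMap O M y = algebraMap O M r) → ∃ l : k, c = algebraMap k M l

variable (H : F1H k O M w c₀)
include H

theorem F1_gen (I : Ideal O) (a : O) (ha : a ≠ 0) (ℓ : ℕ) (hℓ : ℓ ≠ 0) (h : Ideal.span {a} = I ^ ℓ)
    (d : ℕ) (hd : w (algebraMap O M a) = exp (d : ℤ)) :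
    I ≤ Ideal.span {x | x ∈ I ∧ x ∈ F1L H (d + 3 * c₀ + 1)} := by
  obtain ⟨hI, hδ⟩ := F1_delta H a I ha ℓ hℓ h d hd
  have hδ' : Module.finrank k (O ⧸ I) ≤ d + c₀ + 1 := le_trans (Nat.le_mul_of_pos_left _ (Nat.pos_of_ne_zero hℓ)) hδ
  obtain ⟨x, hx, hx0, hxL⟩ := F1_small H I hI
  obtain ⟨e, he⟩ := F1_deg H x hx0
  have he' : (e : ℤ) ≤ Module.finrank k (O ⧸ I) + c₀ := by
    rw [F1_mem, he, exp_le_exp] at hxL; exact hxL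
  have hxS : x ∈ Ideal.span {x | x ∈ I ∧ x ∈ F1L H (d + 3 * c₀ + 1)} :=
    Ideal.subset_span ⟨hx, F1_mono H (by omega) hxL⟩
  intro y hy
  obtain ⟨z, hz⟩ := F1_div' H x e he y
  have h1 : y - x * z ∈ Ideal.span {x | x ∈ I ∧ x ∈ F1L H (d + 3 * c₀ + 1)} :=
    Ideal.subset_span ⟨sub_mem hy (Ideal.mul_mem_right _ _ hx), F1_mono H (by omega) hz⟩
  have := add_mem h1 (Ideal.mul_mem_right z _ hxS)
  simpa using this

open MvPolynomial in
theorem F1_finJ (m : ℕ) (hm : ((m + 2 : ℕ) : k) ≠ 0) (τ : O) (d : ℕ) (hτ : w (algebraMap O M τ) = exp (d : ℤ))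
    {κ₁ κ₂ κ₃ : Type*} [Fintype κ₁] [Fintype κ₂] [Fintype κ₃]
    (B₁ : Module.Basis κ₁ k (F1L H (d - 1))) (B₂ : Module.Basis κ₂ k (F1L H (d + 3 * c₀ + 1)))
    (B₃ : Module.Basis κ₃ k (F1L H ((m+2) * (d + 3 * c₀ + 1)))) (J : Set κ₂) :
    Set.Finite {b : F1L H (d-1) | ∃ I : Ideal O, F1G H m I (τ + b) ∧
      ∃ n : κ₂ → F1L H (d + 3 * c₀ + 1), (∀ j, (n j : O) ∈ I) ∧ (∀ j ∉ J, n j = 0) ∧ (∀ j ∈ J, B₂.repr (n j) j = 1) ∧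
      (∀ j ∈ J, ∀ i ∈ J, i ≠ j → B₂.repr (n j) i = 0) ∧
      (∀ x : F1L H (d + 3 * c₀ + 1), (x : O) ∈ I → (∀ i ∈ J, B₂.repr x i = 0) → x = 0) ∧
      Ideal.span (Set.range fun j => (n j : O)) = I} := by
  classical
  have hτ0 : τ ≠ 0 := by rintro rfl; rw [map_zero, map_zero] at hτ; exact exp_ne_zero hτ.symm
  have hne : ∀ b : F1L H (d-1), τ + b ≠ 0 ∧ w (algebraMap O M (τ + b)) = exp (d:ℤ) := by
    intro b
    have hb := b.2
    rw [F1_lt, sub_add_cancel, ← hτ] at hb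
    have : w (algebraMap O M (τ + b)) = exp (d:ℤ) := by
      rw [map_add, Valuation.map_add_eq_of_lt_left _ hb, hτ]
    refine ⟨fun h => ?_, this⟩
    rw [h, map_zero, map_zero] at this; exact exp_ne_zero this.symm
  let ι := κ₁ ⊕ (κ₂ × κ₂) ⊕ (κ₂ × κ₂ × κ₃)
  let a : MvPolynomial ι O := C τ + ∑ i, X (Sum.inl i) * C (B₁ i : O)
  let n : κ₂ → MvPolynomial ι O := fun j => ∑ i, X (Sum.inr (Sum.inl (j, i))) * C (B₂ i : O)
  let c : κ₂ → κ₂ → MvPolynomial ι O := fun i j => ∑ l, X (Sum.inr (Sum.inr (i, j, l))) * C (B₃ l : O)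
  let S : Set (MvPolynomial ι O) := (Set.range fun ij : κ₂ × κ₂ => n ij.1 * n ij.2 ^ (m+1) - a * c ij.1 ij.2) ∪
    {f | ∃ j i, (j ∉ J ∨ i ∈ J) ∧ ∃ l : O, f = X (Sum.inr (Sum.inl (j, i))) - C (if j ∈ J ∧ i = j then 1 else 0)}
  have evn : ∀ (x : ι → k) j, eval (fun i => algebraMap k O (x i)) (n j) = ∑ i, x (Sum.inr (Sum.inl (j, i))) • (B₂ i : O) := by
    intro x j; simp [n, Algebra.smul_def]
  have eva : ∀ (x : ι → k), eval (fun i => algebraMap k O (x i)) a = τ + ∑ i, x (Sum.inl i) • (B₁ i : O) := by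
    intro x; simp [a, Algebra.smul_def]
  have evc : ∀ (x : ι → k) i j, eval (fun i => algebraMap k O (x i)) (c i j) = ∑ l, x (Sum.inr (Sum.inr (i, j, l))) • (B₃ l : O) := by
    intro x i j; simp [c, Algebra.smul_def]
  have dn : ∀ (x v : ι → k) j, T_D (fun i => algebraMap k O (x i)) (fun i => algebraMap k O (v i)) (n j) = ∑ i, v (Sum.inr (Sum.inl (j, i))) • (B₂ i : O) := by
    intro x v j; simp [n, Algebra.smul_def, T_D_sum, T_D_mul, T_D_C, T_D_X]
  have da : ∀ (x v : ι → k), T_D (fun i => algebraMap k O (x i)) (fun i => algebraMap k O (v i)) a = ∑ i, v (Sum.inl i) • (B₁ i : O) := by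
    intro x v; simp [a, Algebra.smul_def, T_D_add, T_D_sum, T_D_mul, T_D_C, T_D_X]
  have dc : ∀ (x v : ι → k) i j, T_D (fun i => algebraMap k O (x i)) (fun i => algebraMap k O (v i)) (c i j) = ∑ l, v (Sum.inr (Sum.inr (i, j, l))) • (B₃ l : O) := by
    intro x v i j; simp [c, Algebra.smul_def, T_D_sum, T_D_mul, T_D_C, T_D_X]
  let P : (ι → k) → Prop := fun x => ∃ I : Ideal O, F1G H m I (eval (fun i => algebraMap k O (x i)) a) ∧
      Ideal.span (Set.range fun j => eval (fun i => algebraMap k O (x i)) (n j)) = I ∧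
      (∀ x : F1L H (d + 3 * c₀ + 1), (x : O) ∈ I → (∀ i ∈ J, B₂.repr x i = 0) → x = 0)
  have hZ : Set.Finite {x : ι → k | P x ∧ ∀ f ∈ S, eval (fun i => algebraMap k O (x i)) f = 0} := by
    refine T_finite' S _ (fun x hx f hf => hx.2 f hf) ?_
    rintro x ⟨⟨I, hG, hspan, hJ⟩, hx⟩ v hv
    have h1 := fun i j => hx _ (Or.inl ⟨(i,j), rfl⟩)
    have h2 := fun i j => hv _ (Or.inl ⟨(i,j), rfl⟩)
    simp only [map_sub, map_mul, map_pow, sub_eq_zero] at h1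
    simp only [T_D_sub, T_D_mul, T_D_pow, sub_eq_zero, map_pow] at h2
    have hea := hne (∑ i, x (Sum.inl i) • B₁ i)
    rw [show τ + ((∑ i, x (Sum.inl i) • B₁ i : F1L H (d-1)) : O) = eval (fun i => algebraMap k O (x i)) a by
      rw [eva]; simp] at hea
    obtain ⟨h3, h4⟩ := F1_rigid H I _ hea.1 m hm hG.1 hG.2 (fun j => eval (fun i => algebraMap k O (x i)) (n j))
      (fun j => T_D (fun i => algebraMap k O (x i)) (fun i => algebraMap k O (v i)) (n j))
      (fun i j => eval (fun i => algebraMap k O (x i)) (c i j))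
      (fun i j => T_D (fun i => algebraMap k O (x i)) (fun i => algebraMap k O (v i)) (c i j))
      (T_D (fun i => algebraMap k O (x i)) (fun i => algebraMap k O (v i)) a) hspan h1
      (by
        rw [hea.2, da]
        have := (∑ i, v (Sum.inl i) • B₁ i : F1L H (d-1)).2
        rw [F1_lt, sub_add_cancel] at this
        simpa using this) h2
    have h5 : ∀ j, (∑ i, v (Sum.inr (Sum.inl (j, i))) • B₂ i) = 0 := by
      intro j
      apply hJ
      · have := h4 j
        simp only [dn] at this
        simpa using this
      · intro i hi
        have := hv _ (Or.inr ⟨j, i, Or.inr hi, 0, rfl⟩)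
        rw [T_D_sub, T_D_C, T_D_X, sub_zero] at this
        simp only [FaithfulSMul.algebraMap_eq_zero_iff] at this
        simp [Module.Basis.repr_self, Finsupp.single_apply, this]
    have h5' : ∀ j i, v (Sum.inr (Sum.inl (j, i))) = 0 := fun j i =>
      (Fintype.linearIndependent_iff.1 B₂.linearIndependent) _ (h5 j) i
    have h6 : ∀ i, v (Sum.inl i) = 0 := by
      rw [da] at h3
      exact (Fintype.linearIndependent_iff.1 B₁.linearIndependent) (fun i => v (Sum.inl i)) (Subtype.ext (by simpa using h3))
    have h7 : ∀ i j l, v (Sum.inr (Sum.inr (i, j, l))) = 0 := by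
      intro i j
      have := h2 i j
      rw [h3, dn, dn] at this
      simp only [h5', zero_smul, Finset.sum_const_zero, zero_mul, mul_zero, zero_add] at this
      have := (mul_eq_zero.1 this.symm).resolve_left hea.1
      rw [dc] at this
      exact (Fintype.linearIndependent_iff.1 B₃.linearIndependent) (fun l => v (Sum.inr (Sum.inr (i, j, l)))) (Subtype.ext (by simpa using this))
    ext i
    rcases i with i | ⟨j, i⟩ | ⟨i, j, l⟩
    · exact h6 i
    · exact h5' j i
    · exact h7 i j l
  refine (hZ.image (fun x => ∑ i, x (Sum.inl i) • B₁ i)).subset ?_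
  rintro b ⟨I, hG, N, hNI, hN0, hN1, hN2, hJ, hspan⟩
  have hc : ∀ i j, ∃ c : F1L H ((m+2) * (d + 3 * c₀ + 1)), (N i : O) * N j ^ (m+1) = (τ + b) * c := by
    intro i j
    have : (N i : O) * N j ^ (m+1) ∈ Ideal.span {τ + (b:O)} := by
      rw [hG.1, pow_succ']; exact Ideal.mul_mem_mul (hNI i) (Ideal.pow_mem_pow (hNI j) _)
    obtain ⟨c, hc⟩ := Ideal.mem_span_singleton.1 this
    refine ⟨⟨c, ?_⟩, hc⟩
    have h1 := congrArg (fun z => w (algebraMap O M z)) hc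
    simp only [map_mul, map_pow, (hne b).2] at h1
    rw [F1_mem]
    have h2 : w (algebraMap O M c) ≤ exp (d:ℤ) * w (algebraMap O M c) :=
      le_mul_of_one_le_left zero_le (by rw [← exp_zero, exp_le_exp]; omega)
    rw [← h1] at h2
    refine h2.trans ?_
    have h3 : ∀ j, w (algebraMap O M (N j)) ≤ exp ((d:ℤ) + 3 * c₀ + 1) := fun j => (N j).2
    refine (mul_le_mul' (h3 i) (pow_le_pow_left₀ zero_le (h3 j) _)).trans ?_
    rw [← exp_nsmul, ← exp_add, exp_le_exp]
    apply le_of_eq; simp; ring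
  choose c' hc' using hc
  let x : ι → k := Sum.elim (fun i => B₁.repr b i) (Sum.elim (fun ji => B₂.repr (N ji.1) ji.2) (fun ijl => B₃.repr (c' ijl.1 ijl.2.1) ijl.2.2))
  have ea : eval (fun i => algebraMap k O (x i)) a = τ + b := by
    rw [eva]
    conv_rhs => rw [← B₁.sum_repr b]
    simp only [x, Sum.elim_inl, Sum.elim_inr, Submodule.coe_sum, Submodule.coe_smul]
  have en : ∀ j, eval (fun i => algebraMap k O (x i)) (n j) = N j := by
    intro j
    rw [evn]
    conv_rhs => rw [← B₂.sum_repr (N j)]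
    simp only [x, Sum.elim_inl, Sum.elim_inr, Submodule.coe_sum, Submodule.coe_smul]
  have ec : ∀ i j, eval (fun i => algebraMap k O (x i)) (c i j) = c' i j := by
    intro i j
    rw [evc]
    conv_rhs => rw [← B₃.sum_repr (c' i j)]
    simp only [x, Sum.elim_inl, Sum.elim_inr, Submodule.coe_sum, Submodule.coe_smul]
  refine ⟨x, ⟨⟨I, ?_, ?_, hJ⟩, ?_⟩, ?_⟩
  · rw [ea]; exact hG
  · simp only [en]; exact hspan
  · rintro f (⟨⟨i, j⟩, rfl⟩ | ⟨j, i, hij, _, rfl⟩)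
    · simp only [map_sub, map_mul, map_pow, en, ea, ec, hc', sub_self]
    · simp only [map_sub, eval_X, eval_C, sub_eq_zero, x, Sum.elim_inr, Sum.elim_inl]
      by_cases hj : j ∈ J
      · have hi := hij.resolve_left (not_not_intro hj)
        by_cases e : i = j
        · subst e; simp [hN1 i hj, hj]
        · simp [hN2 j hj i hi e, e]
      · simp [hN0 j hj, hj]
  · exact B₁.sum_repr b

theorem F1_fin1 (m : ℕ) (hm : ((m + 2 : ℕ) : k) ≠ 0) (τ : O) (d : ℕ) (hτ : w (algebraMap O M τ) = exp (d : ℤ)) :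
    Set.Finite {b : F1L H (d-1) | ∃ I : Ideal O, F1G H m I (τ + b)} := by
  have f1 := F1_finite H (d-1)
  have f2 := F1_finite H (d + 3 * c₀ + 1)
  have f3 := F1_finite H ((m+2) * (d + 3 * c₀ + 1))
  let B₂ := Module.finBasis k (F1L H (d + 3 * c₀ + 1))
  refine (Set.finite_iUnion fun J => F1_finJ H m hm τ d hτ (Module.finBasis k _) B₂ (Module.finBasis k _) J).subset ?_
  rintro b ⟨I, hG⟩
  have hb := b.2
  rw [F1_lt, sub_add_cancel, ← hτ] at hb
  have hw : w (algebraMap O M (τ + b)) = exp (d:ℤ) := by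
    rw [map_add, Valuation.map_add_eq_of_lt_left _ hb, hτ]
  have h0 : τ + (b:O) ≠ 0 := fun h => by rw [h, map_zero, map_zero] at hw; exact exp_ne_zero hw.symm
  have hgen := F1_gen H I _ h0 (m+2) (by omega) hG.1 d hw
  obtain ⟨J, n, hn, hn0, hn1, hn2, hJ, hs⟩ := F1_coord (fun i => B₂.coord i)
    ((I.restrictScalars k).comap (F1L H (d + 3 * c₀ + 1)).subtype) (fun x _ hx => B₂.forall_coord_eq_zero_iff.1 hx)
  refine Set.mem_iUnion.2 ⟨J, I, hG, n, hn, hn0, hn1, hn2, hJ, ?_⟩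
  apply le_antisymm
  · rw [Ideal.span_le]; rintro _ ⟨j, rfl⟩; exact hn j
  · refine hgen.trans ?_
    rw [Ideal.span_le]
    rintro x ⟨hx, hxL⟩
    have : (⟨x, hxL⟩ : F1L H (d + 3 * c₀ + 1)) ∈ Submodule.span k (Set.range n) := by rw [hs]; exact hx
    have h2 := Submodule.mem_map_of_mem (f := (F1L H (d + 3 * c₀ + 1)).subtype) this
    rw [Submodule.map_span] at h2
    have h3 : Submodule.span k ((F1L H (d + 3 * c₀ + 1)).subtype '' Set.range n) ≤
        (Ideal.span (Set.range fun j => (n j : O))).restrictScalars k := by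
      rw [Submodule.span_le]; rintro _ ⟨_, ⟨j, rfl⟩, rfl⟩
      exact Ideal.subset_span ⟨j, rfl⟩
    exact h3 h2

theorem F1_main (m : ℕ) (hm : ((m + 2 : ℕ) : k) ≠ 0) :
    ∃ Ωs : Set M, Ωs.Finite ∧ ∀ a : M, a ≠ 0 → F1C O (m+2) a → ∃ ω ∈ Ωs, ∃ c : M, c ≠ 0 ∧ a = ω * c ^ (m+2) := by
  classical
  have hτ : ∀ d : ℕ, ∃ τ : O, (∃ x : O, w (algebraMap O M x) = exp (d:ℤ)) → w (algebraMap O M τ) = exp (d:ℤ) := by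
    intro d
    by_cases h : ∃ x : O, w (algebraMap O M x) = exp (d:ℤ)
    · exact ⟨h.choose, fun _ => h.choose_spec⟩
    · exact ⟨0, fun h' => absurd h' h⟩
  choose τ hτ using hτ
  let B := (m+2+1)*c₀+1
  let Ωs : Set M := ⋃ d ∈ {d : ℕ | d ≤ B ∧ ∃ x : O, w (algebraMap O M x) = exp (d:ℤ)},
    (fun b : F1L H (d-1) => algebraMap O M (τ d + b)) '' {b : F1L H (d-1) | ∃ I : Ideal O, F1G H m I (τ d + b)}
  refine ⟨Ωs, Set.Finite.biUnion ((Set.finite_le_nat B).subset fun d hd => hd.1) ?_, ?_⟩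
  · intro d hd
    exact (F1_fin1 H m hm (τ d) d (hτ d hd.2)).image _
  intro a ha hC
  obtain ⟨b, hb0, hbL, ⟨c, hc, hac⟩, I, hI, hmin⟩ := F1_min H (m+2) (by omega) a ha hC
  obtain ⟨d, hd⟩ := F1_deg H b hb0
  have hw := hτ d ⟨b, hd⟩
  have hdB : d ≤ B := by
    rw [F1_mem, hd, exp_le_exp] at hbL
    have : ((B:ℕ):ℤ) = ((m+2:ℕ)+1)*c₀+1 := by simp [B]
    omega
  have hτ0 : algebraMap O M (τ d) ≠ 0 := fun h => by rw [h, map_zero] at hw; exact exp_ne_zero hw.symm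
  obtain ⟨l, hl⟩ := F1_sub H (algebraMap O M b) (algebraMap O M (τ d)) hτ0 (by rw [hd, hw])
  have hl0 : l ≠ 0 := by
    rintro rfl
    rw [zero_smul, sub_zero, hd, hw] at hl
    exact lt_irrefl _ hl
  obtain ⟨μ, hμ⟩ := IsAlgClosed.exists_pow_nat_eq l (n := m+2) (by omega)
  have hμ0 : μ ≠ 0 := by rintro rfl; rw [zero_pow (by omega)] at hμ; exact hl0 hμ.symm
  have hu : IsUnit (algebraMap k O l⁻¹) := (IsUnit.mk0 _ (inv_ne_zero hl0)).map _
  let e : O := l⁻¹ • b - τ d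
  have he : e ∈ F1L H (d-1) := by
    rw [F1_lt, sub_add_cancel]
    have : algebraMap O M e = algebraMap k M l⁻¹ * (algebraMap O M b - l • algebraMap O M (τ d)) := by
      simp only [e, map_sub, F1_smul]
      rw [Algebra.smul_def, Algebra.smul_def, mul_sub, ← mul_assoc, ← map_mul, inv_mul_cancel₀ hl0, map_one, one_mul]
    rw [this, map_mul, H.d0 _ (inv_ne_zero hl0), one_mul, ← hw]
    exact hl
  have hte : τ d + e = algebraMap k O l⁻¹ * b := by simp [e, Algebra.smul_def]
  refine ⟨algebraMap O M (τ d + e), ?_, algebraMap k M μ * c, mul_ne_zero (by simpa using hμ0) hc, ?_⟩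
  · refine Set.mem_biUnion (x := d) ⟨hdB, b, hd⟩ ⟨⟨e, he⟩, ⟨I, ?_, hmin⟩, rfl⟩
    rw [← hI]
    show Ideal.span {τ d + e} = _
    rw [hte, mul_comm, Ideal.span_singleton_mul_right_unit hu]
  · rw [hte, map_mul, ← IsScalarTower.algebraMap_apply, hac, mul_pow, ← map_pow, hμ, map_inv₀]
    have : algebraMap k M l ≠ 0 := by simpa using hl0
    field_simp
end F2d
end MF2d

section MF3
open WithZero Polynomial
set_option linter.unusedSectionVars false

theorem F3_val {k M : Type*} [Field k] [Field M] [Algebra k M] [Algebra k[X] M] [IsScalarTower k k[X] M]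
    (v : Valuation M (WithZero (Multiplicative ℤ))) (h0 : ∀ l : k, v (algebraMap k M l) ≤ 1)
    (ht : v (algebraMap k[X] M X) ≤ 1) (x : M) (hx : IsIntegral k[X] x) : v x ≤ 1 := by
  have h1 : ∀ p : k[X], algebraMap k[X] M p ∈ v.integer := by
    intro p
    induction p using Polynomial.induction_on' with
    | add p q hp hq => rw [map_add]; exact add_mem hp hq
    | monomial n a =>
      rw [← C_mul_X_pow_eq_monomial, map_mul, map_pow]
      refine mul_mem ?_ (pow_mem (show v _ ≤ 1 from ht) _)
      rw [← Polynomial.algebraMap_eq, ← IsScalarTower.algebraMap_apply]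
      exact h0 a
  let g : k[X] →+* v.integer := (algebraMap k[X] M).codRestrict v.integer h1
  refine Valuation.Integers.mem_of_integral (Valuation.integer.integers v) ?_
  obtain ⟨P, hP, h⟩ := hx
  refine ⟨P.map g, hP.map g, ?_⟩
  rw [eval₂_map]; exact h

section F3
open IsDedekindDomain
variable {k M O : Type*} [Field k] [IsAlgClosed k] [Field M] [CommRing O] [IsDedekindDomain O] [Algebra k M]
  [Algebra k[X] O] [Module.Finite k[X] O] [Module.Free k[X] O] [Algebra O M] [IsFractionRing O M]
  [Algebra k O] [IsScalarTower k k[X] O] [IsScalarTower k O M] [Algebra k[X] M] [IsScalarTower k k[X] M]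

theorem F3_fin (I : Ideal O) (hI : I ≠ ⊥) : Module.Finite k (O ⧸ I) := by
  classical
  let b := Module.Free.chooseBasis k[X] O
  exact Module.Finite.equiv (Ideal.quotientEquivDirectSum k b hI).symm

theorem F3_dim (hX : algebraMap k[X] O X ≠ 0) : Module.finrank k (O ⧸ Ideal.span {algebraMap k[X] O X}) = Module.finrank k[X] O := by
  classical
  rw [finrank_quotient_span_eq_natDegree_norm (Module.Free.chooseBasis k[X] O) hX, Algebra.norm_algebraMap]
  simp

theorem F3_k (v : HeightOneSpectrum O) (l : k) : v.valuation M (algebraMap k M l) ≤ 1 := by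
  rw [IsScalarTower.algebraMap_apply k O M]; exact v.valuation_le_one _

theorem F3_int (hs : algebraMap O M (algebraMap k[X] O X) * algebraMap k[X] M X = 1) (x : M) (hx : IsIntegral k[X] x) :
    ∃ c : ℕ, ∃ y : O, algebraMap O M y = algebraMap O M (algebraMap k[X] O X) ^ c * x := by
  set s := algebraMap k[X] O X with hsd
  have hs0 : s ≠ 0 := by intro h; rw [h, map_zero, zero_mul] at hs; exact zero_ne_one hs
  have hfin : {v : HeightOneSpectrum O | v.asIdeal ∣ Ideal.span {s}}.Finite :=
    Ideal.finite_factors (by simpa using hs0)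
  have h1 : ∀ v : HeightOneSpectrum O, v.asIdeal ∣ Ideal.span {s} → ∃ c : ℕ, ∀ n ≥ c, v.valuation M (algebraMap O M s ^ n * x) ≤ 1 := by
    intro v hv
    have hv1 : v.valuation M (algebraMap O M s) < 1 := (v.valuation_lt_one_iff_dvd s).2 hv
    have hv0 : v.valuation M (algebraMap O M s) ≠ 0 := (Valuation.ne_zero_iff _).2 (by simpa using hs0)
    by_cases hx0 : x = 0
    · exact ⟨0, by simp [hx0]⟩
    have hx0' : v.valuation M x ≠ 0 := (Valuation.ne_zero_iff _).2 hx0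
    refine ⟨(log (v.valuation M x)).toNat, fun n hn => ?_⟩
    rw [map_mul, map_pow, ← exp_log hv0, ← exp_log hx0', ← exp_nsmul, ← exp_add, ← exp_zero, exp_le_exp]
    rw [← exp_log hv0, ← exp_zero, exp_lt_exp] at hv1
    have h2 : log (v.valuation M (algebraMap O M s)) ≤ -1 := by omega
    have h3 : log (v.valuation M x) ≤ n := by omega
    rw [nsmul_eq_mul]
    nlinarith
  choose! c hc using h1
  obtain ⟨C, hC⟩ := (hfin.image c).bddAbove
  refine ⟨C, HeightOneSpectrum.mem_integers_of_valuation_le_one M _ fun v => ?_⟩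
  by_cases hv : v.asIdeal ∣ Ideal.span {s}
  · exact hc v hv C (hC ⟨v, hv, rfl⟩)
  · have hv1 : v.valuation M (algebraMap O M s) = 1 :=
      le_antisymm (v.valuation_le_one s) (not_lt.1 fun h => hv ((v.valuation_lt_one_iff_dvd s).1 h))
    rw [map_mul, map_pow, hv1, one_pow, one_mul]
    refine F3_val (k := k) _ (F3_k v) ?_ x hx
    have := congrArg (v.valuation M) hs
    rw [map_mul, hv1, one_mul, map_one] at this
    exact this.le

theorem F3_bound (s : O) (hs0 : s ≠ 0) (v : HeightOneSpectrum O) (K : Ideal O) (hK : Ideal.span {s} = v.asIdeal * K)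
    (m : ℕ) (x : M) (y : O) (hy : y ∈ K ^ m) (hxy : algebraMap O M s ^ m * x = algebraMap O M y) :
    (∀ v' : HeightOneSpectrum O, v' ≠ v → v'.valuation M x ≤ 1) ∧ v.valuation M x ≤ exp (m : ℤ) := by
  have hs0' : algebraMap O M s ≠ 0 := by simpa using hs0
  have key : ∀ (v' : HeightOneSpectrum O), ∀ π ∈ v.asIdeal, v'.valuation M x * (v'.valuation M (algebraMap O M π)) ^ m ≤ 1 := by
    intro v' π hπ
    have : π ^ m * y ∈ Ideal.span {s ^ m} := by
      rw [← Ideal.span_singleton_pow, hK, mul_pow]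
      exact Ideal.mul_mem_mul (Ideal.pow_mem_pow hπ m) hy
    obtain ⟨r, hr⟩ := Ideal.mem_span_singleton.1 this
    have h2 := congrArg (algebraMap O M) hr
    rw [map_mul, map_mul, map_pow, map_pow, ← hxy] at h2
    have h3 : x * (algebraMap O M π) ^ m = algebraMap O M r := by
      apply mul_left_cancel₀ (pow_ne_zero m hs0')
      linear_combination h2
    rw [← map_pow, ← map_mul, h3]
    exact v'.valuation_le_one r
  constructor
  · intro v' hv'
    have : ¬ v.asIdeal ≤ v'.asIdeal := fun h => hv' (HeightOneSpectrum.ext (v.isMaximal.eq_of_le v'.isPrime.ne_top h)).symm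
    obtain ⟨π, hπ, hπ'⟩ := SetLike.not_le_iff_exists.1 this
    have h1 := key v' π hπ
    rw [(HeightOneSpectrum.valuation_eq_one_iff_notMem (K := M) v').2 hπ', one_pow, mul_one] at h1
    exact h1
  · obtain ⟨π, hπ⟩ := v.intValuation_exists_uniformizer
    have h1 := key v π ((v.intValuation_lt_one_iff_mem π).1 (by rw [hπ, ← exp_zero, exp_lt_exp]; omega))
    rw [HeightOneSpectrum.valuation_of_algebraMap, hπ] at h1
    by_cases hx : v.valuation M x = 0
    · rw [hx]; exact zero_le
    rw [← exp_log hx, ← exp_nsmul, ← exp_add, ← exp_zero, exp_le_exp] at h1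
    rw [← exp_log hx, exp_le_exp]
    simp at h1; linarith

theorem F3_count (hs : algebraMap O M (algebraMap k[X] O X) * algebraMap k[X] M X = 1)
    (v : HeightOneSpectrum O) (K : Ideal O) (hK : Ideal.span {algebraMap k[X] O X} = v.asIdeal * K)
    {ι : Type*} [Fintype ι] (ω : ι → M) (hω : LinearIndependent k[X] ω) (hωi : ∀ i, IsIntegral k[X] (ω i))
    (hN : Fintype.card ι = Module.finrank k[X] O) (n : ℕ) :
    ∃ g : ℕ, ∀ m : ℕ, ∃ U : Submodule k M, Module.Finite k U ∧ m ≤ Module.finrank k U + g ∧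
      ∀ x ∈ U, IsIntegral k[X] x ∧ ∃ y ∈ K ^ m, algebraMap O M (algebraMap k[X] O X) ^ m * x =
        algebraMap O M (algebraMap k[X] O X) ^ n * algebraMap O M y := by
  set s := algebraMap k[X] O X with hsd
  set t := algebraMap k[X] M X with htd
  have hs0 : s ≠ 0 := by intro h; rw [h, map_zero, zero_mul] at hs; exact zero_ne_one hs
  have hs0' : algebraMap O M s ≠ 0 := by simpa using hs0
  have hsp0 : Ideal.span {s} ≠ ⊥ := by simpa using hs0
  have hK0 : K ≠ ⊥ := by rintro rfl; rw [Ideal.mul_bot] at hK; exact hsp0 hK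
  have hdK : Module.finrank k (O ⧸ K) + 1 = Fintype.card ι := by
    rw [hN, ← F3_dim (k := k) hs0, ← hsd, hK, F1_prime F3_fin v.asIdeal K v.isPrime v.ne_bot hK0]
  have hc : ∃ c : ℕ, ∀ i, ∃ y : O, algebraMap O M y = algebraMap O M s ^ c * ω i := by
    choose c y hy using fun i => F3_int hs (ω i) (hωi i)
    refine ⟨Finset.univ.sup c, fun i => ⟨s ^ (Finset.univ.sup c - c i) * y i, ?_⟩⟩
    have : c i ≤ Finset.univ.sup c := Finset.le_sup (Finset.mem_univ i)
    rw [map_mul, map_pow, hy, ← mul_assoc, ← pow_add, Nat.sub_add_cancel this]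
  obtain ⟨c, hc⟩ := hc
  choose o ho using hc
  refine ⟨(c + n) * Fintype.card ι, fun m => ?_⟩
  let Q : Ideal O := Ideal.span {s} ^ (c + n) * K ^ m
  have hQ0 : Q ≠ ⊥ := mul_ne_zero (pow_ne_zero _ hsp0) (pow_ne_zero _ hK0)
  have hQd : Module.finrank k (O ⧸ Q) = (c+n) * Fintype.card ι + m * Module.finrank k (O ⧸ K) := by
    rw [F1_mul F3_fin _ _ (pow_ne_zero _ hsp0) (pow_ne_zero _ hK0), F1_pow F3_fin _ hsp0, F1_pow F3_fin _ hK0,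
      F3_dim hs0, hN]
  have hQf : Module.Finite k (O ⧸ Q) := F3_fin Q hQ0
  let φM : (ι × Fin (m+1) → k) →ₗ[k] M := Fintype.linearCombination k (fun ij => t ^ (ij.2 : ℕ) * ω ij.1)
  let φO : (ι × Fin (m+1) → k) →ₗ[k] O := Fintype.linearCombination k (fun ij => s ^ (m - (ij.2:ℕ)) * o ij.1)
  have hφ : ∀ α, algebraMap O M (φO α) = algebraMap O M s ^ (m + c) * φM α := by
    intro α
    simp only [φO, φM, Fintype.linearCombination_apply, map_sum, Finset.mul_sum]
    refine Finset.sum_congr rfl fun ij _ => ?_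
    rw [F1_smul, map_mul, map_pow, ho, mul_smul_comm]
    congr 1
    have h1 : algebraMap O M s ^ (m + c) = algebraMap O M s ^ (m - (ij.2:ℕ)) * algebraMap O M s ^ (ij.2:ℕ) * algebraMap O M s ^ c := by
      rw [← pow_add, ← pow_add]; congr 1; omega
    have h2 : algebraMap O M s ^ (ij.2:ℕ) * t ^ (ij.2:ℕ) = 1 := by rw [← mul_pow, hs, one_pow]
    rw [h1]
    linear_combination (-(algebraMap O M s)^(m - (ij.2:ℕ)) * algebraMap O M s ^ c * ω ij.1) * h2
  have hφinj : Function.Injective φM := by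
    rw [← LinearMap.ker_eq_bot, LinearMap.ker_eq_bot']
    intro α hα
    have h1 : ∑ i, (∑ j : Fin (m+1), C (α (i, j)) * X ^ (j:ℕ) : k[X]) • ω i = 0 := by
      rw [← hα]
      simp only [φM, Fintype.linearCombination_apply, Fintype.sum_prod_type, Finset.sum_smul]
      refine Finset.sum_congr rfl fun i _ => Finset.sum_congr rfl fun j _ => ?_
      rw [Algebra.smul_def, map_mul, map_pow, ← Polynomial.algebraMap_eq, ← IsScalarTower.algebraMap_apply, Algebra.smul_def, mul_assoc]
    have h2 := (Fintype.linearIndependent_iff.1 hω) _ h1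
    ext ⟨i, j⟩
    have h3 := congrArg (fun p => coeff p (j:ℕ)) (h2 i)
    simp only [finsetSum_coeff, coeff_C_mul, coeff_X_pow, coeff_zero] at h3
    rw [Finset.sum_eq_single j] at h3
    · simpa using h3
    · intro b _ hb
      rw [if_neg (fun h => hb (Fin.ext h.symm)), mul_zero]
    · simp
  let ψ : (ι × Fin (m+1) → k) →ₗ[k] (O ⧸ Q) := (Ideal.Quotient.mkₐ k Q).toLinearMap ∘ₗ φO
  refine ⟨(LinearMap.ker ψ).map φM, inferInstance, ?_, ?_⟩
  · rw [← LinearEquiv.finrank_eq (Submodule.equivMapOfInjective φM hφinj _)]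
    have h1 := LinearMap.finrank_range_add_finrank_ker ψ
    have h2 := Submodule.finrank_le (LinearMap.range ψ)
    rw [hQd] at h2
    rw [Module.finrank_fintype_fun_eq_card, Fintype.card_prod, Fintype.card_fin] at h1
    have h3 : m * Fintype.card ι = m * Module.finrank k (O ⧸ K) + m := by rw [← hdK]; ring
    nlinarith
  · rintro _ ⟨α, hα, rfl⟩
    have hα : φO α ∈ Q := by
      rw [← Ideal.Quotient.eq_zero_iff_mem]; exact hα
    constructor
    · simp only [φM, Fintype.linearCombination_apply]
      refine IsIntegral.sum _ fun ij _ => ?_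
      have : α ij • (t ^ (ij.2 : ℕ) * ω ij.1) = algebraMap k[X] M (C (α ij) * X ^ (ij.2:ℕ)) * ω ij.1 := by
        rw [map_mul, map_pow, ← Polynomial.algebraMap_eq, ← IsScalarTower.algebraMap_apply, Algebra.smul_def, mul_assoc]
      rw [this]
      exact isIntegral_algebraMap.mul (hωi _)
    · simp only [Q] at hα
      rw [Ideal.span_singleton_pow, Ideal.mem_span_singleton_mul] at hα
      obtain ⟨y, hy, hy'⟩ := hα
      refine ⟨y, hy, ?_⟩
      have := hφ α
      rw [← hy', map_mul, map_pow, pow_add, pow_add] at this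
      apply mul_left_cancel₀ (pow_ne_zero c hs0')
      linear_combination -this
end F3
end MF3

section MF4
open WithZero Polynomial
set_option linter.unusedSectionVars false

theorem F4_ded {k O M : Type*} [Field k] [CommRing O] [IsDomain O] [Field M] [Algebra k O] [Algebra O M] [Algebra k M]
    [IsScalarTower k O M] [IsFractionRing O M] {w : Valuation M (WithZero (Multiplicative ℤ))} {c₀ : ℕ}
    (H : F1H k O M w c₀) (hint : ∀ x : M, IsIntegral O x → ∃ y : O, algebraMap O M y = x) : IsDedekindDomain O := by
  have : FaithfulSMul O M := (faithfulSMul_iff_algebraMap_injective O M).2 (IsFractionRing.injective O M)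
  have h1 : IsNoetherianRing O := by
    rw [isNoetherianRing_iff_ideal_fg]
    intro I
    by_cases hI : I = ⊥
    · rw [hI]; exact Submodule.fg_bot
    obtain ⟨x, hx, hx0⟩ := Submodule.exists_mem_ne_zero_of_ne_bot hI
    have hf : Module.Finite k (O ⧸ Ideal.span {x}) := F1_quot_fin H _ (by simpa using hx0)
    have hn : IsNoetherian O (O ⧸ Ideal.span {x}) := isNoetherian_of_tower k inferInstance
    refine Submodule.fg_of_fg_map_of_fg_inf_ker (Submodule.mkQ (Ideal.span {x})) (IsNoetherian.noetherian _) ?_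
    rw [Submodule.ker_mkQ, inf_eq_right.2 (by rw [Ideal.span_le]; simpa using hx)]
    exact ⟨{x}, by simp [Ideal.span]⟩
  have h2 : Ring.DimensionLEOne O := by
    constructor
    intro P hP hPp
    have hf : Module.Finite k (O ⧸ P) := F1_quot_fin H P hP
    exact Ideal.Quotient.maximal_of_isField _ (isField_of_isIntegral_of_isField' (R := k) (Field.toIsField k))
  have h3 : IsIntegrallyClosed O := (isIntegrallyClosed_iff M).2 fun {x} hx => hint x hx
  have : IsDedekindRing O := IsDedekindRing.mk
  exact IsDedekindDomain.mk

theorem F4_rank {k M : Type*} [Field k] [Field M] [Algebra k M] (w : Valuation M (WithZero (Multiplicative ℤ)))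
    (d0 : ∀ l : k, w (algebraMap k M l) ≤ 1)
    (d1 : ∀ x : M, w x ≤ 1 → ∃ l : k, w (x - algebraMap k M l) < 1) (D : Finset ℤ) :
    ∀ (U : Submodule k M), Module.Finite k U →
    (∀ x ∈ U, x ≠ 0 → ∃ d ∈ D, w x = exp d) → Module.finrank k U ≤ D.card := by
  induction D using Finset.induction_on_max with
  | empty =>
    intro U _ h
    have : U = ⊥ := by
      rw [Submodule.eq_bot_iff]; intro x hx
      by_contra h0
      obtain ⟨d, hd, _⟩ := h x hx h0
      simp at hd
    rw [this]; simp
  | insert a D' ha ih =>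
    intro U hU h
    have haD : a ∉ D' := fun h => lt_irrefl _ (ha a h)
    rw [Finset.card_insert_of_notMem haD]
    by_cases hy : ∃ y ∈ U, w y = exp a
    · obtain ⟨y, hyU, hy⟩ := hy
      let U' : Submodule k M :=
        { carrier := {x | x ∈ U ∧ w x < exp a}
          add_mem' := fun {x z} hx hz => ⟨U.add_mem hx.1 hz.1, (w.map_add _ _).trans_lt (max_lt hx.2 hz.2)⟩
          zero_mem' := ⟨U.zero_mem, by rw [map_zero]; exact exp_pos⟩
          smul_mem' := fun c x hx => ⟨U.smul_mem c hx.1, by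
            rw [Algebra.smul_def, map_mul]
            exact (mul_le_of_le_one_left' (d0 c)).trans_lt hx.2⟩ }
      have hU' : U' ≤ U := fun x hx => hx.1
      have hfU' : Module.Finite k U' := Submodule.finiteDimensional_of_le hU'
      have h1 := ih U' hfU' (fun x hx hx0 => by
        obtain ⟨d, hd, hxd⟩ := h x hx.1 hx0
        rcases Finset.mem_insert.1 hd with rfl | hd
        · exact absurd hx.2 (by rw [hxd]; exact lt_irrefl _)
        · exact ⟨d, hd, hxd⟩)
      have h2 : U ≤ U' ⊔ Submodule.span k {y} := by
        intro x hx
        have hy0 : w y ≠ 0 := by rw [hy]; exact exp_ne_zero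
        have hxy : w x ≤ w y := by
          by_cases hx0 : x = 0
          · rw [hx0, map_zero]; exact zero_le
          obtain ⟨d, hd, hxd⟩ := h x hx hx0
          rw [hxd, hy, exp_le_exp]
          rcases Finset.mem_insert.1 hd with rfl | hd
          · exact le_rfl
          · exact (ha d hd).le
        obtain ⟨l, hl⟩ := d1 (x / y) (by rw [map_div₀]; exact div_le_one_of_le₀ hxy zero_le)
        have hy1 : y ≠ 0 := (Valuation.ne_zero_iff _).1 hy0
        have e : x - l • y = (x / y - algebraMap k M l) * y := by
          rw [Algebra.smul_def]; field_simp
        have : x - l • y ∈ U' := by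
          refine ⟨U.sub_mem hx (U.smul_mem l hyU), ?_⟩
          rw [e, map_mul, ← hy]
          exact mul_lt_of_lt_one_left (zero_lt_iff.2 hy0) hl
        rw [show x = (x - l • y) + l • y by ring]
        exact Submodule.add_mem_sup this (Submodule.smul_mem _ _ (Submodule.mem_span_singleton_self y))
      have h3 := Submodule.finrank_mono h2
      have h4 := Submodule.finrank_add_le_finrank_add_finrank U' (Submodule.span k {y})
      have h5 : Module.finrank k (Submodule.span k {y}) ≤ 1 := by
        simpa using finrank_span_le_card (R := k) ({y} : Set M)
      omega
    · push Not at hy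
      have := ih U hU (fun x hx hx0 => by
        obtain ⟨d, hd, hxd⟩ := h x hx hx0
        rcases Finset.mem_insert.1 hd with rfl | hd
        · exact absurd hxd (hy x hx)
        · exact ⟨d, hd, hxd⟩)
      omega

section F4
open IsDedekindDomain
variable {k M O : Type*} [Field k] [IsAlgClosed k] [Field M] [CommRing O] [IsDedekindDomain O] [Algebra k M]
  [Algebra k[X] O] [Module.Finite k[X] O] [Module.Free k[X] O] [Algebra O M] [IsFractionRing O M]
  [Algebra k O] [IsScalarTower k k[X] O] [IsScalarTower k O M] [Algebra k[X] M] [IsScalarTower k k[X] M]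

def F4O (v : HeightOneSpectrum O) : Subalgebra k M where
  carrier := {x | IsIntegral k[X] x ∧ ∀ v' : HeightOneSpectrum O, v' ≠ v → v'.valuation M x ≤ 1}
  add_mem' {x y} hx hy := ⟨hx.1.add hy.1, fun v' h => ((v'.valuation M).map_add _ _).trans (max_le (hx.2 v' h) (hy.2 v' h))⟩
  mul_mem' {x y} hx hy := ⟨hx.1.mul hy.1, fun v' h => by rw [map_mul]; exact mul_le_one' (hx.2 v' h) (hy.2 v' h)⟩
  algebraMap_mem' l := ⟨by rw [IsScalarTower.algebraMap_apply k k[X] M]; exact isIntegral_algebraMap, fun v' _ => F3_k v' l⟩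

theorem F4_int (v : HeightOneSpectrum O) (x : M) (hx : IsIntegral (F4O (k := k) (M := M) v) x) :
    ∃ y : F4O (k := k) (M := M) v, algebraMap (F4O (k := k) (M := M) v) M y = x := by
  refine ⟨⟨x, ?_, fun v' hv' => ?_⟩, rfl⟩
  · have : IsIntegral (integralClosure k[X] M) x := by
      let g : F4O (k := k) (M := M) v →+* (integralClosure k[X] M).toSubring :=
        (algebraMap (F4O (k := k) (M := M) v) M).codRestrict _ (fun z => z.2.1)
      obtain ⟨P, hP, h⟩ := hx
      refine ⟨P.map g, hP.map g, ?_⟩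
      rw [eval₂_map]; exact h
    exact isIntegral_trans x this
  · let g : F4O (k := k) (M := M) v →+* (v'.valuation M).integer :=
        (algebraMap (F4O (k := k) (M := M) v) M).codRestrict _ (fun z => z.2.2 v' hv')
    refine Valuation.Integers.mem_of_integral (Valuation.integer.integers (v'.valuation M)) ?_
    obtain ⟨P, hP, h⟩ := hx
    refine ⟨P.map g, hP.map g, ?_⟩
    rw [eval₂_map]; exact h

theorem F4_d1 (v : HeightOneSpectrum O) (x : M) (hx : v.valuation M x ≤ 1) :
    ∃ l : k, v.valuation M (x - algebraMap k M l) < 1 := by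
  obtain ⟨a, ha⟩ := v.exists_valuation_sub_lt_of_integer hx 1
  have hf : Module.Finite k (O ⧸ v.asIdeal) := F3_fin _ v.ne_bot
  have := v.isPrime
  obtain ⟨l, hl⟩ := (IsAlgClosed.algebraMap_bijective_of_isIntegral (k := k) (K := O ⧸ v.asIdeal)).2 (Ideal.Quotient.mk _ a)
  refine ⟨l, ?_⟩
  have h2 : a - algebraMap k O l ∈ v.asIdeal := by
    rw [← Ideal.Quotient.eq, ← hl]; rfl
  have h3 := (v.valuation_lt_one_iff_mem (K := M) _).2 h2
  have : x - algebraMap k M l = -(algebraMap O M a - x) + algebraMap O M (a - algebraMap k O l) := by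
    rw [map_sub, ← IsScalarTower.algebraMap_apply]; ring
  rw [this]
  refine (Valuation.map_add _ _ _).trans_lt (max_lt ?_ h3)
  rw [Valuation.map_neg]; simpa using ha

theorem F4_main (hs : algebraMap O M (algebraMap k[X] O X) * algebraMap k[X] M X = 1)
    {ι : Type*} [Fintype ι] (ω : ι → M) (hω : LinearIndependent k[X] ω) (hωi : ∀ i, IsIntegral k[X] (ω i))
    (hN : Fintype.card ι = Module.finrank k[X] O)
    (hfrac : ∀ x : M, ∃ p q : M, IsIntegral k[X] p ∧ IsIntegral k[X] q ∧ q ≠ 0 ∧ x = p / q)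
    (hconst : ∀ x : O, IsIntegral k[X] (algebraMap O M x) → ∃ l : k, algebraMap O M x = algebraMap k M l) :
    ∃ (O₁ : Subalgebra k M) (_ : IsDedekindDomain O₁) (_ : IsFractionRing O₁ M)
      (w : Valuation M (WithZero (Multiplicative ℤ))) (c₀ : ℕ), F1H k O₁ M w c₀ := by
  have hs0 : algebraMap k[X] O X ≠ 0 := by intro h; rw [h, map_zero, zero_mul] at hs; exact zero_ne_one hs
  have hsu : Ideal.span {algebraMap k[X] O X} ≠ ⊤ := by
    intro h
    have h1 := F3_dim (k := k) hs0
    rw [h] at h1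
    have h2 : Module.finrank k (O ⧸ (⊤ : Ideal O)) = 0 := Module.finrank_zero_of_subsingleton
    rw [h2, ← hN] at h1
    have : IsEmpty ι := Fintype.card_eq_zero_iff.1 h1.symm
    have h3 : Subsingleton O := by
      have : Module.rank k[X] O = 0 := by
        rw [← Module.finrank_eq_rank, ← hN, ← h1]; simp
      exact rank_zero_iff.1 this
    exact hs0 (Subsingleton.elim _ _)
  obtain ⟨P, hP, hsP⟩ := Ideal.exists_le_maximal _ hsu
  have hP0 : P ≠ ⊥ := by
    rintro rfl
    exact hs0 (by simpa using hsP)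
  let v : HeightOneSpectrum O := ⟨P, hP.isPrime, hP0⟩
  obtain ⟨K, hK⟩ : v.asIdeal ∣ Ideal.span {algebraMap k[X] O X} := Ideal.dvd_iff_le.2 hsP
  have hs0' : algebraMap O M (algebraMap k[X] O X) ≠ 0 := by simpa using hs0
  have hconst' : ∀ x ∈ F4O (k := k) (M := M) v, v.valuation M x < 1 → x = 0 := by
    intro x hx hv
    obtain ⟨y, rfl⟩ := HeightOneSpectrum.mem_integers_of_valuation_le_one (R := O) M x (fun v' => by
      by_cases h : v' = v
      · rw [h]; exact hv.le
      · exact hx.2 v' h)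
    obtain ⟨l, hl⟩ := hconst y hx.1
    rw [hl] at hv ⊢
    by_contra h0
    have h1 := F3_k (M := M) v l⁻¹
    rw [map_inv₀, map_inv₀] at h1
    have h2 : v.valuation M (algebraMap k M l) ≠ 0 := (Valuation.ne_zero_iff _).2 h0
    have := (inv_le_one₀ (zero_lt_iff.2 h2)).1 h1
    exact absurd hv (not_lt.2 this)
  have hdeg : ∀ x ∈ F4O (k := k) (M := M) v, x ≠ 0 → ∃ d : ℕ, v.valuation M x = exp (d:ℤ) := by
    intro x hx hx0
    have h0 : v.valuation M x ≠ 0 := (Valuation.ne_zero_iff _).2 hx0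
    have h1 : ¬ v.valuation M x < 1 := fun h => hx0 (hconst' x hx h)
    rw [← exp_log h0, ← exp_zero, exp_lt_exp] at h1
    exact ⟨(log (v.valuation M x)).toNat, by rw [Int.toNat_of_nonneg (by omega), exp_log h0]⟩
  -- fraction field
  have hF : IsFractionRing (F4O (k := k) (M := M) v) M := by
    have key : ∀ y : M, IsIntegral k[X] y → ∃ a b : F4O (k := k) (M := M) v, (b : M) ≠ 0 ∧ y = (a:M) / b := by
      intro y hy
      obtain ⟨n, z, hz⟩ := F3_int hs y hy
      obtain ⟨g, hg⟩ := F3_count hs v K hK ω hω hωi hN n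
      obtain ⟨U, hU, hUd, hU1⟩ := hg (g+1)
      have : U ≠ ⊥ := by
        rintro rfl
        simp at hUd
      obtain ⟨u, hu, hu0⟩ := Submodule.exists_mem_ne_zero_of_ne_bot this
      obtain ⟨hui, y₀, hy₀, huy⟩ := hU1 u hu
      have b1 := F3_bound (M := M) _ hs0 v K hK (g+1) u (algebraMap k[X] O X ^ n * y₀) (Ideal.mul_mem_left _ _ hy₀) (by
        rw [huy, map_mul, map_pow])
      have b2 := F3_bound (M := M) _ hs0 v K hK (g+1) (u*y) (z * y₀) (Ideal.mul_mem_left _ _ hy₀) (by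
        rw [← mul_assoc, huy, map_mul, hz]; ring)
      exact ⟨⟨u*y, hui.mul hy, b2.1⟩, ⟨u, hui, b1.1⟩, hu0, by field_simp⟩
    apply IsFractionRing.of_field
    intro z
    obtain ⟨p, q, hp, hq, hq0, rfl⟩ := hfrac z
    obtain ⟨a, b, hb, rfl⟩ := key p hp
    obtain ⟨c, d, hd, rfl⟩ := key q hq
    refine ⟨a * d, b * c, ?_⟩
    have hc : (c : M) ≠ 0 := fun h => hq0 (by rw [h, zero_div])
    rw [map_mul, map_mul]
    change (a:M)/b/((c:M)/d) = a * d/(b*c)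
    field_simp
  -- d3
  obtain ⟨g, hg⟩ := F3_count hs v K hK ω hω hωi hN 0
  let D : Set ℕ := {d | ∃ x : F4O (k := k) (M := M) v, v.valuation M (x : M) = exp (d:ℤ)}
  have hD : Dᶜ.Finite := by
    by_contra hinf
    obtain ⟨B, hB, hBc⟩ := Set.Infinite.exists_subset_card_eq hinf (g + 2)
    classical
    let m := B.sup id
    obtain ⟨U, hU, hUd, hU1⟩ := hg m
    let R : Finset ℤ := (Finset.range (m+1) \ B).image (fun n : ℕ => (n:ℤ))
    have h1 := F4_rank (v.valuation M) (F3_k v) (F4_d1 v) R U hU (by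
      intro x hx hx0
      obtain ⟨hxi, y, hy, hxy⟩ := hU1 x hx
      rw [pow_zero, one_mul] at hxy
      obtain ⟨b1, b2⟩ := F3_bound (M := M) _ hs0 v K hK m x y hy hxy
      obtain ⟨d, hd⟩ := hdeg x ⟨hxi, b1⟩ hx0
      refine ⟨d, Finset.mem_image.2 ⟨d, ?_, rfl⟩, hd⟩
      rw [hd, exp_le_exp] at b2
      rw [Finset.mem_sdiff, Finset.mem_range]
      refine ⟨by omega, fun hdB => ?_⟩
      exact hB hdB ⟨⟨x, hxi, b1⟩, hd⟩)
    have h2 : R.card ≤ _ := Finset.card_image_le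
    have h3 : B ⊆ Finset.range (m+1) := fun b hb => by
      rw [Finset.mem_range]
      have : b ≤ m := Finset.le_sup (f := id) hb
      omega
    rw [Finset.card_sdiff_of_subset h3, Finset.card_range] at h2
    have h4 := Finset.card_le_card h3
    rw [Finset.card_range] at h4
    omega
  obtain ⟨c₀, hc₀⟩ := hD.bddAbove
  have H : F1H k (F4O (k := k) (M := M) v) M (v.valuation M) (c₀ + 1) := by
    refine ⟨fun l hl => ?_, F4_d1 v, fun x hx => ?_, fun n hn => ?_⟩
    · have h1 := F3_k (M := M) v l⁻¹
      rw [map_inv₀, map_inv₀] at h1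
      have h2 : v.valuation M (algebraMap k M l) ≠ 0 := (Valuation.ne_zero_iff _).2 (by simpa using hl)
      exact le_antisymm (F3_k v l) ((inv_le_one₀ (zero_lt_iff.2 h2)).1 h1)
    · exact Subtype.ext (hconst' x.1 x.2 hx)
    · by_contra h
      have : n ∈ Dᶜ := h
      have := hc₀ this
      omega
  exact ⟨F4O v, F4_ded H (F4_int v), hF, _, _, H⟩
end F4
end MF4

section MF5
open WithZero Polynomial
set_option linter.unusedSectionVars false
set_option linter.style.haveILetI false

theorem F5_G {k K : Type*} {M : Type*} [Field k] [Field K] [Field M] [Algebra K M] [FiniteDimensional K M] [Algebra.IsSeparable K M]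
    (i : k[X] →+* K) (hi : @IsFractionRing k[X] _ K _ i.toAlgebra) :
    ∃ (O : Subring M) (_ : IsDedekindDomain O) (_ : IsFractionRing O M) (_ : Algebra k[X] O) (_ : Module.Finite k[X] O)
      (_ : Module.Free k[X] O), (∀ x : k[X], ((algebraMap k[X] O x : O) : M) = algebraMap K M (i x)) ∧
      Module.finrank k[X] O = Module.finrank K M ∧ ∀ x : O, ∃ Q : k[X][X], minpoly K (x : M) = Q.map i := by
  letI : Algebra k[X] K := i.toAlgebra
  letI : Algebra k[X] M := ((algebraMap K M).comp i).toAlgebra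
  haveI : IsScalarTower k[X] K M := IsScalarTower.of_algebraMap_eq fun _ => rfl
  haveI : IsDedekindDomain (integralClosure k[X] M) := integralClosure.isDedekindDomain k[X] K M
  haveI : IsFractionRing (integralClosure k[X] M) M := IsIntegralClosure.isFractionRing_of_finite_extension k[X] K M _
  haveI : Module.Finite k[X] (integralClosure k[X] M) := IsIntegralClosure.finite k[X] K M _
  haveI : FaithfulSMul k[X] M := (faithfulSMul_iff_algebraMap_injective _ _).2
    ((algebraMap K M).injective.comp (IsFractionRing.injective k[X] K))
  haveI : Module.IsTorsionFree k[X] M := inferInstance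
  haveI : Module.Free k[X] (integralClosure k[X] M) := IsIntegralClosure.module_free k[X] K M _
  have h := IsIntegralClosure.rank k[X] K M (integralClosure k[X] M)
  refine ⟨(integralClosure k[X] M).toSubring, ‹_›, ‹_›, inferInstanceAs (Algebra k[X] (integralClosure k[X] M)), ‹_›, ‹_›, fun x => rfl, h, fun x => ?_⟩
  exact ⟨minpoly k[X] (x:M), minpoly.isIntegrallyClosed_eq_field_fractions' K x.2⟩

noncomputable def F5i (k : Type*) [Field k] : k[X] →+* RatFunc k := eval₂RingHom RatFunc.C (RatFunc.X)⁻¹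

theorem F5_ev {k : Type*} [Field k] (g : k[X]) : eval₂ (RatFunc.C (K := k)) (RatFunc.X : RatFunc k) g = algebraMap k[X] (RatFunc k) g := by
  induction g using Polynomial.induction_on' with
  | add p q hp hq => rw [eval₂_add, map_add, hp, hq]
  | monomial n a => rw [eval₂_monomial, ← C_mul_X_pow_eq_monomial, map_mul, map_pow, RatFunc.algebraMap_X, RatFunc.algebraMap_C]

theorem F5_rev {k : Type*} [Field k] (f : k[X]) :
    algebraMap k[X] (RatFunc k) f.reverse = F5i k f * RatFunc.X ^ f.natDegree := by
  letI : Invertible (RatFunc.X⁻¹ : RatFunc k) := invertibleOfNonzero (inv_ne_zero RatFunc.X_ne_zero)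
  have := eval₂_reverse_mul_pow (RatFunc.C (K := k)) (RatFunc.X⁻¹ : RatFunc k) f
  have h2 : ⅟ (RatFunc.X⁻¹ : RatFunc k) = RatFunc.X := by simp
  rw [h2, F5_ev] at this
  have e : F5i k f = eval₂ (RatFunc.C (K := k)) (RatFunc.X⁻¹ : RatFunc k) f := rfl
  rw [e, ← this, mul_assoc, ← mul_pow, inv_mul_cancel₀ RatFunc.X_ne_zero, one_pow, mul_one]

theorem F5_rev' {k : Type*} [Field k] (f : k[X]) :
    algebraMap k[X] (RatFunc k) f = F5i k f.reverse * RatFunc.X ^ f.natDegree := by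
  letI : Invertible (RatFunc.X : RatFunc k) := invertibleOfNonzero (RatFunc.X_ne_zero)
  have := eval₂_reverse_mul_pow (RatFunc.C (K := k)) (RatFunc.X : RatFunc k) f
  have h2 : ⅟ (RatFunc.X : RatFunc k) = RatFunc.X⁻¹ := by simp
  rw [h2, F5_ev] at this
  exact this.symm

theorem F5_crit {k K : Type*} [Field k] [Field K] (i : k[X] →+* K) (hi : Function.Injective i)
    (h : ∀ z : K, ∃ x y, z = i x / i y) : @IsFractionRing k[X] _ K _ i.toAlgebra := by
  letI : Algebra k[X] K := i.toAlgebra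
  haveI : FaithfulSMul k[X] K := (faithfulSMul_iff_algebraMap_injective _ _).2 hi
  exact IsFractionRing.of_field _ _ h

theorem F5_frac (k : Type*) [Field k] : @IsFractionRing k[X] _ (RatFunc k) _ (F5i k).toAlgebra := by
  have hX : F5i k X = RatFunc.X⁻¹ := by simp [F5i]
  apply F5_crit
  · rw [injective_iff_map_eq_zero]
    intro f hf
    have := F5_rev f
    rw [hf, zero_mul] at this
    have h2 : f.reverse = 0 := RatFunc.algebraMap_injective k (by rw [this, map_zero])
    simpa using h2
  · intro z
    obtain ⟨a, b, hb, rfl⟩ := IsFractionRing.div_surjective (A := k[X]) z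
    refine ⟨a.reverse * X ^ b.natDegree, b.reverse * X ^ a.natDegree, ?_⟩
    rw [F5_rev' a, F5_rev' b, map_mul, map_mul, map_pow, map_pow, hX]
    have : (RatFunc.X : RatFunc k) ≠ 0 := RatFunc.X_ne_zero
    rw [inv_pow, inv_pow]
    generalize h1 : (RatFunc.X : RatFunc k) ^ b.natDegree = u
    generalize h2 : (RatFunc.X : RatFunc k) ^ a.natDegree = w
    have hu : u ≠ 0 := h1 ▸ pow_ne_zero _ this
    have hw : w ≠ 0 := h2 ▸ pow_ne_zero _ this
    field_simp

theorem F5_const {k : Type*} [Field k] (p q : k[X]) (h : algebraMap k[X] (RatFunc k) p = F5i k q) : ∃ l : k, p = C l := by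
  have h1 := F5_rev q
  rw [← h, ← RatFunc.algebraMap_X, ← map_pow, ← map_mul] at h1
  have h2 := RatFunc.algebraMap_injective k h1
  refine ⟨p.coeff 0, eq_C_of_natDegree_eq_zero ?_⟩
  by_cases hp : p = 0
  · simp [hp]
  have h3 := reverse_natDegree_le q
  rw [h2, natDegree_mul_X_pow _ hp] at h3
  omega

section F5
open IsDedekindDomain
variable {k M : Type*} [Field k] [IsAlgClosed k] [Field M] [Algebra (RatFunc k) M] [FiniteDimensional (RatFunc k) M]
  [Algebra.IsSeparable (RatFunc k) M]

theorem F5_ded [Algebra k M] (hkM : ∀ l : k, algebraMap k M l = algebraMap (RatFunc k) M (RatFunc.C l)) :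
    ∃ (O₁ : Subalgebra k M) (_ : IsDedekindDomain O₁) (_ : IsFractionRing O₁ M)
      (w : Valuation M (WithZero (Multiplicative ℤ))) (c₀ : ℕ), F1H k O₁ M w c₀ := by
  letI : Algebra k[X] M := ((algebraMap (RatFunc k) M).comp (algebraMap k[X] (RatFunc k))).toAlgebra
  haveI : IsScalarTower k[X] (RatFunc k) M := IsScalarTower.of_algebraMap_eq fun _ => rfl
  have hXM : ∀ f : k[X], algebraMap k[X] M f = algebraMap (RatFunc k) M (algebraMap k[X] (RatFunc k) f) := fun _ => rfl
  haveI : IsScalarTower k k[X] M := IsScalarTower.of_algebraMap_eq fun l => by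
    rw [hkM, hXM, Polynomial.algebraMap_eq, RatFunc.algebraMap_C]
  obtain ⟨O, hD, hF, hA, hfin, hfree, hmap, hrank, hmin⟩ := F5_G (M := M) (F5i k) (F5_frac k)
  letI : Algebra k O := ((algebraMap k[X] O).comp C).toAlgebra
  haveI : IsScalarTower k k[X] O := IsScalarTower.of_algebraMap_eq fun l => rfl
  haveI : IsScalarTower k O M := IsScalarTower.of_algebraMap_eq fun l => by
    rw [hkM]
    change _ = ((algebraMap k[X] O (C l) : O) : M)
    rw [hmap]; simp [F5i]
  obtain ⟨s, b, hb⟩ := FiniteDimensional.exists_is_basis_integral k[X] (RatFunc k) M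
  haveI : FaithfulSMul k[X] M := (faithfulSMul_iff_algebraMap_injective _ _).2
    ((algebraMap (RatFunc k) M).injective.comp (IsFractionRing.injective k[X] (RatFunc k)))
  refine F4_main (k := k) (O := O) ?_ (fun i : s => b i) ?_ hb ?_ ?_ ?_
  · rw [hXM, show algebraMap O M (algebraMap k[X] O X) = algebraMap (RatFunc k) M (F5i k X) from hmap X, ← map_mul,
      RatFunc.algebraMap_X]
    simp [F5i, RatFunc.X_ne_zero]
  · exact (LinearIndependent.iff_fractionRing k[X] (RatFunc k)).2 b.linearIndependent
  · rw [hrank, Module.finrank_eq_card_basis b]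
  · intro x
    haveI : IsFractionRing (integralClosure k[X] M) M := IsIntegralClosure.isFractionRing_of_finite_extension k[X] (RatFunc k) M _
    obtain ⟨p, q, hq, rfl⟩ := IsFractionRing.div_surjective (A := integralClosure k[X] M) x
    exact ⟨p, q, p.2, q.2, fun h => nonZeroDivisors.ne_zero hq (Subtype.ext h), rfl⟩
  · intro x hx
    obtain ⟨Q, hQ⟩ := hmin x
    have hP := minpoly.isIntegrallyClosed_eq_field_fractions' (RatFunc k) hx
    have hco : ∀ n, ∃ l : k, (minpoly (RatFunc k) (x:M)).coeff n = RatFunc.C l := by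
      intro n
      have h1 : (minpoly (RatFunc k) (x:M)).coeff n = algebraMap _ _ ((minpoly k[X] (x:M)).coeff n) := by
        conv_lhs => rw [show (x:M) = algebraMap O M x from rfl, hP, coeff_map]
        rfl
      have h2 : (minpoly (RatFunc k) (x:M)).coeff n = F5i k (Q.coeff n) := by rw [hQ, coeff_map]
      obtain ⟨l, hl⟩ := F5_const _ _ (h1.symm.trans h2)
      exact ⟨l, by rw [h1, hl, RatFunc.algebraMap_C]⟩
    obtain ⟨R, hR⟩ : ∃ R : k[X], R.map RatFunc.C = minpoly (RatFunc k) (x:M) := by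
      rw [← Polynomial.mem_lifts, Polynomial.lifts_iff_coeff_lifts]
      intro n
      obtain ⟨l, hl⟩ := hco n
      exact ⟨l, hl.symm⟩
    have hxint : IsIntegral (RatFunc k) (x:M) := Algebra.IsIntegral.isIntegral _
    have hRm : R.Monic := by
      have := minpoly.monic hxint
      rw [← hR] at this
      exact Polynomial.monic_of_injective (f := RatFunc.C) RatFunc.C_injective this
    have hRx : IsIntegral k (x:M) := by
      refine ⟨R, hRm, ?_⟩
      have h := minpoly.aeval (RatFunc k) (x:M)
      rw [← hR, aeval_def, eval₂_map] at h
      rw [← h]; congr 1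
      ext l; exact hkM l
    obtain ⟨l, hl⟩ := minpoly.mem_range_of_degree_eq_one k (x:M) (IsAlgClosed.degree_eq_one_of_irreducible k (minpoly.irreducible hRx))
    exact ⟨l, hl.symm⟩
end F5
end MF5

section MF6
open WithZero Polynomial
set_option linter.unusedSectionVars false
set_option linter.style.haveILetI false

section F6
open IsDedekindDomain

theorem F6_bad {O M : Type*} [CommRing O] [IsDedekindDomain O] [Field M] [Algebra O M] [IsFractionRing O M] (z : M) (hz : z ≠ 0) :
    {v : HeightOneSpectrum O | v.valuation M z ≠ 1}.Finite := by
  obtain ⟨x, y, hy, rfl⟩ := IsFractionRing.div_surjective (A := O) z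
  have hx0 : x ≠ 0 := by rintro rfl; simp at hz
  have hy0 : y ≠ 0 := nonZeroDivisors.ne_zero hy
  refine ((Ideal.finite_factors (I := Ideal.span {x}) (by simpa using hx0)).union
    (Ideal.finite_factors (I := Ideal.span {y}) (by simpa using hy0))).subset ?_
  intro v hv
  by_contra h
  simp only [Set.mem_union, Set.mem_ofPred_eq, not_or] at h
  rw [← v.valuation_lt_one_iff_dvd (K := M), ← v.valuation_lt_one_iff_dvd (K := M), not_lt, not_lt] at h
  apply hv
  rw [map_div₀, le_antisymm (v.valuation_le_one x) h.1, le_antisymm (v.valuation_le_one y) h.2, div_one]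

variable {k M : Type*} [Field k] [IsAlgClosed k] [Field M] [Algebra (RatFunc k) M] [FiniteDimensional (RatFunc k) M]
  [Algebra.IsSeparable (RatFunc k) M]

/-- k-trivial valuation -/
def F6V (v : Valuation M (WithZero (Multiplicative ℤ))) : Prop := ∀ l : k, l ≠ 0 → v (algebraMap (RatFunc k) M (RatFunc.C l)) = 1

theorem F_thm (m : ℕ) (hm : ((m + 2 : ℕ) : k) ≠ 0) (S : Set M) (hS : S.Finite) (hS0 : ∀ z ∈ S, z ≠ 0) :
    ∃ Ωs : Set M, Ωs.Finite ∧ ∀ a : M, a ≠ 0 →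
      (∀ v : Valuation M (WithZero (Multiplicative ℤ)), F6V (k := k) v → (∀ z ∈ S, v z = 1) → ∃ n : ℤ, v a = exp ((m + 2) * n)) →
      ∃ ω ∈ Ωs, ∃ c : M, c ≠ 0 ∧ a = ω * c ^ (m+2) := by
  classical
  letI : Algebra k M := ((algebraMap (RatFunc k) M).comp RatFunc.C).toAlgebra
  obtain ⟨O, hD, hF, w, c₀, H⟩ := F5_ded (k := k) (M := M) (fun _ => rfl)
  obtain ⟨Ω₀, hΩ, hΩ1⟩ := F1_main H m hm
  have hB : {v : HeightOneSpectrum O | ∃ z ∈ S, v.valuation M z ≠ 1}.Finite := by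
    refine (hS.biUnion fun z hz => F6_bad (O := O) z (hS0 z hz)).subset ?_
    rintro v ⟨z, hz, hv⟩
    simp only [Set.mem_iUnion]
    exact ⟨z, hz, hv⟩
  haveI := hB.to_subtype
  let A : Set M := {a | a ≠ 0 ∧ ∀ v : Valuation M (WithZero (Multiplicative ℤ)), F6V (k := k) v → (∀ z ∈ S, v z = 1) → ∃ n : ℤ, v a = exp ((m + 2) * n)}
  let cl : M → ({v : HeightOneSpectrum O | ∃ z ∈ S, v.valuation M z ≠ 1} → ZMod (m+2)) :=
    fun a v => ((log (v.1.valuation M a) : ℤ) : ZMod (m+2))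
  have hr : ∀ c, ∃ a₀ : M, (∃ a ∈ A, cl a = c) → a₀ ∈ A ∧ cl a₀ = c := by
    intro c
    by_cases h : ∃ a ∈ A, cl a = c
    · obtain ⟨a, h⟩ := h; exact ⟨a, fun _ => h⟩
    · exact ⟨0, fun h' => absurd h' h⟩
  choose r hr using hr
  refine ⟨Set.image2 (· * ·) Ω₀ (Set.range r), hΩ.image2 _ (Set.finite_range r), fun a ha hav => ?_⟩
  have haA : a ∈ A := ⟨ha, hav⟩
  obtain ⟨h1, h2⟩ := hr (cl a) ⟨a, haA, rfl⟩
  set a₀ := r (cl a) with ha₀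
  obtain ⟨ω, hω, c, hc, hac⟩ := hΩ1 (a / a₀) (div_ne_zero ha h1.1) (by
    intro v
    have hv0 : v.valuation M a ≠ 0 := (Valuation.ne_zero_iff _).2 ha
    have hv0' : v.valuation M a₀ ≠ 0 := (Valuation.ne_zero_iff _).2 h1.1
    by_cases hv : ∃ z ∈ S, v.valuation M z ≠ 1
    · have h3 := congrFun h2 ⟨v, hv⟩
      simp only [cl] at h3
      rw [eq_comm, ← sub_eq_zero, ← Int.cast_sub, ZMod.intCast_zmod_eq_zero_iff_dvd] at h3
      obtain ⟨n, hn⟩ := h3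
      refine ⟨n, ?_⟩
      rw [map_div₀, ← exp_log hv0, ← exp_log hv0', ← exp_sub, hn]
    · push Not at hv
      have htr : F6V (k := k) (v.valuation M) := by
        intro l hl
        have hle : ∀ l : k, v.valuation M (algebraMap (RatFunc k) M (RatFunc.C l)) ≤ 1 := fun l =>
          v.valuation_le_one (algebraMap k O l)
        have h1 := hle l⁻¹
        rw [map_inv₀, map_inv₀, map_inv₀] at h1
        have h2 : v.valuation M (algebraMap (RatFunc k) M (RatFunc.C l)) ≠ 0 := (Valuation.ne_zero_iff _).2 (by simpa using hl)
        exact le_antisymm (hle l) ((inv_le_one₀ (zero_lt_iff.2 h2)).1 h1)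
      obtain ⟨n, hn⟩ := hav _ htr hv
      obtain ⟨n', hn'⟩ := h1.2 _ htr hv
      refine ⟨n - n', ?_⟩
      rw [map_div₀, hn, hn', ← exp_sub]
      congr 1; push_cast; ring)
  refine ⟨ω * a₀, ⟨ω, hω, a₀, ⟨_, rfl⟩, rfl⟩, c, hc, ?_⟩
  rw [div_eq_iff h1.1] at hac
  rw [hac]; ring
end F6
end MF6

section MB
open Polynomial WeierstrassCurve WeierstrassCurve.Affine

theorem B_cond {R : Type*} [CommRing R] (W : WeierstrassCurve R) (x : Fin 3 → R) (i : Fin 3) :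
    ∑ j : Fin 3, (addSubMapCoeff W (i, j)).eval x * (addSubMap W j).eval x = W.Δ * x i ^ 4 := by
  rw [Fin.sum_univ_three, addSubMap, addSubMapCoeff, Function.uncurry_apply_pair, WeierstrassCurve.Δ]
  fin_cases i <;> simp <;> grind only [b_relation]

theorem B_deg {k σ : Type*} [Field k] [Fintype σ] (F : MvPolynomial σ k[X]) (n : ℕ) (hF : F.IsHomogeneous n) :
    ∃ c : ℕ, ∀ (v : σ → k[X]) (H : ℕ), (∀ i, (v i).natDegree ≤ H) → (F.eval v).natDegree ≤ n * H + c := by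
  refine ⟨F.support.sup fun d => (F.coeff d).natDegree, fun v H hv => ?_⟩
  rw [MvPolynomial.eval_eq]
  refine natDegree_sum_le_of_forall_le _ _ fun d hd => ?_
  refine natDegree_mul_le.trans ?_
  rw [add_comm]
  refine add_le_add ?_ (Finset.le_sup (f := fun d => (F.coeff d).natDegree) hd)
  refine (natDegree_prod_le _ _).trans ?_
  have h1 := hF (MvPolynomial.mem_support_iff.1 hd)
  rw [Finsupp.weight_apply, Finsupp.sum_fintype _ _ (by simp)] at h1
  rw [← h1, Finset.sum_mul]
  calc _ ≤ ∑ i ∈ d.support, d i * H := Finset.sum_le_sum fun i _ => natDegree_pow_le.trans (Nat.mul_le_mul_left _ (hv i))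
    _ ≤ ∑ i, d i * H := Finset.sum_le_sum_of_subset (Finset.subset_univ _)
    _ = _ := by simp

/-- max of degrees -/
noncomputable def Bm {k : Type*} [Field k] {n : ℕ} (v : Fin n → k[X]) : ℕ := Finset.univ.sup fun i => (v i).natDegree

theorem B_le {k : Type*} [Field k] {n : ℕ} (v : Fin n → k[X]) (i) : (v i).natDegree ≤ Bm v :=
  Finset.le_sup (f := fun i => (v i).natDegree) (Finset.mem_univ i)

theorem B_le' {k : Type*} [Field k] {n : ℕ} (v : Fin n → k[X]) (H : ℕ) (h : ∀ i, (v i).natDegree ≤ H) : Bm v ≤ H :=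
  Finset.sup_le fun i _ => h i

theorem B_ex {k : Type*} [Field k] {n : ℕ} (v : Fin (n+1) → k[X]) : ∃ i, (v i).natDegree = Bm v := by
  obtain ⟨i, _, hi⟩ := Finset.exists_mem_eq_sup Finset.univ ⟨0, Finset.mem_univ _⟩ (fun i => (v i).natDegree)
  exact ⟨i, hi.symm⟩

/-- proportional to a primitive vector -/
theorem B_prop {k : Type*} [Field k] {n : ℕ} (S F : Fin n → k[X]) (hS : Ideal.span (Set.range S) = ⊤)
    (C : RatFunc k) (hC : C ≠ 0) (h : ∀ i, algebraMap k[X] (RatFunc k) (S i) = C * algebraMap k[X] (RatFunc k) (F i)) :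
    ∃ g : k[X], g ≠ 0 ∧ ∀ i, F i = g * S i := by
  have h1 : (1 : k[X]) ∈ Ideal.span (Set.range S) := by rw [hS]; trivial
  rw [Ideal.span, Submodule.mem_span_range_iff_exists_fun] at h1
  obtain ⟨a, ha⟩ := h1
  have hg : algebraMap k[X] (RatFunc k) (∑ i, a i * F i) = C⁻¹ := by
    have := congrArg (algebraMap k[X] (RatFunc k)) ha
    simp only [map_sum, smul_eq_mul, map_mul, h, map_one] at this ⊢
    apply eq_inv_of_mul_eq_one_left; rw [← this, Finset.sum_mul]
    exact Finset.sum_congr rfl fun i _ => by ring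
  refine ⟨∑ i, a i * F i, fun h0 => ?_, fun i => ?_⟩
  · rw [h0, map_zero] at hg; exact inv_ne_zero hC hg.symm
  · apply RatFunc.algebraMap_injective k
    rw [map_mul, hg, h]; field_simp

theorem B_map {k : Type*} [Field k] (W : WeierstrassCurve k[X]) (hΔ : W.Δ ≠ 0) :
    ∃ c : ℕ, ∀ (v S : Fin 3 → k[X]), Ideal.span (Set.range v) = ⊤ → Ideal.span (Set.range S) = ⊤ →
      ∀ C : RatFunc k, C ≠ 0 → (∀ i, algebraMap k[X] (RatFunc k) (S i) = C * algebraMap k[X] (RatFunc k) ((addSubMap W i).eval v)) →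
      Bm S ≤ 2 * Bm v + c ∧ 2 * Bm v ≤ Bm S + c := by
  choose c1 hc1 using fun i => B_deg _ _ (isHomogeneous_addSubMap W i)
  choose c2 hc2 using fun ij => B_deg _ _ (isHomogeneous_addSubMapCoeff W ij)
  refine ⟨Finset.univ.sup c1 + Finset.univ.sup c2 + W.Δ.natDegree, fun v S hv hS C hC h => ?_⟩
  obtain ⟨g, hg0, hg⟩ := B_prop S _ hS C hC h
  have l1 : ∀ i, c1 i ≤ Finset.univ.sup c1 := fun i => Finset.le_sup (Finset.mem_univ i)
  have l2 : ∀ i, c2 i ≤ Finset.univ.sup c2 := fun i => Finset.le_sup (Finset.mem_univ i)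
  constructor
  · refine B_le' _ _ fun i => ?_
    by_cases hi : S i = 0
    · simp [hi]
    have h1 := hc1 i v _ (B_le v)
    rw [hg, natDegree_mul hg0 hi] at h1
    have := l1 i
    omega
  · have hgd : g ∣ W.Δ := by
      have h1 : (1 : k[X]) ∈ Ideal.span ((fun x => x ^ 4) '' (Set.range v)) := by
        rw [Ideal.span_pow_eq_top _ hv 4]; trivial
      rw [← Set.range_comp, Ideal.span, Submodule.mem_span_range_iff_exists_fun] at h1
      obtain ⟨a, ha⟩ := h1
      have : W.Δ = ∑ i, a i * (W.Δ * v i ^ 4) := by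
        calc W.Δ = W.Δ * 1 := by ring
          _ = _ := by rw [← ha, Finset.mul_sum]; exact Finset.sum_congr rfl fun i _ => by simp only [Function.comp, smul_eq_mul]; ring
      rw [this]
      refine Finset.dvd_sum fun i _ => Dvd.dvd.mul_left ?_ _
      rw [← B_cond]
      exact Finset.dvd_sum fun j _ => Dvd.dvd.mul_left ⟨_, hg j⟩ _
    have hgd' := natDegree_le_of_dvd hgd hΔ
    obtain ⟨i, hi⟩ := B_ex v
    by_cases hvi : v i = 0
    · rw [← hi, hvi]; simp
    have h1 := congrArg natDegree (B_cond W v i)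
    rw [natDegree_mul hΔ (pow_ne_zero _ hvi), natDegree_pow, hi] at h1
    have h2 : (∑ j : Fin 3, (addSubMapCoeff W (i, j)).eval v * (addSubMap W j).eval v).natDegree ≤
        (2 * Bm v + Finset.univ.sup c2) + (g.natDegree + Bm S) := by
      refine natDegree_sum_le_of_forall_le _ _ fun j _ => natDegree_mul_le.trans (add_le_add ?_ ?_)
      · have := hc2 (i,j) v _ (B_le v)
        have := l2 (i,j)
        omega
      · rw [hg]; exact natDegree_mul_le.trans (add_le_add le_rfl (B_le S j))
    omega

theorem B_sym {k : Type*} [Field k] (p q : Fin 2 → k[X]) (hp : IsCoprime (p 0) (p 1)) (hq : IsCoprime (q 0) (q 1)) :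
    Ideal.span (Set.range ![p 0 * q 0, p 0 * q 1 + p 1 * q 0, p 1 * q 1]) = ⊤ ∧
    Bm ![p 0 * q 0, p 0 * q 1 + p 1 * q 0, p 1 * q 1] = Bm p + Bm q := by
  constructor
  · by_contra hne
    obtain ⟨P, hP, hle⟩ := Ideal.exists_le_maximal _ hne
    have hm : ∀ i, (![p 0 * q 0, p 0 * q 1 + p 1 * q 0, p 1 * q 1] : Fin 3 → k[X]) i ∈ P :=
      fun i => hle (Ideal.subset_span ⟨i, rfl⟩)
    have h0 := hm 0; have h1 := hm 1; have h2 := hm 2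
    simp at h0 h1 h2
    have hPp := hP.isPrime
    have np : ∀ a b : k[X], IsCoprime a b → a ∈ P → b ∈ P → False := by
      rintro a b ⟨u, v, huv⟩ ha hb
      exact hP.ne_top ((Ideal.eq_top_iff_one _).2 (huv ▸ P.add_mem (P.mul_mem_left _ ha) (P.mul_mem_left _ hb)))
    have key : ∀ a b c d : k[X], IsCoprime a b → IsCoprime c d → a ∈ P → a * d + b * c ∈ P → b * d ∈ P → False := by
      intro a b c d hab hcd ha h1 h2
      have h3 : b * c ∈ P := (Ideal.add_mem_iff_right P (P.mul_mem_right _ ha)).1 h1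
      have hb : b ∉ P := fun hb => np a b hab ha hb
      exact np c d hcd ((hPp.mem_or_mem h3).resolve_left hb) ((hPp.mem_or_mem h2).resolve_left hb)
    rcases hPp.mem_or_mem h0 with h | h
    · exact key _ _ _ _ hp hq h h1 h2
    · exact key _ _ _ _ hq hp h (by convert h1 using 1; ring) (by convert h2 using 1; ring)
  · apply le_antisymm
    · refine B_le' _ _ fun i => ?_
      have a0 := B_le p 0; have a1 := B_le p 1; have b0 := B_le q 0; have b1 := B_le q 1
      fin_cases i <;> simp
      · exact natDegree_mul_le.trans (by omega)
      · refine (natDegree_add_le _ _).trans (max_le (natDegree_mul_le.trans (by omega)) (natDegree_mul_le.trans (by omega)))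
      · exact natDegree_mul_le.trans (by omega)
    · have nz : ∀ (r : Fin 2 → k[X]), IsCoprime (r 0) (r 1) → ∀ i, (r i).natDegree = Bm r → ∃ j, (r j).natDegree = Bm r ∧ r j ≠ 0 := by
        intro r hr i hi
        by_cases h : r i = 0
        · rw [h, natDegree_zero] at hi
          have h0 := B_le r 0; have h1 := B_le r 1
          by_cases hr0 : r 0 = 0
          · exact ⟨1, by omega, fun hr1 => by rw [hr0, hr1] at hr; exact not_isCoprime_zero_zero hr⟩
          · exact ⟨0, by omega, hr0⟩
        · exact ⟨i, hi, h⟩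
      obtain ⟨i', hi'⟩ := B_ex p
      obtain ⟨j', hj'⟩ := B_ex q
      obtain ⟨i, hi, hi0⟩ := nz p hp i' hi'
      obtain ⟨j, hj, hj0⟩ := nz q hq j' hj'
      have t0 := B_le ![p 0 * q 0, p 0 * q 1 + p 1 * q 0, p 1 * q 1] 0
      have t1 := B_le ![p 0 * q 0, p 0 * q 1 + p 1 * q 0, p 1 * q 1] 1
      have t2 := B_le ![p 0 * q 0, p 0 * q 1 + p 1 * q 0, p 1 * q 1] 2
      simp at t0 t1 t2
      by_contra hlt
      push Not at hlt
      have a0 := B_le p 0; have a1 := B_le p 1; have b0 := B_le q 0; have b1 := B_le q 1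
      generalize hT : Bm ![p 0 * q 0, p 0 * q 1 + p 1 * q 0, p 1 * q 1] = T at *
      have mid : ∀ a b c d : k[X], a ≠ 0 → d ≠ 0 → a.natDegree = Bm p → d.natDegree = Bm q → b.natDegree ≤ Bm p → c.natDegree ≤ Bm q →
          (a * c).natDegree ≤ T → (a * d + b * c).natDegree ≤ T → (b * d).natDegree ≤ T → False := by
        intro a b c d ha hd ea ed eb ec h1 h2 h3
        have h4 : (a * d).natDegree = Bm p + Bm q := by rw [natDegree_mul ha hd, ea, ed]
        by_cases h5 : (b * c).natDegree < (a * d).natDegree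
        · rw [natDegree_add_eq_left_of_natDegree_lt h5] at h2; omega
        · have hb : b ≠ 0 := by rintro rfl; simp at h5; omega
          have hc : c ≠ 0 := by rintro rfl; simp at h5; omega
          rw [natDegree_mul hb hc] at h5
          rw [natDegree_mul ha hc] at h1
          omega
      fin_cases i <;> fin_cases j <;> simp at hi hj hi0 hj0
      · rw [natDegree_mul hi0 hj0] at t0; omega
      · exact mid _ _ _ _ hi0 hj0 hi hj a1 b0 t0 t1 t2
      · exact mid _ _ _ _ hi0 hj0 hi hj a0 b1 t2 (by rwa [add_comm]) t0
      · rw [natDegree_mul hi0 hj0] at t2; omega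

/-- integral model data -/
structure BM {k : Type*} [Field k] (W : WeierstrassCurve (RatFunc k)) (Wt : WeierstrassCurve k[X]) (D : k[X]) : Prop where
  D0 : D ≠ 0
  Δ0 : Wt.Δ ≠ 0
  b2 : algebraMap k[X] (RatFunc k) Wt.b₂ = (algebraMap k[X] (RatFunc k) D) ^ 2 * W.b₂
  b4 : algebraMap k[X] (RatFunc k) Wt.b₄ = (algebraMap k[X] (RatFunc k) D) ^ 4 * W.b₄
  b6 : algebraMap k[X] (RatFunc k) Wt.b₆ = (algebraMap k[X] (RatFunc k) D) ^ 6 * W.b₆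
  b8 : algebraMap k[X] (RatFunc k) Wt.b₈ = (algebraMap k[X] (RatFunc k) D) ^ 8 * W.b₈

theorem BM_ex {k : Type*} [Field k] (W : WeierstrassCurve (RatFunc k)) (hΔ : W.Δ ≠ 0) : ∃ Wt D, BM W Wt D := by
  classical
  obtain ⟨⟨D, hD⟩, h⟩ := IsLocalization.exist_integer_multiples_of_finset (nonZeroDivisors k[X])
    ({W.a₁, W.a₂, W.a₃, W.a₄, W.a₆} : Finset (RatFunc k))
  have hD0 : D ≠ 0 := nonZeroDivisors.ne_zero hD
  have key : ∀ a ∈ ({W.a₁, W.a₂, W.a₃, W.a₄, W.a₆} : Finset (RatFunc k)), ∀ n, ∃ r : k[X], algebraMap k[X] (RatFunc k) r = (algebraMap k[X] (RatFunc k) D) ^ (n+1) * a := by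
    intro a ha n
    obtain ⟨r, hr⟩ := h a ha
    refine ⟨D ^ n * r, ?_⟩
    rw [map_mul, map_pow, hr, Algebra.smul_def]; ring
  obtain ⟨a1, h1⟩ := key W.a₁ (by simp) 0
  obtain ⟨a2, h2⟩ := key W.a₂ (by simp) 1
  obtain ⟨a3, h3⟩ := key W.a₃ (by simp) 2
  obtain ⟨a4, h4⟩ := key W.a₄ (by simp) 3
  obtain ⟨a6, h6⟩ := key W.a₆ (by simp) 5
  have e2 : algebraMap k[X] (RatFunc k) (a1^2+4*a2) = (algebraMap k[X] (RatFunc k) D) ^ 2 * W.b₂ := by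
    simp only [map_add, map_mul, map_pow, h1, h2, WeierstrassCurve.b₂, map_ofNat]; ring
  have e4 : algebraMap k[X] (RatFunc k) (2 * a4 + a1 * a3) = (algebraMap k[X] (RatFunc k) D) ^ 4 * W.b₄ := by
    simp only [map_add, map_mul, h1, h3, h4, WeierstrassCurve.b₄, map_ofNat]; ring
  have e6 : algebraMap k[X] (RatFunc k) (a3 ^ 2 + 4 * a6) = (algebraMap k[X] (RatFunc k) D) ^ 6 * W.b₆ := by
    simp only [map_add, map_mul, map_pow, h3, h6, WeierstrassCurve.b₆, map_ofNat]; ring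
  have e8 : algebraMap k[X] (RatFunc k) (a1 ^ 2 * a6 + 4 * a2 * a6 - a1 * a3 * a4 + a2 * a3 ^ 2 - a4 ^ 2) = (algebraMap k[X] (RatFunc k) D) ^ 8 * W.b₈ := by
    simp only [map_add, map_sub, map_mul, map_pow, h1, h2, h3, h4, h6, WeierstrassCurve.b₈, map_ofNat]; ring
  refine ⟨⟨a1, a2, a3, a4, a6⟩, D, hD0, ?_, e2, e4, e6, e8⟩
  intro h0
  have := congrArg (algebraMap k[X] (RatFunc k)) h0
  rw [map_zero, WeierstrassCurve.Δ] at this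
  simp only [map_sub, map_add, map_neg, map_mul, map_pow, map_ofNat] at this
  simp only [WeierstrassCurve.b₂, WeierstrassCurve.b₄, WeierstrassCurve.b₆, WeierstrassCurve.b₈] at this
  rw [e2, e4, e6, e8] at this
  have h12 : (algebraMap k[X] (RatFunc k) D) ^ 12 * W.Δ = 0 := by
    rw [WeierstrassCurve.Δ, ← this]; ring
  rcases mul_eq_zero.1 h12 with h | h
  · exact hD0 (RatFunc.algebraMap_injective k (by rw [map_zero]; exact eq_zero_of_pow_eq_zero h))
  · exact hΔ h

section B
open Classical in
def BR {k : Type*} [Field k] {W : WeierstrassCurve (RatFunc k)} (D : k[X]) (P : W.toAffine.Point) (p : Fin 2 → k[X]) : Prop :=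
  IsCoprime (p 0) (p 1) ∧ ∃ c : RatFunc k, c ≠ 0 ∧ (algebraMap k[X] (RatFunc k) D) ^ 2 * P.xRep 0 = c * algebraMap k[X] (RatFunc k) (p 0) ∧
    P.xRep 1 = c * algebraMap k[X] (RatFunc k) (p 1)

variable {k : Type*} [Field k] {W : WeierstrassCurve (RatFunc k)} {Wt : WeierstrassCurve k[X]} {D : k[X]}

theorem BR_zero (hD : D ≠ 0) : BR D (0 : W.toAffine.Point) ![1, 0] := by
  refine ⟨isCoprime_one_left, (algebraMap k[X] (RatFunc k) D) ^ 2, ?_, by simp, by simp⟩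
  exact pow_ne_zero _ (by simpa using hD)

theorem BR_ex (hD : D ≠ 0) (P : W.toAffine.Point) : ∃ p, BR D P p := by
  rcases P with _ | ⟨x, y, h⟩
  · exact ⟨_, BR_zero hD⟩
  · set z := (algebraMap k[X] (RatFunc k) D) ^ 2 * x with hz
    have hd : algebraMap k[X] (RatFunc k) z.denom ≠ 0 := by simpa using z.denom_ne_zero
    refine ⟨![z.num, z.denom], z.isCoprime_num_denom, (algebraMap k[X] (RatFunc k) z.denom)⁻¹, inv_ne_zero hd, ?_, ?_⟩
    · simp only [Point.xRep_some, Matrix.cons_val_zero]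
      rw [← hz]
      conv_lhs => rw [← RatFunc.num_div_denom z]
      field_simp
    · simp [hd]

open Classical in
theorem BR_addsub (hM : BM W Wt D) (P Q : W.toAffine.Point) (p q r s : Fin 2 → k[X]) (hp : BR D P p) (hq : BR D Q q)
    (hr : BR D (P + Q) r) (hs : BR D (P - Q) s) :
    ∃ C : RatFunc k, C ≠ 0 ∧ ∀ i, algebraMap k[X] (RatFunc k) ((![r 0 * s 0, r 0 * s 1 + r 1 * s 0, r 1 * s 1] : Fin 3 → k[X]) i) =
      C * algebraMap k[X] (RatFunc k) ((addSubMap Wt i).eval ![p 0 * q 0, p 0 * q 1 + p 1 * q 0, p 1 * q 1]) := by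
  obtain ⟨c, hc, e0, e1, e2⟩ := A_addsub W P Q
  obtain ⟨_, cp, hcp, p0, p1⟩ := hp
  obtain ⟨_, cq, hcq, q0, q1⟩ := hq
  obtain ⟨_, cr, hcr, r0, r1⟩ := hr
  obtain ⟨_, cs, hcs, s0, s1⟩ := hs
  have hd : algebraMap k[X] (RatFunc k) D ≠ 0 := by simpa using hM.D0
  have b2 := hM.b2; have b4 := hM.b4; have b6 := hM.b6; have b8 := hM.b8
  generalize (P+Q).xRep 0 = R0 at *
  generalize (P+Q).xRep 1 = R1 at *
  generalize (P-Q).xRep 0 = S0 at *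
  generalize (P-Q).xRep 1 = S1 at *
  generalize P.xRep 0 = P0 at *
  generalize P.xRep 1 = P1 at *
  generalize Q.xRep 0 = Q0 at *
  generalize Q.xRep 1 = Q1 at *
  generalize algebraMap k[X] (RatFunc k) D = d at *
  refine ⟨c * cp ^ 2 * cq ^ 2 / (d ^ 4 * cr * cs), div_ne_zero (by simp [*]) (by simp [*]), fun i => ?_⟩
  have hR0 : R0 = cr * algebraMap _ _ (r 0) / d ^ 2 := by field_simp; linear_combination r0
  have hS0 : S0 = cs * algebraMap _ _ (s 0) / d ^ 2 := by field_simp; linear_combination s0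
  have hP0 : P0 = cp * algebraMap _ _ (p 0) / d ^ 2 := by field_simp; linear_combination p0
  have hQ0 : Q0 = cq * algebraMap _ _ (q 0) / d ^ 2 := by field_simp; linear_combination q0
  subst hR0 hS0 hP0 hQ0 r1 s1 p1 q1
  have B2 : W.b₂ = algebraMap _ _ Wt.b₂ / d^2 := by field_simp; linear_combination -b2
  have B4 : W.b₄ = algebraMap _ _ Wt.b₄ / d^4 := by field_simp; linear_combination -b4
  have B6 : W.b₆ = algebraMap _ _ Wt.b₆ / d^6 := by field_simp; linear_combination -b6
  have B8 : W.b₈ = algebraMap _ _ Wt.b₈ / d^8 := by field_simp; linear_combination -b8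
  rw [B4, B6, B8] at e0
  rw [B2, B4, B6] at e1
  fin_cases i
  · simp [addSubMap]; field_simp at e0 ⊢; linear_combination e0
  · simp [addSubMap, show algebraMap k[X] (RatFunc k) 2 = 2 from map_ofNat _ 2]; field_simp at e1 ⊢; linear_combination e1
  · simp [addSubMap, show algebraMap k[X] (RatFunc k) 4 = 4 from map_ofNat _ 4]; field_simp at e2 ⊢; linear_combination e2

/-- height -/
noncomputable def Bh (hD : D ≠ 0) (P : W.toAffine.Point) : ℕ := Bm (BR_ex hD P).choose

open Classical in
theorem B_par (hM : BM W Wt D) : ∃ c : ℕ, ∀ P Q : W.toAffine.Point,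
    Bh hM.D0 (P + Q) + Bh hM.D0 (P - Q) ≤ 2 * Bh hM.D0 P + 2 * Bh hM.D0 Q + c ∧
    2 * Bh hM.D0 P + 2 * Bh hM.D0 Q ≤ Bh hM.D0 (P + Q) + Bh hM.D0 (P - Q) + c := by
  obtain ⟨c, hc⟩ := B_map Wt hM.Δ0
  refine ⟨c, fun P Q => ?_⟩
  have hp := (BR_ex hM.D0 P).choose_spec
  have hq := (BR_ex hM.D0 Q).choose_spec
  have hr := (BR_ex hM.D0 (P+Q)).choose_spec
  have hs := (BR_ex hM.D0 (P-Q)).choose_spec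
  obtain ⟨C, hC, h⟩ := BR_addsub hM P Q _ _ _ _ hp hq hr hs
  obtain ⟨v1, v2⟩ := B_sym _ _ hp.1 hq.1
  obtain ⟨S1, S2⟩ := B_sym _ _ hr.1 hs.1
  have := hc _ _ v1 S1 C hC h
  rw [v2, S2] at this
  simp only [Bh]
  omega
end B
end MB

section MC1
open Polynomial WeierstrassCurve WeierstrassCurve.Affine

section C1
open Classical Filter
variable {F : Type*} [Field F] {W : WeierstrassCurve F}

theorem C_rep1 {P : W.toAffine.Point} (h : P ≠ 0) : P.xRep 1 = 1 := by
  rcases P with _ | ⟨x, y, h⟩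
  · exact absurd rfl h
  · simp

theorem C_rep1' {P : W.toAffine.Point} (h : P.xRep 1 ≠ 0) : P ≠ 0 := by
  rintro rfl; simp at h

theorem C_pm {P Q : W.toAffine.Point} (hP : P ≠ 0) (hQ : Q ≠ 0) (h : P.xRep 0 = Q.xRep 0) : P = Q ∨ P = -Q := by
  apply Point.eq_or_eq_neg_of_xRep_eq_xRep
  ext i; fin_cases i
  · exact h
  · exact (C_rep1 hP).trans (C_rep1 hQ).symm

theorem C_fin {S : Set F} (hS : S.Finite) : {P : W.toAffine.Point | P.xRep 0 ∈ S}.Finite := by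
  refine Set.Finite.preimage' (f := fun P : W.toAffine.Point => P.xRep 0) hS fun b _ => ?_
  by_cases h : ∃ P : W.toAffine.Point, P ≠ 0 ∧ P.xRep 0 = b
  · obtain ⟨P, hP, rfl⟩ := h
    refine (Set.toFinite {0, P, -P}).subset fun Q hQ => ?_
    by_cases h0 : Q = 0
    · simp [h0]
    · rcases C_pm h0 hP hQ with h | h <;> simp [h]
  · refine (Set.finite_singleton 0).subset fun Q hQ => ?_
    by_contra h0
    exact h ⟨Q, h0, hQ⟩

theorem C_ev {B : F[X]} (hB : B ≠ 0) : ∀ᶠ P : W.toAffine.Point in cofinite, B.eval (P.xRep 0) ≠ 0 := by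
  rw [eventually_cofinite]
  refine (C_fin (B.roots.toFinset.finite_toSet)).subset fun P hP => ?_
  simpa [hB] using hP

theorem C_inf [IsAlgClosed F] (hΔ : W.Δ ≠ 0) (x : F) : ∃ P : W.toAffine.Point, P ≠ 0 ∧ P.xRep 0 = x := by
  obtain ⟨y, hy⟩ := IsAlgClosed.exists_root (X^2 + C (W.a₁*x+W.a₃) * X - C (x^3+W.a₂*x^2+W.a₄*x+W.a₆) : F[X])
    (by rw [show (X^2 + C (W.a₁*x+W.a₃) * X - C (x^3+W.a₂*x^2+W.a₄*x+W.a₆) : F[X]) = C 1 * X^2 + C (W.a₁*x+W.a₃) * X + C (-(x^3+W.a₂*x^2+W.a₄*x+W.a₆)) by simp only [map_neg, map_one]; ring, degree_quadratic one_ne_zero]; decide)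
  have : W.toAffine.Equation x y := by
    rw [equation_iff]
    simp only [IsRoot.def, eval_sub, eval_add, eval_mul, eval_pow, eval_X, eval_C] at hy
    linear_combination hy
  exact ⟨.some x y ((equation_iff_nonsingular_of_Δ_ne_zero hΔ).1 this), Point.some_ne_zero _, by simp⟩

def CR (W : WeierstrassCurve F) (n : ℕ) : Prop := ∃ A B : F[X], B ≠ 0 ∧ ∀ᶠ P : W.toAffine.Point in cofinite,
  n • P ≠ 0 ∧ (n • P).xRep 0 * B.eval (P.xRep 0) = A.eval (P.xRep 0)

theorem C_ne : ∀ᶠ P : W.toAffine.Point in cofinite, P ≠ 0 := by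
  rw [eventually_cofinite]; simp

theorem CR_one : CR W 1 := ⟨X, 1, one_ne_zero, by filter_upwards [C_ne] with P hP; simpa using hP⟩

theorem CR_two (h0 : (4 : F) ≠ 0 ∨ W.b₂ ≠ 0) : CR W 2 := by
  refine ⟨X^4 - C W.b₄ * X^2 - 2 * C W.b₆ * X - C W.b₈, C 4 * X^3 + C W.b₂ * X^2 + C (2 * W.b₄) * X + C W.b₆, ?_, ?_⟩
  · intro h
    have h3 := congrArg (coeff · 3) h
    have h2 := congrArg (coeff · 2) h
    simp [coeff_X, coeff_C] at h2 h3
    tauto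
  · have hB : (C 4 * X^3 + C W.b₂ * X^2 + C (2 * W.b₄) * X + C W.b₆ : F[X]) ≠ 0 := by
      intro h
      have h3 := congrArg (coeff · 3) h
      have h2 := congrArg (coeff · 2) h
      simp [coeff_X, coeff_C] at h2 h3
      tauto
    filter_upwards [C_ne, C_ev hB] with P hP hb
    rcases P with _ | ⟨x, y, h⟩
    · exact absurd rfl hP
    obtain ⟨c, hc, e0, e1⟩ := A_dbl W h; rw [← two_nsmul] at e0 e1
    simp only [Point.xRep_some, Matrix.cons_val_zero, eval_add, eval_mul, eval_pow, eval_X, eval_C, eval_sub, eval_ofNat] at hb ⊢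
    have h1 : (2 • (Point.some x y h)).xRep 1 ≠ 0 := by
      rw [e1]; refine mul_ne_zero hc ?_; convert hb using 1; ring
    have h2 := C_rep1' h1
    rw [C_rep1 h2] at e1
    refine ⟨h2, ?_⟩
    rw [e0]
    linear_combination (-(x ^ 4 - W.b₄ * x ^ 2 - 2 * W.b₆ * x - W.b₈)) * e1

theorem C_all [IsAlgClosed F] (hΔ : W.Δ ≠ 0) (n : ℕ) (h : ∀ᶠ P : W.toAffine.Point in cofinite, n • P = 0) (P : W.toAffine.Point) : n • P = 0 := by
  have hinf : Infinite W.toAffine.Point := by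
    have : Infinite F := inferInstance
    choose f h0 h1 using C_inf hΔ
    exact Infinite.of_injective f fun x y hxy => by rw [← h1 x, ← h1 y, hxy]
  by_contra hP
  have h2 : ∀ᶠ Q : W.toAffine.Point in cofinite, n • (P + Q) = 0 :=
    (add_right_injective P).tendsto_cofinite.eventually h
  obtain ⟨Q, h1, h2⟩ := (h.and h2).exists
  rw [nsmul_add, h1, add_zero] at h2
  exact hP h2

theorem CR_step [IsAlgClosed F] (hΔ : W.Δ ≠ 0) (n : ℕ) (h1 : CR W n) (h2 : CR W (n+1))
    (h3 : ∃ P : W.toAffine.Point, (n+2) • P ≠ 0) : CR W (n+2) := by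
  obtain ⟨A', B', hB', h1⟩ := h1
  obtain ⟨A, B, hB, h2⟩ := h2
  have key : ∀ P : W.toAffine.Point, P ≠ 0 → n • P ≠ 0 → (n+1) • P ≠ 0 → ∃ c, c ≠ 0 ∧
      ((n+2)•P).xRep 0 + ((n+2)•P).xRep 1 * (n•P).xRep 0 = c * (2 * (((n+1)•P).xRep 0 + P.xRep 0) * (((n+1)•P).xRep 0 * P.xRep 0) + W.b₂ * (((n+1)•P).xRep 0 * P.xRep 0) + W.b₄ * (((n+1)•P).xRep 0 + P.xRep 0) + W.b₆) ∧
      ((n+2)•P).xRep 1 = c * (((n+1)•P).xRep 0 - P.xRep 0)^2 := by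
    intro P hP a1 a2
    obtain ⟨c, hc, -, e1, e2⟩ := A_addsub W ((n+1)•P) P
    rw [show (n+1)•P + P = (n+2)•P by rw [← succ_nsmul], show (n+1)•P - P = n•P by rw [succ_nsmul]; abel,
      C_rep1 a1, C_rep1 a2, C_rep1 hP] at e1
    rw [show (n+1)•P + P = (n+2)•P by rw [← succ_nsmul], show (n+1)•P - P = n•P by rw [succ_nsmul]; abel,
      C_rep1 a1, C_rep1 a2, C_rep1 hP] at e2
    exact ⟨c, hc, by linear_combination e1, by linear_combination e2⟩
  by_cases hE : A - X * B = 0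
  · exfalso
    obtain ⟨P, hP⟩ := h3
    refine hP (C_all hΔ _ ?_ P)
    filter_upwards [h1, h2, C_ne, C_ev hB] with P a1 a2 hP hb
    obtain ⟨c, hc, -, e⟩ := key P hP a1.1 a2.1
    by_contra h0
    rw [C_rep1 h0] at e
    have := congrArg (eval (P.xRep 0)) hE
    simp only [eval_sub, eval_mul, eval_X, eval_zero] at this
    have h5 : (((n+1)•P).xRep 0 - P.xRep 0) * eval (P.xRep 0) B = 0 := by linear_combination a2.2 + this
    rw [(mul_eq_zero.1 h5).resolve_right hb] at e
    simp at e
  · refine ⟨(2*(A+X*B)*A*X + C W.b₂*A*X*B+C W.b₄*(A+X*B)*B + C W.b₆*B^2)*B' - A'*(A-X*B)^2, (A-X*B)^2*B', mul_ne_zero (pow_ne_zero _ hE) hB', ?_⟩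
    filter_upwards [h1, h2, C_ne, C_ev hB, C_ev hB', C_ev hE] with P a1 a2 hP hb hb' he
    obtain ⟨c, hc, e1, e2⟩ := key P hP a1.1 a2.1
    simp only [eval_sub, eval_mul, eval_X, eval_add, eval_pow, eval_C, eval_ofNat] at he ⊢
    have h3 : (n+2)•P ≠ 0 := by
      apply C_rep1'
      rw [e2]
      refine mul_ne_zero hc (pow_ne_zero _ fun h => he ?_)
      linear_combination eval (P.xRep 0) B * h - a2.2
    refine ⟨h3, ?_⟩
    rw [C_rep1 h3] at e1 e2
    rw [← a1.2, ← a2.2]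
    generalize ((n+2)•P).xRep 0 = u at *
    generalize ((n+1)•P).xRep 0 = a at *
    generalize (n•P).xRep 0 = a' at *
    generalize (P).xRep 0 = x at *
    generalize eval x B = β at *
    generalize eval x B' = γ at *
    linear_combination β^2*γ*(a-x)^2*e1 - β^2*γ*(2*(a+x)*(a*x)+W.b₂*(a*x)+W.b₄*(a+x)+W.b₆) * e2

theorem CR_all [IsAlgClosed F] (hΔ : W.Δ ≠ 0) (h0 : (4 : F) ≠ 0 ∨ W.b₂ ≠ 0) (n : ℕ) : CR W (n+1) := by
  induction n using Nat.strong_induction_on with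
  | _ n ih =>
  rcases n with _ | _ | n
  · exact CR_one
  · exact CR_two h0
  refine CR_step hΔ (n+1) (ih n (by omega)) (ih (n+1) (by omega)) ?_
  by_contra! hall
  rcases Nat.even_or_odd' n with ⟨m, hm | hm⟩
  · -- odd: point of order two
    obtain ⟨x, hx⟩ := IsAlgClosed.exists_root (C 4 * X^3 + C W.b₂ * X^2 + C (2 * W.b₄) * X + C W.b₆ : F[X]) (by
      rcases eq_or_ne (4 : F) 0 with h4 | h4
      · rw [h4]; simp only [map_zero, zero_mul, zero_add]
        rw [degree_quadratic (h0.resolve_left (by simp [h4]))]; decide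
      · rw [degree_cubic h4]; decide)
    obtain ⟨P, hP, rfl⟩ := C_inf hΔ x
    have h2 : 2 • P = 0 := by
      rcases P with _ | ⟨x, y, h⟩
      · exact absurd rfl hP
      obtain ⟨c, hc, e0, e1⟩ := A_dbl W h; rw [← two_nsmul] at e0 e1
      by_contra hh
      rw [C_rep1 hh] at e1
      simp only [Point.xRep_some, Matrix.cons_val_zero, eval_add, eval_mul, eval_pow, eval_X, eval_C, IsRoot.def] at hx
      exact one_ne_zero (e1.trans (by linear_combination c * hx))
    apply hP
    have := hall P
    rw [show n + 1 + 2 = (m+1)*2+1 by omega, succ_nsmul, mul_nsmul', h2] at this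
    simpa using this
  · obtain ⟨A, B, hB, h1⟩ := ih (m+1) (by omega)
    obtain ⟨A', B', hB', h2⟩ := CR_two h0
    have hf : (Set.univ : Set W.toAffine.Point).Finite := by
      rw [eventually_cofinite] at h1 h2
      refine (Set.Finite.preimage' (f := fun P : W.toAffine.Point => (m+1+1) • P) (h2.subset fun Q (hQ : 2 • Q = 0) => ?_) fun Q _ => ?_).subset fun P _ => show 2 • ((m+1+1)•P) = 0 from ?_
      · exact fun h => h.1 hQ
      · by_cases hQ : ∃ R, (m+1+1) • R = Q
        · obtain ⟨R, hR⟩ := hQ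
          refine (h1.image (R + ·)).subset fun S hS => ⟨S - R, fun h => h.1 ?_, by simp⟩
          rw [nsmul_sub, hR, show (m+1+1)•S = Q from hS, sub_self]
        · exact Set.finite_empty.subset fun S hS => hQ ⟨S, hS⟩
      · rw [← mul_nsmul', ← hall P]; congr 1; omega
    have : Infinite F := inferInstance
    choose f h0 h1 using C_inf hΔ
    have : Infinite W.toAffine.Point := Infinite.of_injective f fun x y hxy => by rw [← h1 x, ← h1 y, hxy]
    exact Set.infinite_univ hf

theorem C_tors [IsAlgClosed F] (hΔ : W.Δ ≠ 0) (h0 : (4 : F) ≠ 0 ∨ W.b₂ ≠ 0) (n : ℕ) (hn : n ≠ 0) : {P : W.toAffine.Point | n • P = 0}.Finite := by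
  obtain ⟨m, rfl⟩ := Nat.exists_eq_succ_of_ne_zero hn
  obtain ⟨A, B, hB, h⟩ := CR_all hΔ h0 m
  exact (eventually_cofinite.1 h).subset fun P hP h => h.1 hP
end C1
end MC1

section MC2
open Polynomial WeierstrassCurve WeierstrassCurve.Affine

section C2
open Classical

theorem CM_ex {K L : Type*} [Field K] [Field L] (f : K →+* L) {W : WeierstrassCurve K} {W' : WeierstrassCurve L} (h : W.map f = W') :
    ∃ φ : W.toAffine.Point →+ W'.toAffine.Point, ∀ x y hns, ∃ h', φ (.some x y hns) = .some (f x) (f y) h' := by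
  subst h
  let := f.toAlgebra
  exact ⟨Point.map (W' := W) (Algebra.ofId K L), fun x y hns => ⟨_, rfl⟩⟩

noncomputable def CM {K L : Type*} [Field K] [Field L] (f : K →+* L) {W : WeierstrassCurve K} {W' : WeierstrassCurve L} (h : W.map f = W') :
  W.toAffine.Point →+ W'.toAffine.Point := (CM_ex f h).choose

variable {K L : Type*} [Field K] [Field L] (f : K →+* L) {W : WeierstrassCurve K} {W' : WeierstrassCurve L} (h : W.map f = W')

theorem CM_some (x y hns) : ∃ h', CM f h (.some x y hns) = .some (f x) (f y) h' := (CM_ex f h).choose_spec x y hns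

theorem CM_xRep (P) (i) : (CM f h P).xRep i = f (P.xRep i) := by
  rcases P with _ | ⟨x, y, hns⟩
  · change (CM f h 0).xRep i = f ((0 : W.toAffine.Point).xRep i)
    rw [map_zero]; fin_cases i <;> simp
  · obtain ⟨h', e⟩ := CM_some f h x y hns
    rw [e]; fin_cases i <;> simp

theorem CM_inj : Function.Injective (CM f h) := by
  rw [injective_iff_map_eq_zero]
  rintro (_ | ⟨x, y, hns⟩) h0
  · rfl
  · obtain ⟨h', e⟩ := CM_some f h x y hns
    rw [e] at h0; exact absurd h0 (Point.some_ne_zero _)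

theorem CM_range {P : W'.toAffine.Point} (hx : ∀ x y hns, P = .some x y hns → (∃ a, f a = x) ∧ ∃ b, f b = y) : ∃ Q, CM f h Q = P := by
  rcases P with _ | ⟨x, y, hns⟩
  · exact ⟨0, map_zero _⟩
  · obtain ⟨⟨a, rfl⟩, b, rfl⟩ := hx x y hns rfl
    subst h
    have hn : W.toAffine.Nonsingular a b := (map_nonsingular (W := W.toAffine) f.injective a b).1 hns
    obtain ⟨h', e⟩ := CM_some f rfl a b hn
    exact ⟨_, e⟩

theorem C_torsK (hΔ : W.Δ ≠ 0) (h0 : (4 : K) ≠ 0 ∨ W.b₂ ≠ 0) (n : ℕ) (hn : n ≠ 0) : {P : W.toAffine.Point | n • P = 0}.Finite := by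
  let g := algebraMap K (AlgebraicClosure K)
  have := C_tors (W := W.map g) (by simpa using hΔ) (h0.imp (fun h e => h (g.injective (by rw [map_zero, ← e, map_ofNat]))) (by simp)) n hn
  refine (this.preimage (CM_inj g rfl).injOn).subset fun P (hP : n • P = 0) => ?_
  simp only [Set.mem_preimage, Set.mem_ofPred_eq]
  rw [← map_nsmul, hP, map_zero]

/-- formal group congruence -/
theorem C_form0 {Γ : Type*} [LinearOrderedCommGroupWithZero Γ] (v : Valuation K Γ) (B2 B4 B6 B8 : K) (hb2 : v B2 ≤ 1) (hb4 : v B4 ≤ 1)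
    (hb6 : v B6 ≤ 1) (hb8 : v B8 ≤ 1) (X Z : ℕ → K) (hX0 : X 0 ≠ 0) (hZ0 : Z 0 = 0)
    (H : ∀ j, ∃ c, c ≠ 0 ∧ X (j+1+1) * X j = c * ((X (j+1) * X 1)^2 - B4 * (X (j+1) * X 1) * (Z (j+1) * Z 1)
      - B6 * (X (j+1) * Z 1 + Z (j+1) * X 1) * (Z (j+1) * Z 1) - B8 * (Z (j+1) * Z 1)^2) ∧
      X (j+1+1) * Z j + Z (j+1+1) * X j = c * (2 * (X (j+1) * Z 1 + Z (j+1) * X 1) * (X (j+1) * X 1)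
      + B2 * (X (j+1) * X 1) * (Z (j+1) * Z 1) + B4 * (X (j+1) * Z 1 + Z (j+1) * X 1) * (Z (j+1) * Z 1) + B6 * (Z (j+1) * Z 1)^2))
    (hP : v (Z 1 / X 1) < 1) (hP0 : X 1 ≠ 0) (j : ℕ) :
    X j ≠ 0 ∧ v (Z j / X j - j^2 * (Z 1 / X 1)) ≤ v (Z 1 / X 1) ^ 2 := by
  induction j using Nat.strong_induction_on with
  | _ j ih =>
  rcases j with _ | _ | j
  · simp [hX0, hZ0]
  · simpa using hP0
  obtain ⟨h1, h2⟩ := ih j (by omega)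
  obtain ⟨h3, h4⟩ := ih (j+1) (by omega)
  obtain ⟨c, hc, e0, e1⟩ := H j
  set s := Z 1 / X 1 with hs
  set s1 := Z (j+1) / X (j+1) with hs1
  set s0 := Z j / X j with hs0
  have hs' : Z 1 = s * X 1 := by rw [hs]; field_simp
  have hs1' : Z (j+1) = s1 * X (j+1) := by rw [hs1]; field_simp
  have hs0' : Z j = s0 * X j := by rw [hs0]; field_simp
  set N := 1 - B4 * (s1 * s) - B6 * (s1 + s) * (s1 * s) - B8 * (s1*s)^2 with hN
  have hsO : s ∈ v.integer := hP.le
  have hss : v s ^ 2 ≤ v s := by rw [sq]; exact mul_le_of_le_one_left' hP.le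
  have hsn : ∀ n : ℕ, v ((n:K)^2 * s) ≤ v s := fun n => by
    rw [map_mul]; exact mul_le_of_le_one_left' (pow_mem (natCast_mem v.integer n) 2)
  have hv1 : v s1 ≤ v s := by
    have := v.map_add (s1 - ((j+1:ℕ):K)^2*s) (((j+1:ℕ):K)^2*s)
    rw [sub_add_cancel] at this
    exact this.trans (max_le (h4.trans hss) (hsn _))
  have hs1O : s1 ∈ v.integer := hv1.trans hP.le
  have hB : v (s1 * s) ≤ v s ^ 2 := by rw [map_mul, sq]; exact mul_le_mul_left hv1 _
  have hBO : s1 * s ∈ v.integer := mul_mem hs1O hsO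
  have m2 : B2 ∈ v.integer := hb2
  have m4 : B4 ∈ v.integer := hb4
  have m6 : B6 ∈ v.integer := hb6
  have m8 : B8 ∈ v.integer := hb8
  have t2 : (2 : K) ∈ v.integer := ofNat_mem _ 2
  have hmul : ∀ r ∈ v.integer, v (s1 * s * r) ≤ v s ^ 2 := fun r hr => by
    rw [map_mul]; exact (mul_le_of_le_one_right' hr).trans hB
  have hA : s1 + s ∈ v.integer := add_mem hs1O hsO
  have hNv : v N = 1 := by
    have : N = 1 + -(s1 * s * (B4 + B6 * (s1+s) + B8 * (s1*s))) := by rw [hN]; ring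
    rw [this]
    apply v.map_one_add_of_lt
    rw [v.map_neg]
    exact (hmul _ (add_mem (add_mem m4 (mul_mem m6 hA)) (mul_mem m8 hBO))).trans_lt (hss.trans_lt hP)
  have hN0 : N ≠ 0 := by intro h; rw [h, map_zero] at hNv; exact zero_ne_one hNv
  rw [hs', hs1'] at e0 e1
  rw [hs0'] at e1
  have hq : X (j+1+1) ≠ 0 := by
    intro h
    rw [h, zero_mul] at e0
    have : c * ((X (j+1) * X 1)^2 * N) = 0 := by rw [hN]; linear_combination -e0
    simp [hc, h3, hP0, hN0] at this
  refine ⟨hq, ?_⟩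
  have e : Z (j+1+1) / X (j+1+1) = (2 * (s1 + s) + B2 * (s1 * s) + B4 * (s1+s) * (s1*s) + B6 * (s1 * s)^2)/N - s0 := by
    generalize X (j+1+1) = X' at *
    generalize Z (j+1+1) = Z' at *
    generalize X j = X0 at *
    generalize X (j+1) = X1 at *
    generalize X 1 = x at *
    have e0' : X' * X0 = c * ((X1 * x)^2 * N) := by rw [hN]; linear_combination e0
    have e2 : c * (X1*x)^2 = X' * X0 / N := by field_simp; linear_combination -e0'
    rw [div_eq_iff hq]
    have : X0 * (Z' - ((2 * (s1 + s) + B2 * (s1 * s) + B4 * (s1+s) * (s1*s) + B6 * (s1 * s)^2)/N - s0) * X') = 0 := by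
      linear_combination e1 + (2 * (s1 + s) + B2 * (s1 * s) + B4 * (s1+s) * (s1*s) + B6 * (s1 * s)^2) * e2
    exact sub_eq_zero.1 ((mul_eq_zero.1 this).resolve_left h1)
  rw [e]
  have : (2 * (s1 + s) + B2 * (s1 * s) + B4 * (s1+s) * (s1*s) + B6 * (s1 * s)^2)/N - s0 - ((j+1+1:ℕ):K)^2*s =
     (2 * (s1 - ((j+1:ℕ):K)^2*s) - (s0 - (j:K)^2 * s)) + (s1 * s * (B2 + B4 * (s1+s) + B6 * (s1*s) + 2 * (s1+s) * (B4 + B6 * (s1+s) + B8 * (s1*s)))) / N := by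
    field_simp
    rw [hN]; push_cast; ring
  rw [this]
  refine (v.map_add _ _).trans (max_le ((v.map_sub _ _).trans (max_le ?_ h2)) ?_)
  · rw [map_mul]; exact (mul_le_of_le_one_left' t2).trans h4
  · rw [map_div₀, hNv, div_one]
    exact hmul _ (by
      refine add_mem (add_mem (add_mem m2 (mul_mem m4 hA)) (mul_mem m6 hBO)) (mul_mem (mul_mem t2 hA) ?_)
      exact add_mem (add_mem m4 (mul_mem m6 hA)) (mul_mem m8 hBO))

theorem C_form {Γ : Type*} [LinearOrderedCommGroupWithZero Γ] (v : Valuation K Γ) (d : K) (hd : d ≠ 0) (hb2 : v (d^2 * W.b₂) ≤ 1) (hb4 : v (d^4 * W.b₄) ≤ 1)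
    (hb6 : v (d^6 * W.b₆) ≤ 1) (hb8 : v (d^8 * W.b₈) ≤ 1) (P : W.toAffine.Point) (hP : v (P.xRep 1 / (d^2 * P.xRep 0)) < 1) (hP0 : P.xRep 0 ≠ 0) (j : ℕ) :
    (j • P).xRep 0 ≠ 0 ∧ v ((j • P).xRep 1 / (d^2 * (j • P).xRep 0) - j^2 * (P.xRep 1 / (d^2 * P.xRep 0))) ≤ v (P.xRep 1 / (d^2 * P.xRep 0)) ^ 2 := by
  have := C_form0 v _ _ _ _ hb2 hb4 hb6 hb8 (fun j => d^2 * (j • P).xRep 0) (fun j => (j • P).xRep 1) (by simp [hd]) (by simp)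
    (fun j => by
      obtain ⟨c, hc, e0, e1, -⟩ := A_addsub W ((j+1)•P) P
      rw [show (j+1)•P + P = (j+1+1)•P by rw [← succ_nsmul], show (j+1)•P - P = j•P by rw [succ_nsmul]; abel] at e0 e1
      refine ⟨c / d^4, div_ne_zero hc (pow_ne_zero _ hd), ?_, ?_⟩
      · simp only [one_nsmul]; field_simp; linear_combination e0
      · simp only [one_nsmul]; field_simp; linear_combination e1) (by simpa using hP) (by simp [hd, hP0]) j
  simpa [hd] using this
end C2
end MC2

section MC3
open Polynomial WeierstrassCurve WeierstrassCurve.Affine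

section C3
open Classical IsDedekindDomain WithZero

theorem C3_low {k : Type*} [Field k] (v : HeightOneSpectrum k[X]) (r : k[X]) (hr : r ≠ 0) : exp (-(r.natDegree : ℤ)) ≤ v.valuation (RatFunc k) (algebraMap _ _ r) := by
  rw [HeightOneSpectrum.valuation_of_algebraMap]
  by_contra! h
  have h1 : v.intValuation r ≤ exp (-((r.natDegree+1:ℕ) : ℤ)) := by
    rw [← lt_mul_exp_iff_le (by simp), ← exp_add]
    convert h using 2; push_cast; ring
  rw [HeightOneSpectrum.intValuation_le_pow_iff_mem] at h1
  obtain ⟨π, hπ⟩ := (IsPrincipalIdealRing.principal v.asIdeal).principal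
  change v.asIdeal = Ideal.span {π} at hπ
  rw [hπ, Ideal.span_singleton_pow, Ideal.mem_span_singleton] at h1
  have h2 := natDegree_le_of_dvd h1 hr
  rw [natDegree_pow] at h2
  have h3 : 0 < π.natDegree := by
    by_contra h0
    have : π = C (π.coeff 0) := eq_C_of_natDegree_eq_zero (by omega)
    by_cases hc : π.coeff 0 = 0
    · rw [this, hc, C_0] at hπ
      exact v.ne_bot (by rw [hπ]; simp)
    · apply v.isPrime.ne_top
      rw [hπ, Ideal.span_singleton_eq_top, this]
      exact isUnit_C.2 (Ne.isUnit hc)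
  nlinarith

theorem C3_up {k : Type*} [Field k] (v : HeightOneSpectrum k[X]) (x : RatFunc k) : v.valuation (RatFunc k) x ≤ exp (x.denom.natDegree : ℤ) := by
  conv_lhs => rw [← RatFunc.num_div_denom x]
  rw [map_div₀, div_le_iff₀ (lt_of_lt_of_le exp_pos (C3_low v _ x.denom_ne_zero))]
  refine (v.valuation_le_one _).trans ?_
  calc (1:WithZero (Multiplicative ℤ)) = exp (x.denom.natDegree : ℤ) * exp (-(x.denom.natDegree : ℤ)) := by rw [← exp_add]; simp
    _ ≤ _ := by gcongr; exact C3_low v _ x.denom_ne_zero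

theorem C3_unit {k : Type*} [Field k] (v : HeightOneSpectrum k[X]) (m : ℕ) (hm : (m : k) ≠ 0) : v.valuation (RatFunc k) m = 1 := by
  have h1 : (m : RatFunc k) = algebraMap k[X] (RatFunc k) (C (m : k)) := by simp
  refine le_antisymm (by rw [h1]; exact v.valuation_le_one _) ?_
  have := C3_low v (C (m:k)) (C_ne_zero.2 hm)
  rw [← h1] at this; simpa using this

theorem C3_U {k : Type*} [Field k] (p : ℕ) [Fact p.Prime] [CharP k p] {W : WeierstrassCurve (RatFunc k)} (hΔ : W.Δ ≠ 0)
    (h0 : (4 : RatFunc k) ≠ 0 ∨ W.b₂ ≠ 0) {Wt D} (hM : BM W Wt D) :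
    {P : W.toAffine.Point | IsOfFinAddOrder P ∧ ¬ ∃ f : k[X], (algebraMap k[X] (RatFunc k) D)^2 * P.xRep 0 = algebraMap _ _ f}.Finite := by
  have hp : p.Prime := Fact.out
  set d := algebraMap k[X] (RatFunc k) D with hdd
  have hd : d ≠ 0 := by simpa [hdd] using hM.D0
  have hE := C_torsK hΔ h0 p hp.ne_zero
  obtain ⟨N, hN⟩ := (hE.image fun P => (d^2 * P.xRep 0).denom.natDegree).bddAbove
  refine (C_torsK hΔ h0 (p^(N+1)) (pow_ne_zero _ hp.ne_zero)).subset ?_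
  rintro P ⟨hP, hf⟩
  have : ∃ v : HeightOneSpectrum k[X], ¬ v.valuation (RatFunc k) (d^2 * P.xRep 0) ≤ 1 := by
    by_contra! h
    obtain ⟨f, h⟩ := HeightOneSpectrum.mem_integers_of_valuation_le_one _ _ h
    exact hf ⟨f, h.symm⟩
  obtain ⟨v, hv⟩ := this
  have hP0 : P ≠ 0 := by rintro rfl; exact hf ⟨D^2, by simp [hdd]⟩
  have hx0 : P.xRep 0 ≠ 0 := by intro h; rw [h] at hv; simp at hv
  push Not at hv
  have form := fun (Q : W.toAffine.Point) => C_form (W := W) (v.valuation (RatFunc k)) d hd (by rw [← hM.b2]; exact v.valuation_le_one _) (by rw [← hM.b4]; exact v.valuation_le_one _)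
    (by rw [← hM.b6]; exact v.valuation_le_one _) (by rw [← hM.b8]; exact v.valuation_le_one _) Q
  have hs : v.valuation (RatFunc k) (P.xRep 1 / (d^2 * P.xRep 0)) ≤ exp (-1) := by
    rw [C_rep1 hP0, map_div₀, map_one, one_div]
    rw [exp_neg]
    apply inv_anti₀ (by simp)
    by_contra! h
    rw [← one_mul (exp 1), lt_mul_exp_iff_le one_ne_zero] at h
    exact absurd hv (not_lt.2 h)
  have hpow : ∀ a : ℕ, (p^a•P).xRep 0 ≠ 0 ∧ v.valuation (RatFunc k) ((p^a•P).xRep 1 / (d^2 * (p^a•P).xRep 0)) ≤ exp (-((a:ℤ)+1)) := by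
    intro a
    induction a with
    | zero => rw [pow_zero, one_nsmul]; exact ⟨hx0, by simpa only [Nat.cast_zero, zero_add] using hs⟩
    | succ a ih =>
      have := form (p^a•P) (ih.2.trans_lt (by rw [← exp_zero, exp_lt_exp]; omega)) ih.1 p
      rw [← mul_nsmul, ← pow_succ, show ((p:ℕ):RatFunc k) = 0 by
        rw [show ((p:ℕ):RatFunc k) = algebraMap k (RatFunc k) p by simp]; simp] at this
      rw [zero_pow two_ne_zero, zero_mul, sub_zero] at this
      refine ⟨this.1, this.2.trans ((pow_le_pow_left₀ zero_le ih.2 2).trans ?_)⟩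
      rw [← exp_nsmul, exp_le_exp]; simp; omega
  have hpa : ∃ a, p^a•P = 0 := by
    obtain ⟨a, m, hm, e⟩ := Nat.exists_eq_pow_mul_and_not_dvd (n := addOrderOf P) (by rw [← pos_iff_ne_zero]; exact hP.addOrderOf_pos) p hp.ne_one
    refine ⟨a, ?_⟩
    by_contra hQ
    have h1 := (hpow a)
    have h2 : v.valuation (RatFunc k) ((p^a•P).xRep 1 / (d^2 * (p^a•P).xRep 0)) < 1 := h1.2.trans_lt (by rw [← exp_zero, exp_lt_exp]; omega)
    have := (form _ h2 h1.1 m).2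
    rw [← mul_nsmul, ← e, addOrderOf_nsmul_eq_zero] at this
    have hu := C3_unit v m (by rwa [Ne, CharP.cast_eq_zero_iff k p])
    simp only [Point.xRep_zero, Matrix.cons_val_one, Matrix.cons_val_zero, zero_div, zero_sub, Valuation.map_neg, map_mul, map_pow, hu, one_pow, one_mul] at this
    have h3 : (v.valuation (RatFunc k)) ((p^a•P).xRep 1 / (d^2 * (p^a•P).xRep 0)) ≠ 0 := by
      rw [C_rep1 hQ]; simp [hd, h1.1]
    exact absurd h2 (not_lt.2 (one_le_of_le_mul_left₀ (zero_lt_iff.2 h3) (this.trans_eq (sq _))))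
  have ha := Nat.find_spec hpa
  have hmin := fun b => Nat.find_min hpa (m := b)
  set a := Nat.find hpa
  change p^(N+1)•P = 0
  suffices a ≤ N + 1 by
    obtain ⟨c, hc⟩ := Nat.exists_eq_add_of_le this
    rw [hc, pow_add, mul_nsmul, ha, nsmul_zero]
  rcases a with _ | b
  · omega
  have hb := hmin b (by omega)
  have h4 : p • (p^b•P) = 0 := by rw [← mul_nsmul, ← pow_succ]; exact ha
  have h5 : (d^2 * (p^b•P).xRep 0).denom.natDegree ≤ N := hN ⟨_, h4, rfl⟩
  have h6 := C3_up v (d^2 * (p^b•P).xRep 0)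
  have h7 := (hpow b).2
  rw [C_rep1 hb, map_div₀, map_one, one_div] at h7
  have h8 : (exp (((d^2 * (p^b•P).xRep 0).denom.natDegree : ℤ)))⁻¹ ≤ exp (-((b:ℤ)+1)) := by
    refine le_trans ?_ h7
    apply inv_anti₀ _ h6
    rw [zero_lt_iff]; simp [hd, (hpow b).1]
  rw [← exp_neg, exp_le_exp] at h8
  omega
end C3
end MC3

section MC4
open Polynomial WeierstrassCurve WeierstrassCurve.Affine

section C4
open Classical
variable {k : Type*} [Field k] {W : WeierstrassCurve (RatFunc k)} {Wt : WeierstrassCurve k[X]} {D : k[X]}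

def CI (D : k[X]) (P : W.toAffine.Point) (f : k[X]) : Prop := P ≠ 0 ∧ (algebraMap k[X] (RatFunc k) D)^2 * P.xRep 0 = algebraMap _ _ f

theorem CI_BR {P : W.toAffine.Point} {f : k[X]} (h : CI D P f) : BR D P ![f, 1] :=
  ⟨isCoprime_one_right, 1, one_ne_zero, by simpa using h.2, by simp [C_rep1 h.1]⟩

theorem C4_dvd (hM : BM W Wt D) {P Q : W.toAffine.Point} {f g r s : k[X]} (hf : CI D P f) (hg : CI D Q g) (hr : CI D (P+Q) r) (hs : CI D (P-Q) s) :
    (f - g)^2 ∣ Wt.Δ ∧ f ≠ g := by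
  obtain ⟨C, hC, h⟩ := BR_addsub hM P Q _ _ _ _ (CI_BR hf) (CI_BR hg) (CI_BR hr) (CI_BR hs)
  have h0 := h 0
  have h1 := h 1
  have h2 := h 2
  have hc := B_cond Wt ![f*g, f+g, 1] 2
  simp only [Matrix.cons_val_zero, Matrix.cons_val_one, mul_one, one_mul, Matrix.cons_val_two, Matrix.tail_cons, Matrix.head_cons, Fin.sum_univ_three, one_pow] at h0 h1 h2 hc
  have e3 : MvPolynomial.eval ![f*g, f+g, 1] (addSubMap Wt 2) = (f-g)^2 := by
    simp [addSubMap]; ring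
  rw [e3] at h2 hc
  have e1 : MvPolynomial.eval ![f*g, f+g, 1] (addSubMap Wt 0) = r * s * (f-g)^2 := by
    apply RatFunc.algebraMap_injective k
    rw [map_mul, h0]
    rw [map_one] at h2
    linear_combination -(algebraMap k[X] (RatFunc k)) ((MvPolynomial.eval ![f * g, f + g, 1]) (Wt.addSubMap 0)) * (-h2)
  have e2 : MvPolynomial.eval ![f*g, f+g, 1] (addSubMap Wt 1) = (r + s) * (f-g)^2 := by
    apply RatFunc.algebraMap_injective k
    rw [map_mul, h1]
    rw [map_one] at h2
    linear_combination (algebraMap k[X] (RatFunc k)) ((MvPolynomial.eval ![f * g, f + g, 1]) (Wt.addSubMap 1)) * (h2)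
  rw [e1, e2] at hc
  refine ⟨?_, ?_⟩
  · rw [← hc]
    exact dvd_add (dvd_add (Dvd.dvd.mul_left (dvd_mul_left _ _) _) (Dvd.dvd.mul_left (dvd_mul_left _ _) _)) (dvd_mul_left _ _)
  · rintro rfl
    simp at h2

theorem C4_pig {δ a b : k[X]} (hδ : δ ≠ 0) (hab : a ≠ b) :
    {f : k[X] | (f - a)^2 ∣ δ ∧ (f - b)^2 ∣ δ ∧ ¬ ∃ c, f = a + C c * (b - a)}.Finite := by
  have hfin : {I : Ideal k[X] | I ∣ Ideal.span {δ}}.Finite :=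
    @Set.toFinite _ _ (@Finite.of_fintype _ (UniqueFactorizationMonoid.fintypeSubtypeDvd (Ideal.span {δ}) (by simpa using hδ)))
  refine Set.Finite.of_finite_image (f := fun f => (Ideal.span {f - a}, Ideal.span {f - b})) ((hfin.prod hfin).subset ?_) ?_
  · rintro _ ⟨f, ⟨h1, h2, -⟩, rfl⟩
    exact ⟨Ideal.span_singleton_dvd_span_singleton_iff_dvd.2 ((dvd_pow_self _ two_ne_zero).trans h1),
      Ideal.span_singleton_dvd_span_singleton_iff_dvd.2 ((dvd_pow_self _ two_ne_zero).trans h2)⟩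
  · rintro f ⟨-, -, hf⟩ g ⟨-, -, -⟩ h
    simp only [Prod.mk.injEq, Ideal.span_singleton_eq_span_singleton] at h
    obtain ⟨⟨u, hu⟩, ⟨w, hw⟩⟩ := h
    obtain ⟨c, hc, hu'⟩ := isUnit_iff.1 u.isUnit
    obtain ⟨e, he, hw'⟩ := isUnit_iff.1 w.isUnit
    rw [← hu'] at hu
    rw [← hw'] at hw
    by_contra hfg
    apply hf
    -- (f-a)c = g-a, (f-b)e = g-b
    have hce : c - e ≠ 0 := by
      intro h0
      rw [sub_eq_zero] at h0; subst h0
      have : (C c - 1) * (a - b) = 0 := by linear_combination -hu + hw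
      rcases mul_eq_zero.1 this with h | h
      · apply hfg; linear_combination hu - (f-a)*h
      · exact hab (sub_eq_zero.1 h)
    have hce' : C (c - e) * C (c-e)⁻¹ = (1 : k[X]) := by rw [← C_mul, mul_inv_cancel₀ hce, C_1]
    -- f (c-e) = a c - b e + b - a 
    refine ⟨(1-e) * (c-e)⁻¹, ?_⟩
    simp only [C_mul, C_sub, C_1] at hce' ⊢
    linear_combination (hu - hw) * C (c-e)⁻¹ - (f - a) * hce'

theorem C4_lin {K : Type*} [Field K] [Algebra k K] (b2 b4 b6 b8 : K) (N M : K[X]) (hN : N = C 4 * X^3 + C b2 * X^2 + C (2*b4) * X + C b6)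
    (hM : M = X^4 - C b4 * X^2 - C (2 * b6) * X - C b8) (hNM : IsCoprime M N) (S : Set k) (hS : S.Infinite)
    (h : ∀ c ∈ S, ∃ c' : k, algebraMap k K c' * N.eval (algebraMap k K c) = M.eval (algebraMap k K c)) :
    ∀ φ : K →ₗ[k] k, φ 1 = 0 → φ b2 = 0 ∧ φ b4 = 0 ∧ φ b6 = 0 ∧ φ b8 = 0 := by
  intro φ h1
  set ι := algebraMap k K
  set G : K[X] := C (ι (φ b2)) * X^2 + C (ι (2 * φ b4)) * X + C (ι (φ b6)) with hG
  set H : K[X] := C (ι (φ b4)) * X^2 + C (ι (2 * φ b6)) * X + C (ι (φ b8)) with hH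
  have hz : H * N + G * M = 0 := by
    apply eq_zero_of_infinite_isRoot
    refine (hS.image ι.injective.injOn).mono ?_
    rintro _ ⟨c, hc, rfl⟩
    obtain ⟨c', e⟩ := h c hc
    have e' : (c^2*c') • b2 + (2*c*c'+c^2) • b4 + (c' + 2 * c) • b6 + b8 = (c^4 - 4*c^3*c') • (1 : K) := by
      simp only [Algebra.smul_def, map_add, map_sub, map_mul, map_pow, map_ofNat, mul_one]
      simp only [hN, hM, eval_add, eval_sub, eval_mul, eval_pow, eval_X, eval_C] at e
      linear_combination e
    have e2 := congrArg φ e'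
    simp only [map_add, map_smul, smul_eq_mul, h1, mul_zero] at e2
    have e3 := congrArg ι e2
    simp only [map_add, map_mul, map_pow, map_ofNat, map_zero] at e3
    change eval (ι c) (H * N + G * M) = 0
    rw [eval_add, eval_mul, eval_mul, ← e, hG, hH]
    simp only [eval_add, eval_mul, eval_pow, eval_X, eval_C, map_mul ι, map_ofNat ι]
    linear_combination N.eval (ι c) * e3
  have hMd : M.degree = 4 := by
    rw [hM]; compute_degree!
  have hd : M ∣ H := by
    apply hNM.dvd_of_dvd_mul_right
    exact ⟨-G, by linear_combination hz⟩
  have hHd : H.degree ≤ 2 := by rw [hH]; compute_degree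
  have hH0 : H = 0 := by
    by_contra h0
    have := degree_le_of_dvd hd h0
    rw [hMd] at this
    exact absurd (this.trans hHd) (by decide)
  have hG0 : G = 0 := by
    rw [hH0, zero_mul, zero_add] at hz
    refine (mul_eq_zero.1 hz).resolve_right ?_
    rintro rfl; simp at hMd
  have i0 : ∀ x, ι x = 0 → x = 0 := fun x hx => by simpa [ι] using hx
  refine ⟨i0 _ ?_, i0 _ ?_, i0 _ ?_, i0 _ ?_⟩
  · simpa [hG] using congrArg (coeff · 2) hG0
  · simpa [hH] using congrArg (coeff · 2) hH0
  · simpa [hG] using congrArg (coeff · 0) hG0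
  · simpa [hH] using congrArg (coeff · 0) hH0

theorem C4_k {K : Type*} [Field K] [Algebra k K] (b : K) (h : ∀ φ : K →ₗ[k] k, φ 1 = 0 → φ b = 0) : ∃ c : k, algebraMap k K c = b := by
  by_contra hb
  obtain ⟨φ, h1, h2⟩ := Submodule.exists_dual_map_eq_bot_of_notMem (p := Submodule.span k {(1:K)}) (x := b) (by
    rw [Submodule.mem_span_singleton]
    rintro ⟨c, rfl⟩
    exact hb ⟨c, by rw [Algebra.smul_def, mul_one]⟩) inferInstance
  refine h1 (h φ ?_)
  have : φ 1 ∈ (Submodule.span k {(1:K)}).map φ := Submodule.mem_map_of_mem (Submodule.mem_span_singleton_self _)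
  exact (Submodule.mem_bot k).1 (h2 ▸ this)

theorem C4_cop {K : Type*} [Field K] (W : WeierstrassCurve K) (hΔ : W.Δ ≠ 0) :
    IsCoprime (X^4 - C W.b₄ * X^2 - C (2 * W.b₆) * X - C W.b₈) (C 4 * X^3 + C W.b₂ * X^2 + C (2*W.b₄) * X + C W.b₆) := by
  have h := B_cond (W.map (C : K →+* K[X])) ![X*X, X+X, 1] 2
  rw [Fin.sum_univ_three] at h
  have e2 : MvPolynomial.eval ![X*X, X+X, (1 : K[X])] (addSubMap (W.map (C : K →+* K[X])) 2) = 0 := by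
    simp [addSubMap]; ring
  have e0 : MvPolynomial.eval ![X*X, X+X, (1 : K[X])] (addSubMap (W.map (C : K →+* K[X])) 0) = (X^4 - C W.b₄ * X^2 - C (2 * W.b₆) * X - C W.b₈) := by
    rw [C_mul, map_ofNat C 2]; simp [addSubMap]; ring
  have e1 : MvPolynomial.eval ![X*X, X+X, (1 : K[X])] (addSubMap (W.map (C : K →+* K[X])) 1) = (C 4 * X^3 + C W.b₂ * X^2 + C (2*W.b₄) * X + C W.b₆) := by
    rw [C_mul, map_ofNat C 2, map_ofNat C 4]; simp [addSubMap]; ring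
  rw [e0, e1, e2, map_Δ] at h
  have hd : C W.Δ * C W.Δ⁻¹ = (1 : K[X]) := by rw [← C_mul, mul_inv_cancel₀ hΔ, C_1]
  have h1 : ![X * X, X + X, (1 : K[X])] 2 = 1 := rfl
  rw [h1] at h
  refine ⟨C W.Δ⁻¹ * (MvPolynomial.eval ![X * X, X + X, 1]) ((W.map C).addSubMapCoeff (2, 0)), C W.Δ⁻¹ * (MvPolynomial.eval ![X * X, X + X, 1]) ((W.map C).addSubMapCoeff (2, 1)), ?_⟩
  linear_combination C W.Δ⁻¹ * h + hd

theorem C4_red {K : Type*} [Field K] [Algebra k K] (W : WeierstrassCurve K) (hΔ : W.Δ ≠ 0) (r w : K) (hw : w ≠ 0) (S : Set k) (hS : S.Infinite)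
    (h : ∀ c ∈ S, ∃ c' : k, ∃ x, x = r + algebraMap k K c * w ∧ (r + algebraMap k K c' * w) * (4*x^3+W.b₂*x^2+2*W.b₄*x+W.b₆) = x^4-W.b₄*x^2-2*W.b₆*x-W.b₈) :
    ∃ c : k, algebraMap k K c = W.c₄ ^ 3 / W.Δ := by
  obtain ⟨B2, h2⟩ : ∃ x, x = (W.b₂+12*r)/w := ⟨_, rfl⟩
  obtain ⟨B4, h4⟩ : ∃ x, x = (W.b₄+r*W.b₂+6*r^2)/w^2 := ⟨_, rfl⟩
  obtain ⟨B6, h6⟩ : ∃ x, x = (W.b₆+2*r*W.b₄+r^2*W.b₂+4*r^3)/w^3 := ⟨_, rfl⟩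
  obtain ⟨B8, h8⟩ : ∃ x, x = (W.b₈+3*r*W.b₆+3*r^2*W.b₄+r^3*W.b₂+3*r^4)/w^4 := ⟨_, rfl⟩
  have g2 : W.b₂ = B2 * w - 12 * r := by rw [h2]; field_simp; ring
  have g4 : W.b₄ = B4 * w^2 - r * W.b₂ - 6*r^2 := by rw [h4]; field_simp; ring
  have g6 : W.b₆ = B6 * w^3 - (2*r*W.b₄+r^2*W.b₂+4*r^3) := by rw [h6]; field_simp; ring
  have g8 : W.b₈ = B8 * w^4 - (3*r*W.b₆+3*r^2*W.b₄+r^3*W.b₂+3*r^4) := by rw [h8]; field_simp; ring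
  have key := C4_lin (k := k) B2 B4 B6 B8 _ _ rfl rfl (by
    have hcop := ((C4_cop W hΔ).map (compRingHom (C r + C w * X)))
    have hcop' := hcop.symm.add_mul_left_right (-C r)
    have ww : ∀ n, C (w^n) * C (w^n)⁻¹ = (1 : K[X]) := fun n => by rw [← C_mul, mul_inv_cancel₀ (pow_ne_zero n hw), C_1]
    have u : ∀ n, IsUnit (C (w^n) : K[X]) := fun n => IsUnit.of_mul_eq_one _ (ww n)
    refine (isCoprime_mul_unit_left_left (u 4) _ _).1 ((isCoprime_mul_unit_left_right (u 3) _ _).1 ?_)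
    refine Eq.mpr (congrArg₂ IsCoprime ?_ ?_) hcop'.symm
    · simp only [coe_compRingHom_apply, add_comp, sub_comp, mul_comp, pow_comp, X_comp, C_comp]
      rw [g8, g6, g4, g2]; simp only [C_sub, C_add, C_mul, C_pow, map_ofNat C]; ring
    · simp only [coe_compRingHom_apply, add_comp, mul_comp, pow_comp, X_comp, C_comp]
      rw [g6, g4, g2]; simp only [C_sub, C_add, C_mul, C_pow, map_ofNat C]; ring) S hS (by
    intro c hc
    obtain ⟨c', x, hx, e⟩ := h c hc
    refine ⟨c', mul_left_cancel₀ (pow_ne_zero 4 hw) ?_⟩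
    simp only [eval_add, eval_sub, eval_mul, eval_pow, eval_X, eval_C]
    generalize algebraMap k K c = z at *
    generalize algebraMap k K c' = z' at *
    subst hx
    rw [g8, g6, g4, g2] at e
    linear_combination e)
  obtain ⟨c2, e2⟩ := C4_k B2 fun φ hφ => (key φ hφ).1
  obtain ⟨c4, e4⟩ := C4_k B4 fun φ hφ => (key φ hφ).2.1
  obtain ⟨c6, e6⟩ := C4_k B6 fun φ hφ => (key φ hφ).2.2.1
  obtain ⟨c8, e8⟩ := C4_k B8 fun φ hφ => (key φ hφ).2.2.2
  have hc : W.c₄ = w^2 * (B2^2 - 24 * B4) := by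
    rw [h2, h4]; simp only [WeierstrassCurve.c₄]; field_simp; ring
  have hD : W.Δ = w^6 * (-B2^2*B8 - 8*B4^3-27*B6^2+9*B2*B4*B6) := by
    rw [h2, h4, h6, h8]; simp only [WeierstrassCurve.Δ, b₂, b₄, b₆, b₈]; field_simp; ring
  refine ⟨(c2^2-24*c4)^3/(-c2^2*c8 - 8*c4^3-27*c6^2+9*c2*c4*c6), ?_⟩
  simp only [map_div₀, map_pow, map_sub, map_neg, map_add, map_mul, map_ofNat, e2, e4, e6, e8]
  have := right_ne_zero_of_mul (hD ▸ hΔ)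
  rw [hc, hD]
  field_simp

theorem C4_pre {K : Type*} [Field K] {W : WeierstrassCurve K} (hΔ : W.Δ ≠ 0) (h0 : (4 : K) ≠ 0 ∨ W.b₂ ≠ 0) (n : ℕ) (hn : n ≠ 0) {S : Set W.toAffine.Point} (hS : S.Finite) :
    {R : W.toAffine.Point | n • R ∈ S}.Finite := by
  refine Set.Finite.preimage' (f := fun R : W.toAffine.Point => n • R) hS fun b _ => ?_
  rcases Set.eq_empty_or_nonempty ((fun R : W.toAffine.Point => n • R) ⁻¹' {b}) with h | ⟨R, hR⟩
  · rw [h]; exact Set.finite_empty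
  · refine ((C_torsK hΔ h0 n hn).image (R + ·)).subset fun Q hQ => ⟨Q - R, ?_, by simp⟩
    simp only [Set.mem_preimage, Set.mem_singleton_iff] at hQ hR
    change n • (Q - R) = 0
    rw [smul_sub, hQ, hR, sub_self]

theorem C4_T (p : ℕ) [Fact p.Prime] [CharP k p] (hΔ : W.Δ ≠ 0) (h0 : (4 : RatFunc k) ≠ 0 ∨ W.b₂ ≠ 0)
    (hj : ∀ c, algebraMap k (RatFunc k) c ≠ W.c₄^3/W.Δ) : {P : W.toAffine.Point | IsOfFinAddOrder P}.Finite := by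
  by_contra hT
  obtain ⟨Wt, D, hM⟩ := BM_ex W hΔ
  have hWΔ : Wt.Δ ≠ 0 := hM.Δ0
  obtain ⟨T, hTd⟩ : ∃ T, T = {P : W.toAffine.Point | IsOfFinAddOrder P} := ⟨_, rfl⟩
  rw [← hTd] at hT
  replace hT : T.Infinite := hT
  have hTa : ∀ P ∈ T, ∀ Q ∈ T, P + Q ∈ T ∧ P - Q ∈ T := by
    rw [hTd]; intro P hP Q hQ
    refine ⟨IsOfFinAddOrder.add hP hQ, ?_⟩
    rw [sub_eq_add_neg]
    exact IsOfFinAddOrder.add hP hQ.neg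
  obtain ⟨B, hBf, hB⟩ : ∃ B : Set W.toAffine.Point, B.Finite ∧ ∀ P ∈ T, P ∉ B → ∃ f, CI D P f := by
    refine ⟨_, ((C3_U p hΔ h0 hM).union (Set.finite_singleton 0)), fun P hP hPB => ?_⟩
    rw [hTd] at hP
    by_contra h
    apply hPB
    by_cases hP0 : P = 0
    · exact Or.inr hP0
    · exact Or.inl ⟨hP, fun ⟨f, hf⟩ => h ⟨f, hP0, hf⟩⟩
  obtain ⟨P, hPT, hPB⟩ := hT.sdiff hBf |>.nonempty
  obtain ⟨Q, hQT, hQB⟩ := hT.sdiff (hBf.union (C_fin (W := W) (Set.finite_singleton (P.xRep 0)))) |>.nonempty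
  obtain ⟨f, hf⟩ := hB P hPT hPB
  obtain ⟨g, hg⟩ := hB Q hQT fun h => hQB (Or.inl h)
  have hD : algebraMap k[X] (RatFunc k) D ≠ 0 := by simpa using hM.D0
  have hD2 := pow_ne_zero 2 hD
  have hfg : f ≠ g := by
    rintro rfl
    exact hQB (Or.inr (mul_left_cancel₀ hD2 (hg.2.trans hf.2.symm)))
  set d := algebraMap k[X] (RatFunc k) D with hdd
  obtain ⟨V, hVf, hV⟩ : ∃ V : Set W.toAffine.Point, V.Finite ∧ ∀ R ∈ T, R ∉ V → R ≠ 0 ∧ ∃ c : k, R.xRep 0 = algebraMap _ _ f / d^2 + algebraMap k (RatFunc k) c * (algebraMap _ _ (g - f) / d^2) := by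
    have hpre : ∀ P : W.toAffine.Point, {R | R + P ∈ B}.Finite := fun P => hBf.preimage (add_left_injective P).injOn
    have hpre' : ∀ P : W.toAffine.Point, {R | R - P ∈ B}.Finite := fun P => hBf.preimage (sub_left_injective).injOn
    refine ⟨_, (((((hBf.union (hpre P)).union (hpre' P)).union (hpre Q)).union (hpre' Q)).union
      (C_fin (W := W) ((C4_pig hWΔ hfg).image fun q => algebraMap _ (RatFunc k) q / d^2))), fun R hR hn => ?_⟩
    simp only [Set.mem_union, not_or] at hn
    obtain ⟨⟨⟨⟨⟨n1, n2⟩, n3⟩, n4⟩, n5⟩, n6⟩ := hn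
    obtain ⟨q, hq⟩ := hB R hR n1
    obtain ⟨r1, hr1⟩ := hB _ (hTa R hR P hPT).1 n2
    obtain ⟨r2, hr2⟩ := hB _ (hTa R hR P hPT).2 n3
    obtain ⟨r3, hr3⟩ := hB _ (hTa R hR Q hQT).1 n4
    obtain ⟨r4, hr4⟩ := hB _ (hTa R hR Q hQT).2 n5
    refine ⟨hq.1, ?_⟩
    have hx : R.xRep 0 = algebraMap _ _ q / d^2 := by rw [← hq.2, ← hdd]; field_simp
    by_contra hc
    refine n6 ⟨q, ⟨(C4_dvd hM hq hf hr1 hr2).1, (C4_dvd hM hq hg hr3 hr4).1, ?_⟩, hx.symm⟩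
    rintro ⟨c, rfl⟩
    refine hc ⟨c, ?_⟩
    rw [hx, map_add, map_mul, IsScalarTower.algebraMap_apply k k[X] (RatFunc k)]
    change _ = _ + algebraMap _ _ (C c) * _
    ring
  obtain ⟨r, hr⟩ : ∃ r, r = algebraMap _ (RatFunc k) f / d^2 := ⟨_, rfl⟩
  obtain ⟨w, hw⟩ : ∃ w, w = algebraMap _ (RatFunc k) (g - f) / d^2 := ⟨_, rfl⟩
  rw [← hr, ← hw] at hV
  have hw0 : w ≠ 0 := by
    rw [hw]; exact div_ne_zero ((map_ne_zero_iff _ (RatFunc.algebraMap_injective k)).2 (sub_ne_zero.2 hfg.symm)) hD2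
  have hT' : (T \ (V ∪ {R | 2 • R ∈ V})).Infinite := hT.sdiff (hVf.union (C4_pre hΔ h0 2 two_ne_zero hVf))
  refine (fun ⟨c, hc⟩ => hj c hc) (C4_red W hΔ r w hw0 {c : k | ∃ R ∈ T \ (V ∪ {R | 2 • R ∈ V}), R.xRep 0 = r + algebraMap k (RatFunc k) c * w} ?_ ?_)
  · intro hfin
    refine hT' ((C_fin (W := W) (hfin.image fun c => r + algebraMap k (RatFunc k) c * w)).subset fun R hR => ?_)
    obtain ⟨c, hc⟩ := (hV R hR.1 fun h => hR.2 (Or.inl h)).2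
    exact ⟨c, ⟨R, hR, hc⟩, hc.symm⟩
  · rintro c ⟨R, hR, hc⟩
    obtain ⟨hR0, -⟩ := hV R hR.1 fun h => hR.2 (Or.inl h)
    obtain ⟨h20, c', hc'⟩ := hV (2 • R) (by rw [two_nsmul]; exact (hTa R hR.1 R hR.1).1) fun h => hR.2 (Or.inr h)
    refine ⟨c', R.xRep 0, hc, ?_⟩
    rcases R with _ | ⟨x, y, hns⟩
    · exact absurd rfl hR0
    obtain ⟨e, he, e0, e1⟩ := A_dbl W hns
    rw [← two_nsmul] at e0 e1
    rw [C_rep1 h20] at e1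
    rw [hc'] at e0
    simp only [Point.xRep_some, Matrix.cons_val_zero]
    apply mul_left_cancel₀ he
    linear_combination e0 - (r + algebraMap k (RatFunc k) c' * w) * e1
end C4
end MC4

section MD1
open Polynomial WeierstrassCurve WeierstrassCurve.Affine WithZero

section D1
open Classical

theorem D_fi {G Z : Type*} [AddCommGroup G] [Finite Z] (H : AddSubgroup G) (f : G → Z) (h : ∀ a b, f a = f b → a - b ∈ H) : H.FiniteIndex := by
  have : Finite (G ⧸ H) := Finite.of_injective (fun q : G ⧸ H => f q.out) fun a b hab => by
    have := h _ _ hab.symm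
    rw [← QuotientAddGroup.out_eq' a, ← QuotientAddGroup.out_eq' b, QuotientAddGroup.eq]
    rwa [neg_add_eq_sub]
  exact AddSubgroup.finiteIndex_of_finite_quotient

theorem D1a {K M Ω : Type*} [Field K] [Field M] [Field Ω] [Algebra K M] [Algebra K Ω] [IsGalois K Ω] [FiniteDimensional K M] (ι : M →ₐ[K] Ω)
    {W : WeierstrassCurve K} (hΔ : W.Δ ≠ 0) (h0 : (4 : K) ≠ 0 ∨ W.b₂ ≠ 0) (n : ℕ) (hn : n ≠ 0)
    (hP : {P : W.toAffine.Point | ¬ ∃ Q : (W.map (algebraMap K M)).toAffine.Point, n • Q = CM (algebraMap K M) rfl P}.Finite) :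
    (nsmulAddMonoidHom (α := W.toAffine.Point) n).range.FiniteIndex := by
  let W' := W.map (algebraMap K Ω)
  have hτ : ∀ τ : M →ₐ[K] Ω, (W.map (algebraMap K M)).map τ.toRingHom = W' := fun τ => by
    rw [WeierstrassCurve.map_map]; congr 1; exact τ.comp_algebraMap
  have hfin : Finite {P : W'.toAffine.Point // n • P = 0} := by
    refine (C_torsK ?_ ?_ n hn).to_subtype
    · simpa [W', map_Δ] using hΔ
    · refine h0.imp (fun h => ?_) (fun h => by simpa [W', map_b₂] using h)
      have := (map_ne_zero (algebraMap K Ω)).2 h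
      rwa [map_ofNat] at this
  obtain ⟨B, hB⟩ : ∃ B, B = {P : W.toAffine.Point | ¬ ∃ Q : (W.map (algebraMap K M)).toAffine.Point, n • Q = CM (algebraMap K M) rfl P} := ⟨_, rfl⟩
  rw [← hB] at hP
  have := hP.to_subtype
  have hQ : ∀ P, P ∉ B → ∃ Q : (W.map (algebraMap K M)).toAffine.Point, n • Q = CM (algebraMap K M) rfl P := fun P hP => by
    rw [hB] at hP; exact not_not.1 hP
  choose! q hq using hQ
  have hcomp : ∀ (τ : M →ₐ[K] Ω) (P : W.toAffine.Point), CM τ.toRingHom (hτ τ) (CM (algebraMap K M) rfl P) = CM (algebraMap K Ω) rfl P := by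
    rintro τ (_ | ⟨x, y, hns⟩)
    · change CM _ _ (CM _ _ 0) = CM _ _ 0
      simp only [map_zero]
    · obtain ⟨h1, e1⟩ := CM_some (algebraMap K M) (rfl : W.map _ = _) x y hns
      obtain ⟨h2, e2⟩ := CM_some (algebraMap K Ω) (rfl : W.map _ = _) x y hns
      obtain ⟨h3, e3⟩ := CM_some τ.toRingHom (hτ τ) _ _ h1
      rw [e1, e2, e3]; congr 1 <;> exact τ.commutes _
  have hz : ∀ P, P ∉ B → ∀ τ : M →ₐ[K] Ω, n • (CM τ.toRingHom (hτ τ) (q P) - CM ι.toRingHom (hτ ι) (q P)) = 0 := fun P hP τ => by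
    rw [smul_sub, ← map_nsmul, ← map_nsmul, hq P hP, hcomp, hcomp, sub_self]
  let F : W.toAffine.Point → B ⊕ ((M →ₐ[K] Ω) → {P : W'.toAffine.Point // n • P = 0}) := fun P =>
    if h : P ∈ B then .inl ⟨P, h⟩ else .inr fun τ => ⟨_, hz P h τ⟩
  refine D_fi _ F fun P P' h => ?_
  by_cases h1 : P ∈ B <;> by_cases h2 : P' ∈ B
  · simp only [F, dif_pos h1, dif_pos h2, Sum.inl.injEq, Subtype.mk.injEq] at h
    rw [h, sub_self]; exact zero_mem _
  · simp [F, dif_pos h1, dif_neg h2] at h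
  · simp [F, dif_neg h1, dif_pos h2] at h
  · simp only [F, dif_neg h1, dif_neg h2, Sum.inr.injEq] at h
    have hR : ∀ τ : M →ₐ[K] Ω, CM τ.toRingHom (hτ τ) (q P - q P') = CM ι.toRingHom (hτ ι) (q P - q P') := fun τ => by
      have := congrArg Subtype.val (congrFun h τ)
      simp only at this
      rw [map_sub, map_sub, ← sub_eq_zero]; rw [← sub_eq_zero] at this
      rw [← this]; abel
    have hfix : ∀ x : M, (∀ τ : M →ₐ[K] Ω, τ x = ι x) → ∃ a, algebraMap K M a = x := fun x hx => by
      have : ι x ∈ (⊥ : IntermediateField K Ω) := by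
        rw [InfiniteGalois.mem_bot_iff_fixed]
        exact fun σ => hx (σ.toAlgHom.comp ι)
      obtain ⟨a, ha⟩ := IntermediateField.mem_bot.1 this
      exact ⟨a, (RingHom.injective ι.toRingHom) ((ι.commutes a).trans ha)⟩
    obtain ⟨R, hR'⟩ := CM_range (algebraMap K M) (rfl : W.map _ = _) (P := q P - q P') (fun x y hns e => by
      have : ∀ τ : M →ₐ[K] Ω, τ x = ι x ∧ τ y = ι y := fun τ => by
        have := hR τ
        rw [e] at this
        obtain ⟨h3, e3⟩ := CM_some τ.toRingHom (hτ τ) _ _ hns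
        obtain ⟨h4, e4⟩ := CM_some ι.toRingHom (hτ ι) _ _ hns
        rw [e3, e4] at this
        simpa using this
      exact ⟨hfix _ fun τ => (this τ).1, hfix _ fun τ => (this τ).2⟩)
    refine ⟨R, CM_inj (algebraMap K M) (rfl : W.map _ = _) ?_⟩
    change CM _ _ (n • R) = _
    rw [map_nsmul, hR', smul_sub, hq P h1, hq P' h2, map_sub]

theorem D1 {K M : Type*} [Field K] [Field M] [Algebra K M] [FiniteDimensional K M] [Algebra.IsSeparable K M]
    {W : WeierstrassCurve K} (hΔ : W.Δ ≠ 0) (h0 : (4 : K) ≠ 0 ∨ W.b₂ ≠ 0) (n : ℕ) (hn : n ≠ 0)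
    (hP : {P : W.toAffine.Point | ¬ ∃ Q : (W.map (algebraMap K M)).toAffine.Point, n • Q = CM (algebraMap K M) rfl P}.Finite) :
    (nsmulAddMonoidHom (α := W.toAffine.Point) n).range.FiniteIndex :=
  D1a (IsSepClosed.lift : M →ₐ[K] SeparableClosure K) hΔ h0 n hn hP

universe u
theorem D_adj {K : Type u} [Field K] (s : Set (SeparableClosure K)) (hs : s.Finite) : ∃ (M : Type u) (_ : Field M) (_ : Algebra K M) (f : M →ₐ[K] SeparableClosure K),
    FiniteDimensional K M ∧ Algebra.IsSeparable K M ∧ ∀ x ∈ s, ∃ y, f y = x := by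
  have := hs.to_subtype
  refine ⟨IntermediateField.adjoin K s, inferInstance, inferInstance, IntermediateField.val _,
    IntermediateField.finiteDimensional_adjoin fun x _ => Algebra.IsIntegral.isIntegral x, inferInstance, fun x hx => ⟨⟨x, IntermediateField.subset_adjoin _ _ hx⟩, rfl⟩⟩

theorem D0 {k M : Type u} [Field k] [IsAlgClosed k] [Field M] [Algebra (RatFunc k) M] [FiniteDimensional (RatFunc k) M] [Algebra.IsSeparable (RatFunc k) M]
    (m : ℕ) (hm : ((m+2:ℕ):k) ≠ 0) (S : Set M) (hS : S.Finite) (hS0 : ∀ z ∈ S, z ≠ 0) :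
    ∃ (M' : Type u) (_ : Field M') (_ : Algebra M M') (_ : Algebra (RatFunc k) M') (_ : IsScalarTower (RatFunc k) M M'),
      FiniteDimensional (RatFunc k) M' ∧ Algebra.IsSeparable (RatFunc k) M' ∧
      ∀ a ≠ 0, (∀ v : Valuation M (WithZero (Multiplicative ℤ)), F6V (k:=k) v → (∀ z ∈ S, v z = 1) → ∃ n : ℤ, v a = exp ((m+2)*n)) → ∃ b : M', b ^ (m+2) = algebraMap M M' a := by
  obtain ⟨Ωs, hf, h⟩ := F_thm (k := k) m hm S hS hS0
  have hm' : NeZero (((m+2 : ℕ)) : SeparableClosure M) := ⟨by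
    have := (map_ne_zero ((algebraMap M (SeparableClosure M)).comp ((algebraMap (RatFunc k) M).comp (algebraMap k (RatFunc k))))).2 hm
    rwa [map_natCast] at this⟩
  choose ρ hρ using fun z : M => IsSepClosed.exists_pow_nat_eq (algebraMap M (SeparableClosure M) z) (m+2)
  obtain ⟨M', _, _, f, h1, h2, h3⟩ := D_adj (K := M) (ρ '' Ωs) (hf.image _)
  let i3 : Algebra (RatFunc k) M' := ((algebraMap M M').comp (algebraMap (RatFunc k) M)).toAlgebra
  have i4 : IsScalarTower (RatFunc k) M M' := IsScalarTower.of_algebraMap_eq fun _ => rfl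
  refine ⟨M', _, _, i3, i4, FiniteDimensional.trans _ M _, Algebra.IsSeparable.trans _ M _, fun a ha hv => ?_⟩
  obtain ⟨ω, hω, c, hc, e⟩ := h a ha hv
  obtain ⟨y, hy⟩ := h3 (ρ ω) ⟨ω, hω, rfl⟩
  refine ⟨y * algebraMap M M' c, (RingHom.injective f.toRingHom) ?_⟩
  change f _ = f _
  rw [map_pow, map_mul, hy, mul_pow, hρ, e, f.commutes, f.commutes, map_mul, map_pow]
end D1
end MD1

section MD2
open Polynomial WeierstrassCurve WeierstrassCurve.Affine WithZero

section D2
open Classical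

theorem D2a {L : Type*} [Field L] (h2 : (2 : L) ≠ 0) {W : WeierstrassCurve L} (hΔ : W.Δ ≠ 0) (e₁ e₂ e₃ r₁ r₂ r₃ : L)
    (hb2 : W.b₂ = -4 * (e₁ + e₂ + e₃)) (hb4 : W.b₄ = 2 * (e₁ * e₂ + e₁ * e₃ + e₂ * e₃)) (hb6 : W.b₆ = -4 * (e₁ * e₂ * e₃))
    (P : W.toAffine.Point) (hP : P ≠ 0) (h₁ : r₁^2 = P.xRep 0 - e₁) (h₂ : r₂^2 = P.xRep 0 - e₂) (h₃ : r₃^2 = P.xRep 0 - e₃) :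
    ∃ Q : W.toAffine.Point, 2 • Q = P := by
  generalize hx : P.xRep 0 = x at *
  have h4 : (4 : L) ≠ 0 := by
    have := mul_ne_zero h2 h2; norm_num at this; exact this
  have hb8 := W.b_relation
  obtain ⟨z, hz⟩ : ∃ z, z = x + r₁ * r₂ + r₁ * r₃ + r₂ * r₃ := ⟨_, rfl⟩
  obtain ⟨y, hy⟩ : ∃ y, y = (2 * (r₁+r₂)*(r₁+r₃)*(r₂+r₃) - W.a₁ * z - W.a₃) / 2 := ⟨_, rfl⟩
  obtain rfl : e₁ = x - r₁^2 := by rw [h₁]; ring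
  obtain rfl : e₂ = x - r₂^2 := by rw [h₂]; ring
  obtain rfl : e₃ = x - r₃^2 := by rw [h₃]; ring
  have heq : W.toAffine.Equation z y := by
    rw [equation_iff]
    have hy' : 2 * y = 2 * (r₁+r₂)*(r₁+r₃)*(r₂+r₃) - W.a₁ * z - W.a₃ := by rw [hy]; field_simp
    have hN : (2 * y + W.a₁ * z + W.a₃)^2 = 4 * z^3 + W.b₂ * z^2 + 2 * W.b₄ * z + W.b₆ := by
      rw [hy', hb2, hb4, hb6, hz]; ring
    apply mul_left_cancel₀ h4
    simp only [b₂, b₄, b₆] at hN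
    linear_combination hN
  have hns := (equation_iff_nonsingular_of_Δ_ne_zero hΔ).1 heq
  obtain ⟨c, hc, e0, e1⟩ := A_dbl W hns
  rw [← two_nsmul] at e0 e1
  have key : (z*z)^2 - W.b₄*(z*z) - W.b₆*(z+z) - W.b₈ = x * (2*(z+z)*(z*z) + W.b₂*(z*z) + W.b₄*(z+z)+W.b₆) := by
    apply mul_left_cancel₀ h4
    rw [hb2, hb4, hb6] at hb8 ⊢
    rw [hz]
    linear_combination -hb8
  rw [key] at e0
  have hQ0 : 2 • Point.some z y hns ≠ 0 := by
    intro h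
    rw [h] at e0 e1
    simp only [Point.xRep_zero, Matrix.cons_val_zero, Matrix.cons_val_one] at e0 e1
    refine one_ne_zero (α := L) ?_
    linear_combination e0 - x * e1
  have h1 := C_rep1 hQ0
  have : (2 • Point.some z y hns).xRep 0 = P.xRep 0 := by
    rw [hx]; linear_combination e0 - x * e1 + x * h1
  rcases C_pm hQ0 hP this with h | h
  · exact ⟨_, h⟩
  · exact ⟨-Point.some z y hns, by rw [smul_neg, h, neg_neg]⟩

theorem D2v {M : Type*} [Field M] (v : Valuation M (WithZero (Multiplicative ℤ))) (u a b y : M) (h4 : v 4 = 1) (ha : v a = 1) (hb : v b = 1) (hu : u ≠ 0)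
    (h : y^2 = 4 * (u * (u + a) * (u + b))) : ∃ n : ℤ, v u = exp (2 * n) := by
  have hu0 : v u ≠ 0 := (Valuation.ne_zero_iff _).2 hu
  have hv := congrArg v h
  simp only [map_mul, map_pow, h4, one_mul] at hv
  have hex : ∀ z, z ≠ 0 → ∃ n : ℤ, v z = exp n := fun z hz => ⟨_, (exp_log ((Valuation.ne_zero_iff v).2 hz)).symm⟩
  obtain ⟨s, hs⟩ := hex u hu
  rcases lt_trichotomy (v u) 1 with h1 | h1 | h1
  · rw [Valuation.map_add_eq_of_lt_right v (by rwa [ha]), Valuation.map_add_eq_of_lt_right v (by rwa [hb]), ha, hb, mul_one, mul_one] at hv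
    have hy : y ≠ 0 := by rintro rfl; simp at hv; exact hu0 hv.symm
    obtain ⟨t, ht⟩ := hex y hy
    exact ⟨t, by rw [← hv, ht, ← exp_nsmul]; simp⟩
  · exact ⟨0, by simpa using h1⟩
  · rw [Valuation.map_add_eq_of_lt_left v (by rwa [ha]), Valuation.map_add_eq_of_lt_left v (by rwa [hb])] at hv
    have hy : y ≠ 0 := by rintro rfl; simp at hv; exact hu hv
    obtain ⟨t, ht⟩ := hex y hy
    rw [hs, ht, ← exp_nsmul, ← exp_add, ← exp_add, exp_inj] at hv
    simp only [nsmul_eq_mul, Nat.cast_ofNat] at hv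
    exact ⟨t - s, by rw [hs, exp_inj]; linarith⟩

theorem D2sep {K : Type*} [Field K] (h2 : (2 : K) ≠ 0) (W : WeierstrassCurve K) (hΔ : W.Δ ≠ 0) :
    (C 4 * X^3 + C W.b₂ * X^2 + C (2*W.b₄) * X + C W.b₆ : K[X]).Separable := by
  have h4 : (16 : K) ≠ 0 := by
    have := pow_ne_zero 4 h2; norm_num at this; exact this
  rw [Polynomial.Separable]
  have h := C4_cop W hΔ
  have hr : (4 : K[X]) * C W.b₈ = C W.b₂ * C W.b₆ - C W.b₄^2 := by
    rw [← C_mul, ← C_pow, ← C_sub, ← W.b_relation, C_mul, map_ofNat C]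
  have hd : derivative (C 4 * X^3 + C W.b₂ * X^2 + C (2*W.b₄) * X + C W.b₆ : K[X]) = 12 * X^2 + 2 * C W.b₂ * X + 2 * C W.b₄ := by
    simp [map_ofNat C]; ring
  have hu : IsUnit (C 16 : K[X]) := isUnit_C.2 h4.isUnit
  have h' := ((isCoprime_mul_unit_left_left hu _ _).2 h).symm
  have h'' := h'.add_mul_left_right (4 * C W.b₂ + 32 * X)
  refine IsCoprime.of_mul_right_left (y := derivative (C 4 * X^3 + C W.b₂ * X^2 + C (2*W.b₄) * X + C W.b₆ : K[X])) (z := derivative (C 4 * X^3 + C W.b₂ * X^2 + C (2*W.b₄) * X + C W.b₆ : K[X])) ?_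
  refine Eq.mpr (congrArg₂ IsCoprime rfl ?_) h''
  rw [hd]; simp only [C_mul, map_ofNat C]
  linear_combination 4 * hr

universe u
theorem D2 {k : Type u} [Field k] [IsAlgClosed k] (h2 : (2 : k) ≠ 0) {W : WeierstrassCurve (RatFunc k)} (hΔ : W.Δ ≠ 0) :
    (nsmulAddMonoidHom (α := W.toAffine.Point) 2).range.FiniteIndex := by
  have h2K : (2 : RatFunc k) ≠ 0 := by
    have := (map_ne_zero (algebraMap k (RatFunc k))).2 h2; rwa [map_ofNat] at this
  have h4K : (4 : RatFunc k) ≠ 0 := by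
    have := mul_ne_zero h2K h2K; norm_num at this; exact this
  obtain ⟨e₁, e₂, e₃, he⟩ : ∃ e₁ e₂ e₃ : SeparableClosure (RatFunc k), (C 4 * X^3 + C W.b₂ * X^2 + C (2*W.b₄) * X + C W.b₆ : (RatFunc k)[X]).map (algebraMap _ (SeparableClosure (RatFunc k))) = C 4 * ((X - C e₁) * (X - C e₂) * (X - C e₃)) := by
    have hsp := IsSepClosed.splits_codomain (f := algebraMap _ (SeparableClosure (RatFunc k))) _ (D2sep h2K W hΔ)
    have hd : ((C 4 * X^3 + C W.b₂ * X^2 + C (2*W.b₄) * X + C W.b₆ : (RatFunc k)[X]).map (algebraMap _ (SeparableClosure (RatFunc k)))).natDegree = 3 := by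
      rw [natDegree_map]; compute_degree!
    have hl : ((C 4 * X^3 + C W.b₂ * X^2 + C (2*W.b₄) * X + C W.b₆ : (RatFunc k)[X]).map (algebraMap _ (SeparableClosure (RatFunc k)))).leadingCoeff = 4 := by
      rw [leadingCoeff, hd]; simp [coeff_X, coeff_C, map_ofNat]
    rw [hsp.natDegree_eq_card_roots, Multiset.card_eq_three] at hd
    obtain ⟨a, b, c, h⟩ := hd
    refine ⟨a, b, c, ?_⟩
    rw [hsp.eq_prod_roots, hl, h]; simp; left; ring
  obtain ⟨M, _, _, f, _, _, hl⟩ := D_adj {e₁, e₂, e₃} (by simp)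
  obtain ⟨e₁, rfl⟩ := hl e₁ (by simp)
  obtain ⟨e₂, rfl⟩ := hl e₂ (by simp)
  obtain ⟨e₃, rfl⟩ := hl e₃ (by simp)
  have hinj := RingHom.injective f.toRingHom
  let g := algebraMap (RatFunc k) M
  have h2M : (2 : M) ≠ 0 := by
    have := (map_ne_zero g).2 h2K; rwa [map_ofNat] at this
  have hco : ∀ n, f (g ((C 4 * X^3 + C W.b₂ * X^2 + C (2*W.b₄) * X + C W.b₆ : (RatFunc k)[X]).coeff n)) = f ((C 4 * ((X - C e₁) * (X - C e₂) * (X - C e₃)) : M[X]).coeff n) := fun n => by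
    have h := congrArg (fun q => coeff q n) he
    simp only [coeff_map] at h
    have h3 : (C 4 * ((X - C (f e₁)) * (X - C (f e₂)) * (X - C (f e₃)))) = (C 4 * ((X - C e₁) * (X - C e₂) * (X - C e₃)) : M[X]).map f.toRingHom := by
      have : f 4 = 4 := map_ofNat f 4
      simp [this]
    rw [h3, coeff_map] at h
    exact (f.commutes _).trans h
  have hexp : (C 4 * ((X - C e₁) * (X - C e₂) * (X - C e₃)) : M[X]) = C 4 * X^3 + C (-4 * (e₁ + e₂ + e₃)) * X^2 + C (2*(2 * (e₁ * e₂ + e₁ * e₃ + e₂ * e₃))) * X + C (-4 * (e₁ * e₂ * e₃)) := by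
    simp only [C_mul, C_add, C_neg, map_ofNat C]; ring
  rw [hexp] at hco
  clear hexp he
  generalize hA : -4 * (e₁ + e₂ + e₃) = A at hco
  generalize hB : 2 * (e₁ * e₂ + e₁ * e₃ + e₂ * e₃) = B at hco
  generalize hC : -4 * (e₁ * e₂ * e₃) = C' at hco
  have hg2 : g 2 = 2 := map_ofNat g 2
  have hb2 : (W.map g).b₂ = -4 * (e₁ + e₂ + e₃) := by
    have := hinj (hco 2); rw [hA]; simpa [coeff_X, coeff_C, map_b₂] using this
  have hb4 : (W.map g).b₄ = 2 * (e₁ * e₂ + e₁ * e₃ + e₂ * e₃) := by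
    have := hinj (hco 1)
    rw [hB]
    simp [coeff_X, coeff_C, h2M, hg2] at this
    simpa [map_b₄] using this
  have hb6 : (W.map g).b₆ = -4 * (e₁ * e₂ * e₃) := by
    have := hinj (hco 0); rw [hC]; simpa [coeff_X, coeff_C, map_b₆] using this
  have hΔM : (W.map g).Δ ≠ 0 := by simpa [map_Δ] using hΔ
  have hD : 4 * (W.map g).Δ = 64 * ((e₁ - e₂) * (e₁ - e₃) * (e₂ - e₃))^2 := by
    have h8 := (W.map g).b_relation
    rw [WeierstrassCurve.Δ]
    rw [hb2, hb4, hb6] at h8 ⊢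
    linear_combination -(-4 * (e₁ + e₂ + e₃))^2 * h8
  have h4M : (4 : M) ≠ 0 := by
    have := mul_ne_zero h2M h2M; norm_num at this; exact this
  have hne : (e₁ - e₂) * (e₁ - e₃) * (e₂ - e₃) ≠ 0 := by
    intro h; rw [h] at hD; rw [zero_pow two_ne_zero, mul_zero] at hD; exact mul_ne_zero h4M hΔM hD
  obtain ⟨⟨h12, h13⟩, h23⟩ : (e₁ - e₂ ≠ 0 ∧ e₁ - e₃ ≠ 0) ∧ e₂ - e₃ ≠ 0 := by simpa only [mul_ne_zero_iff] using hne
  obtain ⟨M', _, _, _, _, _, _, hr⟩ := D0 (k := k) (M := M) 0 (by simpa using h2) {e₁ - e₂, e₁ - e₃, e₂ - e₃} (by simp) (by simp [h12, h13, h23])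
  have hv4 : ∀ v : Valuation M (WithZero (Multiplicative ℤ)), F6V (k := k) v → v 4 = 1 := fun v hv => by
    have := hv 4 (by have := mul_ne_zero h2 h2; norm_num at this; exact this)
    rwa [map_ofNat, map_ofNat] at this
  refine D1 (M := M') hΔ (.inl h4K) 2 two_ne_zero ?_
  have hE : {x : RatFunc k | g x ∈ ({e₁, e₂, e₃} : Set M)}.Finite :=
    Set.Finite.preimage (RingHom.injective g).injOn (by simp)
  refine ((C_fin (W := W) hE).union (Set.finite_singleton 0)).subset fun P hP => ?_
  by_contra hPn
  simp only [Set.mem_union, Set.mem_ofPred_eq, Set.mem_singleton_iff, not_or, Set.mem_insert_iff] at hPn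
  obtain ⟨⟨n1, n2, n3⟩, hP0⟩ := hPn
  refine hP ?_
  have hgg : ∀ x, algebraMap M M' (g x) = algebraMap (RatFunc k) M' x := fun x => (IsScalarTower.algebraMap_apply _ _ _ _).symm
  have hWW : (W.map g).map (algebraMap M M') = W.map (algebraMap (RatFunc k) M') := by
    rw [WeierstrassCurve.map_map]; congr 1; exact RingHom.ext hgg
  rcases P with _ | ⟨x, y, hns⟩
  · exact absurd rfl hP0
  simp only [Point.xRep_some, Matrix.cons_val_zero] at n1 n2 n3
  have hcv : ∀ a b c : M, a + b + c = e₁ + e₂ + e₃ → a * b + a * c + b * c = e₁ * e₂ + e₁ * e₃ + e₂ * e₃ → a * b * c = e₁ * e₂ * e₃ →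
      (g (2 * y + W.a₁ * x + W.a₃))^2 = 4 * ((g x - a) * ((g x - a) + (a - b)) * ((g x - a) + (a - c))) := by
    intro a b c h1 h2 h3
    have h := (equation_iff _ _).1 hns.1
    have h' := congrArg g h
    simp only [map_b₂, map_b₄, map_b₆] at hb2 hb4 hb6
    simp only [WeierstrassCurve.b₂, WeierstrassCurve.b₄, WeierstrassCurve.b₆, map_add, map_mul, map_pow, map_ofNat] at h' hb2 hb4 hb6 ⊢
    linear_combination 4 * h' + g x ^ 2 * hb2 + 2 * g x * hb4 + hb6 + 4 * g x ^ 2 * h1 - 4 * g x * h2 + 4 * h3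
  have hroot : ∀ a b c : M, a + b + c = e₁ + e₂ + e₃ → a * b + a * c + b * c = e₁ * e₂ + e₁ * e₃ + e₂ * e₃ → a * b * c = e₁ * e₂ * e₃ → g x ≠ a →
      (∀ v : Valuation M (WithZero (Multiplicative ℤ)), (∀ z ∈ ({e₁ - e₂, e₁ - e₃, e₂ - e₃} : Set M), v z = 1) → v (a - b) = 1 ∧ v (a - c) = 1) →
      ∃ r : M', r ^ 2 = algebraMap M M' (g x) - algebraMap M M' a := by
    intro a b c h1 h2 h3 hn hv
    rw [← map_sub]
    refine hr _ (sub_ne_zero.2 hn) fun v h6 hS => ?_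
    simpa using D2v v _ _ _ _ (hv4 v h6) (hv v hS).1 (hv v hS).2 (sub_ne_zero.2 hn) (hcv a b c h1 h2 h3)
  obtain ⟨r₁, hr1⟩ := hroot e₁ e₂ e₃ rfl rfl rfl n1 (fun v hv => ⟨hv _ (by simp), hv _ (by simp)⟩)
  obtain ⟨r₂, hr2⟩ := hroot e₂ e₁ e₃ (by ring) (by ring) (by ring) n2 (fun v hv => ⟨by rw [Valuation.map_sub_swap]; exact hv _ (by simp), hv _ (by simp)⟩)
  obtain ⟨r₃, hr3⟩ := hroot e₃ e₁ e₂ (by ring) (by ring) (by ring) n3 (fun v hv => ⟨by rw [Valuation.map_sub_swap]; exact hv _ (by simp), by rw [Valuation.map_sub_swap]; exact hv _ (by simp)⟩)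
  have hx : (CM (algebraMap (RatFunc k) M') (rfl : W.map _ = _) (.some x y hns)).xRep 0 = algebraMap M M' (g x) := by
    rw [CM_xRep, hgg]; simp
  refine D2a (r₁ := r₁) (r₂ := r₂) (r₃ := r₃) (by have := (map_ne_zero (algebraMap M M')).2 h2M; rwa [map_ofNat] at this) (by simpa [map_Δ] using hΔ)
    (algebraMap M M' e₁) (algebraMap M M' e₂) (algebraMap M M' e₃) ?_ ?_ ?_ _ ?_ (by rw [hx, hr1]) (by rw [hx, hr2]) (by rw [hx, hr3])
  · rw [← hWW, map_b₂, hb2]; simp only [map_mul, map_add, map_neg, map_ofNat]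
  · rw [← hWW, map_b₄, hb4]; simp only [map_mul, map_add, map_neg, map_ofNat]
  · rw [← hWW, map_b₆, hb6]; simp only [map_mul, map_add, map_neg, map_ofNat]
  · intro h; exact hP0 (CM_inj _ _ (h.trans (map_zero _).symm))
end D2
end MD2

section MD3
open Polynomial WeierstrassCurve WeierstrassCurve.Affine WithZero

section D3
open Classical

theorem D3a0 {L : Type*} [Field L] [c2 : CharP L 2] (om b d l m n X : L) (ho : om^2 + om + 1 = 0) (hb : b = d^3 + 1) (hb0 : b ≠ 0) (hd : d ≠ 0)
    (h1 : l * (1 + m^3 + n^3) = 1) (h2 : l * m * n = d) (hX : X = l^2*m^3*n^3 + l^2 + l + 1) :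
    ∃ Q Y : L, Y^2 + Q * Y + b * Y = Q^3 ∧ Q^4+b*Q^2+Q*(Q+b)^2 ≠ 0 ∧ (Q+b)^3*(Q^4+b^3) = (Q + X) * (Q^4+b*Q^2+Q*(Q+b)^2)^2 := by
  obtain ⟨l0, hl0⟩ : ∃ l0, l0 = 1 + d * (m + n) := ⟨_, rfl⟩
  obtain ⟨l1, hl1⟩ : ∃ l1, l1 = 1 + om^2 * d * m + om * d * n := ⟨_, rfl⟩
  obtain ⟨l2, hl2⟩ : ∃ l2, l2 = 1 + l0 + l1 := ⟨_, rfl⟩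
  have hl0' : l ≠ 0 := by rintro rfl; simp at h1
  have hmn : m * n ≠ 0 := by rintro h; apply hd; rw [← h2, mul_assoc, h, mul_zero]
  have hds : d * (1 + m^3 + n^3) = m * n := by clear * - h1 h2 c2; grind
  have hl12 : l1 * l2 = 1+d*(m+n)+d^2*(m^2+n^2+m*n) := by rw [hl2, hl1, hl0]; clear * - ho c2; grind
  have hlb : l0 * (l1 * l2) = b := by rw [hl12, hl0, hb]; clear * - hds c2; grind
  have hl00 : l0 ≠ 0 := by rintro h; rw [h, zero_mul] at hlb; exact hb0 hlb.symm
  obtain ⟨Q, hQ⟩ : ∃ Q, Q = l1 * l2 := ⟨_, rfl⟩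
  rw [← hQ] at hlb
  have hQ0 : Q ≠ 0 := by rintro h; rw [h, mul_zero] at hlb; exact hb0 hlb.symm
  have hQb : Q + b = Q * d * (m + n) := by
    rw [← hlb, hl0]; clear * - c2; grind
  have hpsi : Q^4+b*Q^2+Q*(Q+b)^2 = Q^3 * d^2 * (m*n) := by
    have hc : Q + l0 + d^2*(m+n)^2 = d^2 *(m*n) := by rw [hQ, hl12, hl0]; clear * - c2; grind
    rw [hQb]; linear_combination Q^3 * hc - Q^2 * hlb
  refine ⟨Q, l1 * Q, ?_, ?_, ?_⟩
  · have : l1 + 1 + l0 = l2 := by rw [hl2]; ring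
    rw [← hlb]; rw [hQ]; clear * - c2 this; grind
  · rw [hpsi]; exact mul_ne_zero (mul_ne_zero (pow_ne_zero _ hQ0) (pow_ne_zero _ hd)) hmn
  · rw [hpsi, hQb]
    have e2 : Q^4 + b^3 = Q^3 * (Q + l0^3) := by rw [← hlb]; ring
    have e3 : l0 * (Q + l0^3) = d^3 * (1 + d * (m+n)^4) := by
      rw [mul_add, hlb, hl0, hb]; clear * - c2; grind
    have hXm : X * (m*n)^2 = d^2 * (1 + m^3 + n^3 + m^6 + n^6 + m^3*n^3) := by
      rw [hX]; 
      have : (1 + m^3 + n^3 + m^6 + n^6 + m^3*n^3) = (1+m^3+n^3)^2 * (l^2*m^3*n^3 + l^2 + l + 1) := by clear * - h1 c2; grind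
      rw [this, ← hds]; ring
    have e4 : (m+n)^3 * (d^3 * (1 + d * (m+n)^4)) = (b + l0 * X) * d * (m * n)^2 := by
      have e5 : (m+n)^3 * (1 + d * (m+n)^4) = (d^3+1)*(1+m^3+n^3)^2 + l0 * (1 + m^3 + n^3 + m^6 + n^6 + m^3*n^3) := by
        rw [hl0]; clear * - hds c2; grind
      rw [show (b + l0 * X) * d * (m * n)^2 = b * d * (m*n)^2 + l0 * d * (X * (m*n)^2) by ring, hXm, ← hds, hb]
      linear_combination d^3 * e5
    rw [e2]
    apply mul_left_cancel₀ hl00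
    rw [← hlb] at e4
    linear_combination Q^6 * d^3 * (m+n)^3 * e3 + Q^6 * d^3 * e4

theorem D3a {L : Type*} [Field L] [c2 : CharP L 2] {W : WeierstrassCurve L} (hΔ : W.Δ ≠ 0) (w r b : L) (hw : w ≠ 0) (hb2 : W.b₂ = w) (hb4 : W.b₄ = w^2*b+r*w)
    (hb6 : W.b₆ = w^3*b^2+r^2*w) (hb8 : W.b₈ = r * W.b₆ + r^2*W.b₄+r^3*W.b₂+r^4)
    (hE : ∀ X Y, Y^2 + X * Y + b * Y = X^3 → ∃ y, W.toAffine.Equation (w*X+r) y) (P : W.toAffine.Point) (hP : P ≠ 0) (X Q Y : L) (hX : P.xRep 0 = w * X + r)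
    (h1 : Y^2 + Q * Y + b * Y = Q^3) (h2 : Q^4+b*Q^2+Q*(Q+b)^2 ≠ 0) (h3 : (Q+b)^3*(Q^4+b^3) = (Q + X) * (Q^4+b*Q^2+Q*(Q+b)^2)^2) :
    ∃ R : W.toAffine.Point, 3 • R = P := by
  obtain ⟨y, heq⟩ := hE Q Y h1
  have hns := (equation_iff_nonsingular_of_Δ_ne_zero hΔ).1 heq
  obtain ⟨x, hx⟩ : ∃ x, x = w * Q + r := ⟨_, rfl⟩
  rw [← hx] at heq hns
  obtain ⟨c, hc, e0, e1⟩ := A_dbl W hns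
  rw [← two_nsmul] at e0 e1
  obtain ⟨N, hN⟩ : ∃ N, N = w^3 * (Q+b)^2 := ⟨_, rfl⟩
  obtain ⟨M, hM⟩ : ∃ M, M = w^4 * (Q^2*(Q^2+b)) + r * N := ⟨_, rfl⟩
  have e0' : (2 • Point.some x y hns).xRep 0 = c * M := by
    rw [e0, hM, hN, hb8, hb6, hb4, hb2, hx]; clear * - c2; grind
  have e1' : (2 • Point.some x y hns).xRep 1 = c * N := by
    rw [e1, hN, hb6, hb4, hb2, hx]; clear * - c2; grind
  obtain ⟨c', hc', -, f1, f2⟩ := A_addsub W (2 • Point.some x y hns) (Point.some x y hns)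
  rw [← succ_nsmul, succ_nsmul _ 1, one_nsmul, add_sub_cancel_right, ← two_nsmul] at f1 f2
  rw [e0', e1'] at f1 f2
  simp only [Point.xRep_some, Matrix.cons_val_zero, Matrix.cons_val_one, mul_one] at f1 f2
  obtain ⟨H, hH⟩ : ∃ H, H = Q^4+b*Q^2+Q*(Q+b)^2 := ⟨_, rfl⟩
  rw [← hH] at h2 h3
  have f2' : (3 • Point.some x y hns).xRep 1 = c' * c^2 * w^8 * H^2 := by
    rw [f2, hM, hN, hx, hH]; clear * - c2; grind
  have f1' : (3 • Point.some x y hns).xRep 0 = (w * X + r) * (3 • Point.some x y hns).xRep 1 := by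
    have : W.b₂ * M * x * N + W.b₄ * (M + N * x) * N + W.b₆ * N^2 = w^9 * ((Q+b)^3*(Q^4+b^3)) := by
      rw [hb6, hb4, hb2, hM, hN, hx]; clear * - c2; grind
    rw [h3] at this
    have h : (3 • Point.some x y hns).xRep 0 + (3 • Point.some x y hns).xRep 1 * x = c' * c^2 * (w^9 * ((Q + X) * H^2)) := by
      rw [f1, ← this]; clear * - c2; grind
    rw [f2'] at h ⊢
    generalize (3 • Point.some x y hns).xRep 0 = A at h ⊢
    rw [hx] at h
    clear * - h c2; grind
  have h30 : 3 • Point.some x y hns ≠ 0 := C_rep1' (by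
    rw [f2']; exact mul_ne_zero (mul_ne_zero (mul_ne_zero hc' (pow_ne_zero _ hc)) (pow_ne_zero _ hw)) (pow_ne_zero _ h2))
  rw [C_rep1 h30, mul_one, ← hX] at f1'
  rcases C_pm h30 hP f1' with h | h
  · exact ⟨_, h⟩
  · exact ⟨-Point.some x y hns, by rw [smul_neg, h, neg_neg]⟩

theorem D3t {M : Type*} [Field M] (v : Valuation M (WithZero (Multiplicative ℤ))) {x y : M} {a b : ℤ} (hx : v x = exp a) (hy : v y = exp b) :
    (a < b → v (x + y) = exp b) ∧ (b < a → v (x + y) = exp a) ∧ v (x + y) ≤ exp (max a b) := by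
  refine ⟨fun h => ?_, fun h => ?_, ?_⟩
  · rw [Valuation.map_add_eq_of_lt_right v (by rwa [hx, hy, exp_lt_exp]), hy]
  · rw [Valuation.map_add_eq_of_lt_left v (by rwa [hx, hy, exp_lt_exp]), hx]
  · refine (v.map_add x y).trans ?_
    rw [hx, hy]; exact max_le (exp_le_exp.2 (le_max_left _ _)) (exp_le_exp.2 (le_max_right _ _))

theorem D3e {M : Type*} [Field M] (v : Valuation M (WithZero (Multiplicative ℤ))) {z : M} (hz : z ≠ 0) : ∃ n : ℤ, v z = exp n :=
  ⟨_, (exp_log ((Valuation.ne_zero_iff v).2 hz)).symm⟩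

theorem D3v1 {M : Type*} [Field M] [c2 : CharP M 2] (v : Valuation M (WithZero (Multiplicative ℤ))) (b X Y : M) (hb : v b = 1) (hX : X ≠ 0) (h : Y * (Y + X + b) = X^3) :
    ∃ n : ℤ, v Y = exp (3 * n) := by
  have h0 : Y * (Y + X + b) ≠ 0 := by rw [h]; exact pow_ne_zero _ hX
  obtain ⟨s, hs⟩ := D3e v hX
  obtain ⟨t, ht⟩ := D3e v (left_ne_zero_of_mul h0)
  obtain ⟨t', ht'⟩ := D3e v (right_ne_zero_of_mul h0)
  have e := congrArg v h
  rw [map_mul, map_pow, hs, ht, ht', ← exp_add, ← exp_nsmul, exp_inj, nsmul_eq_mul] at e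
  push_cast at e
  rw [← exp_zero] at hb
  obtain ⟨a1, a2, a3⟩ := D3t v hs hb
  obtain ⟨b1, b2, b3⟩ := D3t v ht ht'
  rw [show Y + (Y + X + b) = X + b by clear * - c2; grind] at b1 b2 b3
  simp only [ht, exp_inj]
  rcases lt_trichotomy s 0 with h1 | h1 | h1
  · rw [a1 h1] at b1 b2 b3
    simp only [exp_inj, exp_le_exp] at b1 b2 b3
    rcases lt_trichotomy t t' with h2 | h2 | h2
    · exact ⟨s, by have := b1 h2; omega⟩
    · omega
    · exact ⟨0, by have := b2 h2; omega⟩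
  · refine ⟨0, ?_⟩
    rcases lt_trichotomy t t' with h2 | h2 | h2
    · rw [b1 h2, exp_le_exp] at a3; omega
    · omega
    · rw [b2 h2, exp_le_exp] at a3; omega
  · rw [a2 h1] at b1 b2 b3
    simp only [exp_inj, exp_le_exp] at b1 b2 b3
    exact ⟨t - s, by omega⟩

theorem D3v2 {M : Type*} [Field M] (v : Valuation M (WithZero (Multiplicative ℤ))) (d x y z : M) (hd : v d = 1) (hd0 : d ≠ 0) (h : x * y * z = d^3) (h1 : x + y + z = 1) :
    ∃ n : ℤ, v (y / x) = exp (3 * n) := by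
  have h0 : x * y * z ≠ 0 := by rw [h]; exact pow_ne_zero _ hd0
  obtain ⟨a, ha⟩ := D3e v (left_ne_zero_of_mul (left_ne_zero_of_mul h0))
  obtain ⟨b, hb⟩ := D3e v (right_ne_zero_of_mul (left_ne_zero_of_mul h0))
  obtain ⟨c, hc⟩ := D3e v (right_ne_zero_of_mul h0)
  have e := congrArg v h
  rw [map_mul, map_mul, map_pow, ha, hb, hc, hd, one_pow, ← exp_add, ← exp_add, ← exp_zero, exp_inj] at e
  rw [map_div₀, ha, hb, ← exp_sub]
  simp only [exp_inj]
  have h1' := congrArg v h1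
  rw [map_one, ← exp_zero] at h1'
  obtain ⟨a1, a2, a3⟩ := D3t v ha hb
  by_cases hab : a = b
  · exact ⟨0, by omega⟩
  obtain ⟨m, hm, hm'⟩ : ∃ m, v (x + y) = exp m ∧ m = max a b := by
    rcases lt_or_gt_of_ne hab with h | h
    · exact ⟨b, a1 h, by omega⟩
    · exact ⟨a, a2 h, by omega⟩
  obtain ⟨b1, b2, b3⟩ := D3t v hm hc
  rw [h1'] at b1 b2 b3
  simp only [exp_inj, exp_le_exp] at b1 b2 b3
  have hmc : m = c := by
    rcases lt_trichotomy m c with h | h | h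
    · have := b1 h; omega
    · exact h
    · have := b2 h; omega
  rcases lt_or_gt_of_ne hab with h | h
  · exact ⟨b, by omega⟩
  · exact ⟨-a, by omega⟩
end D3
end MD3

section MD4
open Polynomial WeierstrassCurve WeierstrassCurve.Affine WithZero

section D4
open Classical

structure D3N {L : Type*} [Field L] (W : WeierstrassCurve L) (r s t b d : L) : Prop where
  u0 : W.a₁ ≠ 0
  b0 : b ≠ 0
  d0 : d ≠ 0
  d3 : b = d^3 + 1
  a3 : W.a₃ = b * W.a₁^3 + r * W.a₁
  a2 : W.a₂ = s * W.a₁ + r + s^2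
  a4 : W.a₄ = s * W.a₃ + (t + r * s) * W.a₁ + r^2
  a6 : W.a₆ = r * W.a₄ + r^2 * W.a₂ + r^3 + t * W.a₃ + t^2 + r * t * W.a₁

section
variable {L : Type*} [Field L] [c2 : CharP L 2] {W : WeierstrassCurve L} {r s t b d : L}

theorem D3N.b2 : W.b₂ = W.a₁^2 := by
  rw [WeierstrassCurve.b₂]; grind

theorem D3N.b4 (h : W.a₃ = b * W.a₁^3 + r * W.a₁) : W.b₄ = (W.a₁^2)^2 * b + r * W.a₁^2 := by
  rw [WeierstrassCurve.b₄, h]; clear * - c2; grind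

theorem D3N.b6 (h : W.a₃ = b * W.a₁^3 + r * W.a₁) : W.b₆ = (W.a₁^2)^3 * b^2 + r^2 * W.a₁^2 := by
  rw [WeierstrassCurve.b₆, h]; clear * - c2; grind

theorem D3N.b8 (a3 : W.a₃ = b * W.a₁^3 + r * W.a₁) (a2 : W.a₂ = s * W.a₁ + r + s^2) (a4 : W.a₄ = s * W.a₃ + (t + r * s) * W.a₁ + r^2)
  (a6 : W.a₆ = r * W.a₄ + r^2 * W.a₂ + r^3 + t * W.a₃ + t^2 + r * t * W.a₁) : W.b₈ = r * W.b₆ + r^2*W.b₄+r^3*W.b₂+r^4 := by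
  rw [D3N.b6 a3, D3N.b4 a3, D3N.b2, WeierstrassCurve.b₈, a6, a4, a2, a3]; clear * - c2; grind

theorem D3N.eqn (h : D3N W r s t b d) (X Y : L) : W.toAffine.Equation (W.a₁^2*X+r) (W.a₁^3*Y+s*W.a₁^2*X+t) ↔ Y * (Y + X + b) = X^3 := by
  rw [equation_iff, h.a6, h.a4, h.a2, h.a3]
  have := h.u0
  constructor
  · intro h
    apply mul_left_cancel₀ (pow_ne_zero 6 this)
    clear * - h c2; grind
  · intro h; clear * - h c2; grind

theorem D3n [IsSepClosed L] (hΔ : W.Δ ≠ 0) (hu : W.a₁ ≠ 0) : ∃ r s t b d, D3N W r s t b d := by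
  have hr : ∃ r, r^4 + W.b₂ * r^3 + W.b₄ * r^2 + W.b₆ * r + W.b₈ = 0 := by
    have hsep : (X^4 + C W.b₂ * X^3 + C W.b₄ * X^2 + C W.b₆ * X + C W.b₈ : L[X]).Separable := by
      have hd : derivative (X^4 + C W.b₂ * X^3 + C W.b₄ * X^2 + C W.b₆ * X + C W.b₈ : L[X]) = C (W.a₁^2) * (X - C (W.a₃ / W.a₁))^2 := by
        have h2 : (2 : L[X]) = 0 := CharTwo.two_eq_zero
        have e : C W.a₁ * C (W.a₃ / W.a₁) = C W.a₃ := by rw [← C_mul]; congr 1; field_simp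
        have e6 : C W.b₆ = C W.a₃ ^ 2 := by rw [← C_pow]; congr 1; rw [WeierstrassCurve.b₆]; clear * - c2; grind
        simp only [derivative_add, derivative_mul, derivative_C, derivative_X_pow, derivative_X]
        rw [D3N.b2, e6, C_pow]
        push_cast
        simp only [map_ofNat C]
        linear_combination (2 * X^3 + C W.a₁^2 * X^2 + C W.b₄ * X + X * C W.a₁ * C W.a₃ ) * h2 + (2 * C W.a₁ * X - C W.a₁ * C (W.a₃/W.a₁) - C W.a₃) * e
      rw [Polynomial.Separable, hd]
      refine IsCoprime.symm ?_
      refine (isCoprime_mul_unit_left_left (isUnit_C.2 (pow_ne_zero 2 hu).isUnit) _ _).2 (IsCoprime.pow_left ?_)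
      rw [(irreducible_X_sub_C _).coprime_iff_not_dvd, dvd_iff_isRoot, IsRoot]
      intro h
      simp only [eval_add, eval_mul, eval_C, eval_pow, eval_X] at h
      apply hΔ
      have hq : W.a₃ = W.a₃ / W.a₁ * W.a₁ := by field_simp
      generalize W.a₃ / W.a₁ = q at h hq
      rw [D3N.b2, WeierstrassCurve.b₄, WeierstrassCurve.b₆] at h
      rw [WeierstrassCurve.Δ, D3N.b2, WeierstrassCurve.b₄, WeierstrassCurve.b₆]
      rw [hq] at h ⊢
      generalize W.b₈ = B at h ⊢
      clear * - h c2; grind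
    obtain ⟨r, hr⟩ := IsSepClosed.exists_root (X^4 + C W.b₂ * X^3 + C W.b₄ * X^2 + C W.b₆ * X + C W.b₈ : L[X]) (by
      have : (X^4 + C W.b₂ * X^3 + C W.b₄ * X^2 + C W.b₆ * X + C W.b₈ : L[X]).degree = 4 := by compute_degree!
      rw [this]; decide) hsep
    exact ⟨r, by simpa using hr⟩
  obtain ⟨r, hr⟩ := hr
  have hc : W.a₃ + r * W.a₁ ≠ 0 := by
    intro h
    apply hΔ
    have hq : W.a₃ = r * W.a₁ := by clear * - h c2; grind
    rw [D3N.b2, WeierstrassCurve.b₄, WeierstrassCurve.b₆] at hr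
    rw [WeierstrassCurve.Δ, D3N.b2, WeierstrassCurve.b₄, WeierstrassCurve.b₆]
    rw [hq] at hr ⊢
    generalize W.b₈ = B at hr ⊢
    clear * - hr c2; grind
  have ht : ∃ t, t^2 + (W.a₃ + r * W.a₁) * t + (r^3 + W.a₂ * r^2 + W.a₄ * r + W.a₆) = 0 := by
    obtain ⟨t, ht⟩ := IsSepClosed.exists_root (X^2 + C (W.a₃ + r * W.a₁) * X + C (r^3 + W.a₂ * r^2 + W.a₄ * r + W.a₆) : L[X]) (by
      have : (X^2 + C (W.a₃ + r * W.a₁) * X + C (r^3 + W.a₂ * r^2 + W.a₄ * r + W.a₆) : L[X]).degree = 2 := by compute_degree!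
      rw [this]; decide) (by
      have hd : derivative (X^2 + C (W.a₃ + r * W.a₁) * X + C (r^3 + W.a₂ * r^2 + W.a₄ * r + W.a₆) : L[X]) = C (W.a₃ + r * W.a₁) := by
        have h2 : (2 : L[X]) = 0 := CharTwo.two_eq_zero
        simp only [derivative_add, derivative_mul, derivative_C, derivative_X_pow, derivative_X]
        push_cast
        simp only [map_ofNat C]
        linear_combination X * h2
      rw [Polynomial.Separable, hd]
      exact ⟨0, C (W.a₃ + r * W.a₁)⁻¹, by rw [zero_mul, zero_add, ← C_mul, inv_mul_cancel₀ hc, C_1]⟩)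
    exact ⟨t, by simpa using ht⟩
  obtain ⟨t, ht⟩ := ht
  obtain ⟨s, hs⟩ : ∃ s, s * (W.a₃ + r * W.a₁) = r^2 + W.a₄ + W.a₁ * t := ⟨(r^2 + W.a₄ + W.a₁ * t) / (W.a₃ + r * W.a₁), by field_simp⟩
  obtain ⟨b, hb⟩ : ∃ b, b * W.a₁^3 = W.a₃ + r * W.a₁ := ⟨(W.a₃ + r * W.a₁) / W.a₁^3, by field_simp⟩
  have hb0 : b ≠ 0 := by rintro rfl; rw [zero_mul] at hb; exact hc hb.symm
  have : NeZero ((3 : ℕ) : L) := ⟨by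
    have h2 : (2 : L) = 0 := CharTwo.two_eq_zero
    intro h; push_cast at h; exact one_ne_zero (α := L) (by linear_combination h - h2)⟩
  obtain ⟨d, hd⟩ := IsSepClosed.exists_pow_nat_eq (b + 1) 3
  have a3 : W.a₃ = b * W.a₁^3 + r * W.a₁ := by rw [hb]; clear * - c2; grind
  have a4 : W.a₄ = s * W.a₃ + (t + r * s) * W.a₁ + r^2 := by clear * - c2 hs; grind
  have a6 : W.a₆ = r * W.a₄ + r^2 * W.a₂ + r^3 + t * W.a₃ + t^2 + r * t * W.a₁ := by clear * - c2 ht; grind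
  have a2 : W.a₂ = s * W.a₁ + r + s^2 := by
    apply mul_left_cancel₀ (pow_ne_zero 2 hc)
    rw [D3N.b2, WeierstrassCurve.b₄, WeierstrassCurve.b₆, WeierstrassCurve.b₈, a6, a4] at hr
    clear * - hr c2; grind
  refine ⟨r, s, t, b, d, hu, hb0, ?_, ?_, a3, a2, a4, a6⟩
  · rintro rfl
    have hb1 : b = 1 := by clear * - c2 hd; grind
    subst hb1
    apply hΔ
    rw [WeierstrassCurve.Δ, D3N.b8 a3 a2 a4 a6, D3N.b6 a3, D3N.b4 a3, D3N.b2]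
    clear * - c2; grind
  · rw [hd]; clear * - c2; grind
end

theorem D3N_map {L L' : Type*} [Field L] [Field L'] (f : L →+* L') {W : WeierstrassCurve L} {r s t b d : L} :
    D3N (W.map f) (f r) (f s) (f t) (f b) (f d) ↔ D3N W r s t b d := by
  have hi := f.injective
  constructor
  · rintro ⟨h1, h2, h3, h4, h5, h6, h7, h8⟩
    simp only [map_a₁, map_a₂, map_a₃, map_a₄, map_a₆, ← map_mul, ← map_pow, ← map_add, _root_.map_ne_zero, ← map_one f] at *
    exact ⟨h1, h2, h3, hi h4, hi h5, hi h6, hi h7, hi h8⟩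
  · rintro ⟨h1, h2, h3, h4, h5, h6, h7, h8⟩
    constructor
    all_goals
      simp only [map_a₁, map_a₂, map_a₃, map_a₄, map_a₆, ← map_mul, ← map_pow, ← map_add, _root_.map_ne_zero, ← map_one f, hi.eq_iff]
      assumption

theorem D3c {L : Type*} [Field L] (om a c X : L) (ho : om^2 + om + 1 = 0) (h : (a * c)^3 = X^3) : ∃ c', c'^3 = c^3 ∧ a * c' = X := by
  have h3 : om^3 = 1 := by linear_combination (om - 1) * ho
  have : (a * c - X) * ((a * c - om * X) * (a * c - om^2 * X)) = 0 := by
    linear_combination h - (a * c * X * (a * c - X)) * ho + a * c * X^2 * (om * ho - h3) + (a * c - X) * X^2 * h3 - a * c * X^2 *ho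
  rcases mul_eq_zero.1 this with h | h
  · exact ⟨c, rfl, by linear_combination h⟩
  rcases mul_eq_zero.1 h with h | h
  · exact ⟨om^2 * c, by linear_combination c^3 * (om^3 + 1) * h3, by linear_combination om^2 * h + X * h3⟩
  · exact ⟨om * c, by linear_combination c^3 * h3, by linear_combination om * h + X * h3⟩

theorem D3s1 {L : Type*} [Field L] [c2 : CharP L 2] (om b d X Y v w : L) (ho : om^2 + om + 1 = 0) (hv : v^3 = Y) (hw : w^3 = Y + X + b) (h : Y * (Y + X + b) = X^3) (hb : b = d^3 + 1) :
    ∃ x y z : L, x + y + z = 1 ∧ x * y * z = d^3 ∧ X = y * z + x^2 + x + 1 := by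
  obtain ⟨w, hw', hvw⟩ := D3c om v w X ho (by rw [mul_pow, hv, hw, h])
  rw [← hw', ← hv] at hw
  rw [← hvw, hb] at hw
  refine ⟨w + v + 1, om * w + om^2 * v + 1, om^2 * w + om * v + 1, ?_, ?_, ?_⟩
  · clear * - c2 ho; grind
  · clear * - c2 ho hw; grind
  · rw [← hvw]; clear * - c2 ho; grind

theorem D3s2 {L : Type*} [Field L] (om d X x y z m n : L) (ho : om^2 + om + 1 = 0) (hd : d ≠ 0) (h1 : x + y + z = 1) (h2 : x * y * z = d^3) (h3 : X = y * z + x^2 + x + 1)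
    (hm : m^3 = y / x) (hn : n^3 = z / x) : ∃ l m n : L, l * (1 + m^3 + n^3) = 1 ∧ l * m * n = d ∧ X = l^2*m^3*n^3 + l^2 + l + 1 := by
  have hx : x ≠ 0 := by rintro rfl; rw [zero_mul, zero_mul] at h2; exact pow_ne_zero 3 hd h2.symm
  have hm' : x * m^3 = y := by rw [hm]; field_simp
  have hn' : x * n^3 = z := by rw [hn]; field_simp
  obtain ⟨n, hn1, hn2⟩ := D3c om (x * m) n d ho (by rw [← h2, ← hm', ← hn']; ring)
  rw [← hn1] at hn'
  refine ⟨x, m, n, ?_, hn2, ?_⟩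
  · linear_combination h1 + hm' + hn'
  · rw [h3, ← hm', ← hn']; ring

universe u
theorem D4 {k : Type u} [Field k] [IsAlgClosed k] [c2 : CharP k 2] {W : WeierstrassCurve (RatFunc k)} (hΔ : W.Δ ≠ 0) (hu : W.a₁ ≠ 0) :
    (nsmulAddMonoidHom (α := W.toAffine.Point) 3).range.FiniteIndex := by
  have cK : CharP (RatFunc k) 2 := charP_of_injective_algebraMap (algebraMap k (RatFunc k)).injective 2
  have hc : ∀ (M : Type u) [Field M] [Algebra (RatFunc k) M], CharP M 2 := fun M _ _ => charP_of_injective_algebraMap (algebraMap (RatFunc k) M).injective 2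
  have c3 : ((1 + 2 : ℕ) : k) ≠ 0 := by
    have h2 : (2 : k) = 0 := CharTwo.two_eq_zero
    intro h; push_cast at h; exact one_ne_zero (α := k) (by linear_combination h - h2)
  obtain ⟨om, hom⟩ : ∃ om : k, om^2 + om + 1 = 0 := by
    obtain ⟨t, ht⟩ := IsAlgClosed.exists_root (X^2 + X + C 1 : k[X]) (by
      have : (X^2 + X + C 1 : k[X]).degree = 2 := by compute_degree!
      rw [this]; decide)
    exact ⟨t, by simpa using ht⟩
  have hoM : ∀ (M : Type u) [Field M] [Algebra (RatFunc k) M], ∃ om : M, om^2 + om + 1 = 0 := fun M _ _ =>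
    ⟨algebraMap (RatFunc k) M (algebraMap k _ om), by rw [← map_pow, ← map_pow, ← map_add, ← map_add, ← map_one (algebraMap (RatFunc k) M), ← map_one (algebraMap k (RatFunc k)), ← map_add, ← map_add, hom, map_zero, map_zero]⟩
  have := hc (SeparableClosure (RatFunc k))
  obtain ⟨r, s, t, b, d, hN⟩ := D3n (W := W.map (algebraMap (RatFunc k) (SeparableClosure (RatFunc k)))) (by simpa [map_Δ] using hΔ) (by simpa using hu)
  obtain ⟨M, _, _, f, _, _, hl⟩ := D_adj {r, s, t, b, d} (by simp)
  obtain ⟨r, rfl⟩ := hl r (by simp)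
  obtain ⟨s, rfl⟩ := hl s (by simp)
  obtain ⟨t, rfl⟩ := hl t (by simp)
  obtain ⟨b, rfl⟩ := hl b (by simp)
  obtain ⟨d, rfl⟩ := hl d (by simp)
  let g := algebraMap (RatFunc k) M
  have hN : D3N (W.map g) r s t b d := by
    rw [← D3N_map f.toRingHom, WeierstrassCurve.map_map]
    have : f.toRingHom.comp g = algebraMap _ _ := f.comp_algebraMap
    rw [this]; exact hN
  have := hc M
  obtain ⟨M₁, _, _, _, _, _, _, hr1⟩ := D0 (k := k) (M := M) 1 c3 {b} (by simp) (by simpa using hN.b0)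
  have := hc M₁
  let g₁ := algebraMap M M₁
  obtain ⟨M₂, _, _, _, _, _, _, hr2⟩ := D0 (k := k) (M := M₁) 1 c3 {g₁ d} (by simp) (by simpa using hN.d0)
  have := hc M₂
  let g₂ := algebraMap M₁ M₂
  have hg : ∀ x, algebraMap (RatFunc k) M₂ x = g₂ (g₁ (g x)) := fun x => by
    rw [IsScalarTower.algebraMap_apply (RatFunc k) M₁ M₂, IsScalarTower.algebraMap_apply (RatFunc k) M M₁]
  refine D1 (M := M₂) hΔ (.inr (by rw [D3N.b2]; exact pow_ne_zero 2 hu)) 3 three_ne_zero ?_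
  have hE : {x : RatFunc k | g x ∈ ({r} : Set M)}.Finite :=
    Set.Finite.preimage (RingHom.injective g).injOn (by simp)
  refine ((C_fin (W := W) hE).union (Set.finite_singleton 0)).subset fun P hP => ?_
  by_contra hPn
  simp only [Set.mem_union, Set.mem_ofPred_eq, Set.mem_singleton_iff, not_or] at hPn
  obtain ⟨n1, hP0⟩ := hPn
  refine hP ?_
  rcases P with _ | ⟨x, y, hns⟩
  · exact absurd rfl hP0
  simp only [Point.xRep_some, Matrix.cons_val_zero] at n1
  have hu' := hN.u0
  generalize hU : (W.map g).a₁ = U at hu'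
  obtain ⟨X, hX⟩ : ∃ X, U^2 * X + r = g x := ⟨(g x - r) / U^2, by field_simp; ring⟩
  obtain ⟨Y, hY⟩ : ∃ Y, U^3 * Y + s * U^2 * X + t = g y := ⟨(g y - s * U^2 * X - t) / U^3, by field_simp; ring⟩
  have hX0 : X ≠ 0 := by rintro rfl; apply n1; rw [← hX]; ring
  have heq : Y * (Y + X + b) = X^3 := by
    rw [← hN.eqn, hU, hX, hY]
    exact ((map_nonsingular (W := W.toAffine) g.injective x y).2 hns).1
  have hY0 : Y * (Y + X + b) ≠ 0 := by rw [heq]; exact pow_ne_zero _ hX0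
  obtain ⟨v, hv⟩ := hr1 Y (left_ne_zero_of_mul hY0) fun v _ hb => by
    simpa using D3v1 v b X Y (hb b rfl) hX0 heq
  obtain ⟨w, hw⟩ := hr1 (Y + X + b) (right_ne_zero_of_mul hY0) fun v _ hb => by
    have : (Y + X + b) * ((Y + X + b) + X + b) = X^3 := by rw [← heq]; clear * - this; grind
    simpa using D3v1 v b X _ (hb b rfl) hX0 this
  obtain ⟨om1, hom1⟩ := hoM M₁
  obtain ⟨om2, hom2⟩ := hoM M₂
  obtain ⟨x₁, y₁, z₁, s1, s2, s3⟩ := D3s1 om1 (g₁ b) (g₁ d) (g₁ X) (g₁ Y) v w hom1 hv (by rw [hw]; simp [g₁]) (by rw [← map_pow, ← heq]; simp) (by rw [hN.d3]; simp)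
  have hd1 : g₁ d ≠ 0 := by simpa using hN.d0
  have hxyz : x₁ * y₁ * z₁ ≠ 0 := by rw [s2]; exact pow_ne_zero _ hd1
  obtain ⟨m, hm⟩ := hr2 (y₁ / x₁) (div_ne_zero (right_ne_zero_of_mul (left_ne_zero_of_mul hxyz)) (left_ne_zero_of_mul (left_ne_zero_of_mul hxyz))) fun v _ hb => by
    simpa using D3v2 v _ _ _ _ (hb _ rfl) hd1 s2 s1
  obtain ⟨n, hn⟩ := hr2 (z₁ / x₁) (div_ne_zero (right_ne_zero_of_mul hxyz) (left_ne_zero_of_mul (left_ne_zero_of_mul hxyz))) fun v _ hb => by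
    simpa using D3v2 v _ x₁ z₁ y₁ (hb _ rfl) hd1 (by rw [← s2]; ring) (by rw [← s1]; ring)
  obtain ⟨l, m, n, q1, q2, q3⟩ := D3s2 om2 (g₂ (g₁ d)) (g₂ (g₁ X)) (g₂ x₁) (g₂ y₁) (g₂ z₁) m n hom2 (by simpa using hN.d0) (by rw [← map_add, ← map_add, s1, map_one])
    (by rw [← map_mul, ← map_mul, s2, map_pow]) (by rw [s3]; simp) (by rw [← map_div₀]; exact hm) (by rw [← map_div₀]; exact hn)
  have hN2 : D3N (W.map (algebraMap (RatFunc k) M₂)) (g₂ (g₁ r)) (g₂ (g₁ s)) (g₂ (g₁ t)) (g₂ (g₁ b)) (g₂ (g₁ d)) := by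
    have := (D3N_map g₂).2 ((D3N_map g₁).2 hN)
    rw [WeierstrassCurve.map_map, WeierstrassCurve.map_map] at this
    rwa [show (g₂.comp g₁).comp g = algebraMap (RatFunc k) M₂ from (RingHom.ext hg).symm] at this
  obtain ⟨Q, Y', t1, t2, t3⟩ := D3a0 om2 _ _ l m n _ hom2 hN2.d3 hN2.b0 hN2.d0 q1 q2 q3
  refine D3a (by simpa [map_Δ] using hΔ) _ (g₂ (g₁ r)) _ (pow_ne_zero 2 hN2.u0) D3N.b2 (D3N.b4 hN2.a3) (D3N.b6 hN2.a3) (D3N.b8 hN2.a3 hN2.a2 hN2.a4 hN2.a6) ?_ _ ?_ _ Q Y' ?_ t1 t2 t3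
  · intro X Y h
    exact ⟨_, (hN2.eqn X Y).2 (by rw [← h]; ring)⟩
  · intro h; exact hP0 (CM_inj _ _ (h.trans (map_zero _).symm))
  · rw [CM_xRep, Point.xRep_some, Matrix.cons_val_zero, hg, ← hX, ← hU, map_a₁, map_a₁, hg]; simp
end D4
end MD4

section ME1
section E1
variable {G : Type*} [AddCommGroup G]

def E1M (τ : AddMonoid.End G) : AddSubgroup G :=
  (AddCommGroup.torsion G).comap (show G →+ G from (τ - 1 : AddMonoid.End G))

lemma E1M_mem {τ : AddMonoid.End G} {x : G} : x ∈ E1M τ ↔ IsOfFinAddOrder (τ x - x) := Iff.rfl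

lemma E1_nsm {l : ℕ} (hl : l ≠ 0) {x : G} (h : IsOfFinAddOrder (l • x)) : IsOfFinAddOrder x := by
  rw [isOfFinAddOrder_iff_nsmul_eq_zero] at h ⊢
  obtain ⟨n, hn, h⟩ := h
  exact ⟨n * l, by positivity, by rw [mul_smul, h]⟩

lemma E1_div {τ : AddMonoid.End G} {l : ℕ} (hl : l ≠ 0) {s x : G} (hs : τ s = s)
    (h : s + l • x ∈ E1M τ) : x ∈ E1M τ := by
  rw [E1M_mem] at h ⊢
  apply E1_nsm hl
  convert h using 1
  rw [map_add, map_nsmul, hs, smul_sub]; abel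

lemma E1_pow {τ : AddMonoid.End G} {x t : G} (h : τ x = x + t) (ht : τ t = t) (m : ℕ) :
    (τ ^ m) x = x + m • t := by
  induction m with
  | zero => simp
  | succ m ih =>
    rw [pow_succ', show (τ * τ ^ m) x = τ ((τ ^ m) x) from rfl, ih, map_add, map_nsmul, h, ht, succ_nsmul]; abel

lemma E1_fg {h : G → ℕ} {τ : AddMonoid.End G} {l : ℕ} (hl : l ≠ 0)
    (hT : {P : G | IsOfFinAddOrder P}.Finite) (hτ : ∀ t : G, IsOfFinAddOrder t → τ t = t)
    (H1 : ∀ m : ℕ, 0 < m → ∀ B : ℕ, {P : G | (τ ^ m) P = P ∧ h P ≤ B}.Finite)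
    (HI : (nsmulAddMonoidHom (α := G) l).range.FiniteIndex)
    {c : G → ℕ} (H2 : ∀ g x, h x ≤ 2 * h (g + x) + c g)
    {c₀ : ℕ} (H3 : ∀ x, 4 * h x ≤ h (l • x) + c₀) : AddGroup.FG (E1M τ) := by
  obtain ⟨e, he, hE⟩ : ∃ e : ℕ, 0 < e ∧ ∀ t : G, IsOfFinAddOrder t → e • t = 0 := by
    refine ⟨∏ t ∈ hT.toFinset, addOrderOf t, Finset.prod_pos fun t ht => ?_, fun t ht => ?_⟩
    · exact addOrderOf_pos_iff.2 (by simpa using ht)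
    · exact addOrderOf_dvd_iff_nsmul_eq_zero.1 (Finset.dvd_prod_of_mem _ (by simpa using ht))
  have HI' : (nsmulAddMonoidHom (α := E1M τ) l).range.FiniteIndex := by
    have : (nsmulAddMonoidHom (α := E1M τ) l).range =
        ((nsmulAddMonoidHom (α := G) l).range).comap (E1M τ).subtype := by
      ext x
      constructor
      · rintro ⟨y, rfl⟩
        exact ⟨y, by simp⟩
      · rintro ⟨y, hy⟩
        have hy' : l • y = (x : G) := hy
        refine ⟨⟨y, E1_div (s := 0) hl (map_zero _) (by rw [zero_add, hy']; exact x.2)⟩, ?_⟩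
        exact Subtype.ext hy'
    rw [this]
    exact AddSubgroup.instFiniteIndex_addSubgroupOf _ (E1M τ)
  have : Northcott (fun x : E1M τ => (h x : ℝ)) := by
    refine ⟨fun b => ?_⟩
    have := (H1 e he ⌊b⌋₊).preimage (f := (fun x : E1M τ => (x : G))) (Subtype.val_injective.injOn)
    refine this.subset fun x hx => ⟨?_, Nat.le_floor hx⟩
    have h1 := E1M_mem.1 x.2
    rw [E1_pow (t := τ x - x) (by abel) (hτ _ h1), hE _ h1, add_zero]
  refine AddCommGroup.fg_of_descent (n := l) (h := fun x : E1M τ => (h x : ℝ)) (a := 2) (b := 4)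
    (c₀ := c₀) (c := fun g => c g) (by norm_num) (by norm_num) HI' (fun g x => ?_) (fun x => ?_)
  · have := H2 g x
    simp only [AddSubgroup.coe_add]
    exact_mod_cast this
  · have := H3 x
    simp only [AddSubgroup.coe_nsmul]
    rw [sub_le_iff_le_add]
    exact_mod_cast this

lemma E1_fix {σ : AddMonoid.End G} (H : ∀ P : G, ∃ n : ℕ, 0 < n ∧ (σ ^ n) P = P) {S : Set G}
    (hS : S.Finite) : ∃ n : ℕ, 0 < n ∧ ∀ P ∈ S, (σ ^ n) P = P := by
  have key : ∀ {n m : ℕ} {P : G}, (σ ^ n) P = P → (σ ^ (n * m)) P = P := by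
    intro n m P h
    rw [pow_mul]
    simpa using E1_pow (τ := σ ^ n) (x := P) (t := 0) (by simpa using h) (map_zero _) m
  induction S, hS using Set.Finite.induction_on with
  | empty => exact ⟨1, one_pos, by simp⟩
  | insert _ _ ih =>
    rename_i a S _ _
    obtain ⟨n, hn, h⟩ := ih
    obtain ⟨m, hm, h'⟩ := H a
    refine ⟨n * m, by positivity, ?_⟩
    rintro P (rfl | hP)
    · rw [mul_comm]; exact key h'
    · exact key (h P hP)

theorem E1_main {h : G → ℕ} {σ : AddMonoid.End G} {l : ℕ} (hl : 2 ≤ l)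
    (hT : {P : G | IsOfFinAddOrder P}.Finite)
    (H0 : ∀ P : G, ∃ n : ℕ, 0 < n ∧ (σ ^ n) P = P)
    (H1 : ∀ m : ℕ, 0 < m → ∀ B : ℕ, {P : G | (σ ^ m) P = P ∧ h P ≤ B}.Finite)
    (HI : (nsmulAddMonoidHom (α := G) l).range.FiniteIndex)
    {c : G → ℕ} (H2 : ∀ g x, h x ≤ 2 * h (g + x) + c g)
    {c₀ : ℕ} (H3 : ∀ x, 4 * h x ≤ h (l • x) + c₀) : AddGroup.FG G := by
  have hl0 : l ≠ 0 := by omega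
  obtain ⟨S, hS, hS'⟩ : ∃ S : Set G, S.Finite ∧ ∀ P : G, ∃ s ∈ S, ∃ Q, P = s + l • Q := by
    have : Finite (G ⧸ (nsmulAddMonoidHom (α := G) l).range) := inferInstance
    refine ⟨Set.range (Quotient.out : (G ⧸ (nsmulAddMonoidHom (α := G) l).range) → G),
      Set.finite_range _, fun P => ⟨_, ⟨(P : G ⧸ (nsmulAddMonoidHom (α := G) l).range), rfl⟩, ?_⟩⟩
    have : (((P : G ⧸ (nsmulAddMonoidHom (α := G) l).range).out : G) :
        G ⧸ (nsmulAddMonoidHom (α := G) l).range) = P := Quotient.out_eq _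
    obtain ⟨Q, hQ⟩ := QuotientAddGroup.eq.1 this
    refine ⟨Q, ?_⟩
    rw [show l • Q = _ from hQ]; abel
  obtain ⟨N, hN, hf⟩ := E1_fix H0 (hS.union hT)
  have hfg : ∀ n, 0 < n → (∀ P ∈ S ∪ {P : G | IsOfFinAddOrder P}, (σ ^ n) P = P) →
      AddGroup.FG (E1M (σ ^ n)) := fun n hn h' =>
    E1_fg hl0 hT (fun t ht => h' t (Or.inr ht))
      (fun m hm B => by simpa only [← pow_mul] using H1 (n * m) (by positivity) B) HI H2 H3
  have top : ∀ P : G, P ∈ E1M (σ ^ N) := by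
    intro P
    obtain ⟨n, hn, hP⟩ := E1_fix H0 ((hS.union hT).insert P)
    have h1 := hfg n hn (fun Q hQ => hP Q (Or.inr hQ))
    set φ : G →+ G := (σ ^ N - 1 : AddMonoid.End G) with hφ
    set A : Submodule ℤ G :=
      (AddSubgroup.toIntSubmodule (E1M (σ ^ n))).map φ.toIntLinearMap with hA
    have hAfg : A.FG := by
      apply Submodule.FG.map
      rw [Submodule.fg_iff_addSubgroup_fg]
      simpa using (AddGroup.fg_iff_addSubgroup_fg _).1 h1
    have hle : A ≤ Ideal.span {(l : ℤ)} • A := by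
      rintro _ ⟨Q, hQ, rfl⟩
      obtain ⟨s, hs, R, rfl⟩ := hS' Q
      have hR : R ∈ E1M (σ ^ n) := E1_div hl0 (hP s (Or.inr (Or.inl hs))) hQ
      have : φ (s + l • R) = (l : ℤ) • φ R := by
        rw [map_add, map_nsmul]
        have : φ s = 0 := sub_eq_zero.2 (hf s (Or.inl hs))
        rw [this, zero_add, natCast_zsmul]
      rw [AddMonoidHom.coe_toIntLinearMap, this]
      exact Submodule.smul_mem_smul (Ideal.mem_span_singleton_self _) ⟨R, hR, rfl⟩
    obtain ⟨r, hr, hr'⟩ :=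
      Submodule.exists_sub_one_mem_and_smul_eq_zero_of_fg_of_le_smul _ A hAfg hle
    have hr0 : r ≠ 0 := by
      rintro rfl
      rw [Ideal.mem_span_singleton, zero_sub, dvd_neg] at hr
      have : l ∣ 1 := by exact_mod_cast hr
      have := Nat.le_of_dvd one_pos this
      omega
    have hPM : P ∈ E1M (σ ^ n) := by
      rw [E1M_mem, hP P (Or.inl rfl), sub_self]; exact IsOfFinAddOrder.zero
    have h2 := hr' (φ P) ⟨P, hPM, rfl⟩
    exact isOfFinAddOrder_iff_zsmul_eq_zero.2 ⟨r, hr0, h2⟩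
  have h3 := hfg N hN hf
  have h4 : E1M (σ ^ N) = ⊤ := by ext x; simpa using top x
  rw [h4] at h3
  exact AddGroup.fg_iff_addSubgroup_fg (⊤ : AddSubgroup G) |>.1 h3 |> fun h => ⟨h⟩
end E1
end ME1

section ME2
open Polynomial

section E2
variable {p : ℕ} [Fact p.Prime] {k : Type*} [Field k] [CharP k p]

lemma E2_alg [Algebra (ZMod p) k] [Algebra.IsAlgebraic (ZMod p) k] (c : k) :
    ∃ n : ℕ, 0 < n ∧ c ^ p ^ n = c := by
  have hi : IsIntegral (ZMod p) c := (Algebra.IsAlgebraic.isAlgebraic c).isIntegral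
  haveI := IntermediateField.adjoin.finiteDimensional hi
  haveI : Finite (IntermediateField.adjoin (ZMod p) {c}) := Module.finite_of_finite (ZMod p)
  letI := Fintype.ofFinite (IntermediateField.adjoin (ZMod p) {c})
  obtain ⟨n, -, h⟩ := FiniteField.card (IntermediateField.adjoin (ZMod p) {c}) p
  refine ⟨n, n.2, ?_⟩
  have := FiniteField.pow_card (IntermediateField.AdjoinSimple.gen (ZMod p) c)
  rw [h] at this
  have := congrArg (algebraMap _ k) this
  simpa using this

variable (p k) in
noncomputable def E2F : RatFunc k →+* RatFunc k :=
  IsFractionRing.map (A := k[X]) (K := RatFunc k) (B := k[X]) (L := RatFunc k)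
    (j := Polynomial.mapRingHom (frobenius k p))
    (Polynomial.map_injective _ (frobenius k p).injective)

lemma E2F_map (f : k[X]) (n : ℕ) : ((E2F p k) ^ n) (algebraMap _ _ f) =
    algebraMap _ _ (f.map (iterateFrobenius k p n)) := by
  induction n with
  | zero =>
    have : iterateFrobenius k p 0 = RingHom.id k := by ext; simp
    simp [this]
  | succ n ih =>
    rw [pow_succ', RingHom.mul_def, RingHom.comp_apply, ih]
    have : iterateFrobenius k p (n + 1) = (frobenius k p).comp (iterateFrobenius k p n) := by
      ext x; simp [iterateFrobenius_def, frobenius_def, pow_succ, pow_mul]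
    rw [this, ← Polynomial.map_map]
    simp [E2F, IsFractionRing.map]

lemma E2_mul {K : Type*} [Field K] (φ : K →+* K) {n : ℕ} {x : K} (h : (φ ^ n) x = x) (m : ℕ) :
    (φ ^ (n * m)) x = x := by
  rw [pow_mul]
  induction m with
  | zero => simp
  | succ m ih => rw [pow_succ, RingHom.mul_def, RingHom.comp_apply, h, ih]

lemma E2_per [Algebra (ZMod p) k] [Algebra.IsAlgebraic (ZMod p) k] (x : RatFunc k) :
    ∃ n : ℕ, 0 < n ∧ ((E2F p k) ^ n) x = x := by
  have key : ∀ f : k[X], ∃ n : ℕ, 0 < n ∧ ((E2F p k) ^ n) (algebraMap _ _ f) = algebraMap _ _ f := by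
    intro f
    induction f using Polynomial.induction_on' with
    | add f g hf hg =>
      obtain ⟨n, hn, h⟩ := hf
      obtain ⟨m, hm, h'⟩ := hg
      refine ⟨n * m, by positivity, ?_⟩
      rw [map_add, map_add, E2_mul _ h, mul_comm, E2_mul _ h']
    | monomial i c =>
      obtain ⟨n, hn, h⟩ := E2_alg (p := p) c
      refine ⟨n, hn, ?_⟩
      rw [E2F_map, Polynomial.map_monomial, iterateFrobenius_def, h]
  obtain ⟨n, hn, h⟩ := key x.num
  obtain ⟨m, hm, h'⟩ := key x.denom
  refine ⟨n * m, by positivity, ?_⟩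
  rw [← RatFunc.num_div_denom x, map_div₀, E2_mul _ h, mul_comm, E2_mul _ h']

lemma E2_fixfin {n : ℕ} (hn : 0 < n) (B : ℕ) :
    {f : k[X] | f.map (iterateFrobenius k p n) = f ∧ f.natDegree ≤ B}.Finite := by
  have hF : {c : k | c ^ p ^ n = c}.Finite := by
    have h1 : 1 < p ^ n := Nat.one_lt_pow hn.ne' (Fact.out : p.Prime).one_lt
    have hne : (X ^ p ^ n - X : k[X]) ≠ 0 := FiniteField.X_pow_card_sub_X_ne_zero k h1
    refine (Polynomial.finite_setOf_isRoot hne).subset fun c hc => ?_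
    have hc' : c ^ p ^ n = c := hc
    simp [hc']
  have h2 := (Set.Finite.pi' (ι := Fin (B + 1)) (fun _ => hF)).image
    (fun a : Fin (B + 1) → k => ∑ i : Fin (B + 1), C (a i) * X ^ (i : ℕ))
  refine h2.subset fun f hf => ⟨fun i => f.coeff i, fun i => ?_, ?_⟩
  · have := congrArg (fun g => g.coeff i) hf.1
    simpa [iterateFrobenius_def] using this
  · show ∑ i : Fin (B + 1), C (f.coeff i) * X ^ (i : ℕ) = f
    rw [Fin.sum_univ_eq_sum_range (fun i => C (f.coeff i) * X ^ i)]
    exact (Polynomial.as_sum_range_C_mul_X_pow' f (Nat.lt_succ_of_le hf.2)).symm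

lemma E2_fin {n : ℕ} (hn : 0 < n) (B : ℕ) :
    {r : RatFunc k | ((E2F p k) ^ n) r = r ∧ r.num.natDegree ≤ B ∧ r.denom.natDegree ≤ B}.Finite := by
  have h := E2_fixfin (k := k) (p := p) hn B
  refine (h.image2 (fun f g => (algebraMap k[X] (RatFunc k) f) / algebraMap _ _ g) h).subset ?_
  rintro r ⟨h1, h2, h3⟩
  set τ := iterateFrobenius k p n
  have hd0 := RatFunc.denom_ne_zero r
  have hdm0 : r.denom.map τ ≠ 0 := (Polynomial.map_ne_zero_iff τ.injective).2 hd0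
  have e : r.num.map τ * r.denom = r.num * r.denom.map τ := by
    apply RatFunc.algebraMap_injective k
    have h4 := h1
    rw [← RatFunc.num_div_denom r, map_div₀, E2F_map, E2F_map, div_eq_div_iff
      (by simpa using hdm0) (by simpa using hd0)] at h4
    simpa using h4
  have hc := RatFunc.isCoprime_num_denom r
  have hmon := RatFunc.monic_denom r
  have hd : r.denom ∣ r.denom.map τ := hc.symm.dvd_of_dvd_mul_left ⟨_, by rw [← e, mul_comm]⟩
  have e2 : r.denom.map τ = r.denom := by
    refine (Polynomial.eq_of_monic_of_dvd_of_natDegree_le hmon (hmon.map τ) hd ?_)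
    rw [Polynomial.natDegree_map]
  have e3 : r.num.map τ = r.num := by
    rw [e2] at e
    exact mul_right_cancel₀ hd0 e
  exact ⟨r.num, ⟨e3, h2⟩, r.denom, ⟨e2, h3⟩, RatFunc.num_div_denom r⟩

lemma E2_deg {r : RatFunc k} {f g : k[X]} (hg : g ≠ 0)
    (h : r = algebraMap _ _ f / algebraMap _ _ g) :
    r.num.natDegree ≤ f.natDegree ∧ r.denom.natDegree ≤ g.natDegree := by
  constructor
  · by_cases hf : f = 0
    · subst hf; simp [h]
    · rw [h]; exact Polynomial.natDegree_le_of_dvd (RatFunc.num_div_dvd f hg) hf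
  · rw [h]; exact Polynomial.natDegree_le_of_dvd (RatFunc.denom_div_dvd f g) hg
end E2
end ME2

section ME3
open Polynomial WeierstrassCurve WeierstrassCurve.Affine

section E3
open Classical
variable {p : ℕ} [Fact p.Prime] {k : Type*} [Field k] [CharP k p]

noncomputable def CE {W : WeierstrassCurve (RatFunc k)} (σ : RatFunc k →+* RatFunc k)
    (h : W.map σ = W) : AddMonoid.End W.toAffine.Point := CM σ h

lemma E3_pow {W : WeierstrassCurve (RatFunc k)} (σ : RatFunc k →+* RatFunc k) (h : W.map σ = W)
    (n : ℕ) (x y : RatFunc k) (hns : W.toAffine.Nonsingular x y) : ∃ h', ((CE σ h) ^ n)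
      (Point.some x y hns) = .some ((σ ^ n) x) ((σ ^ n) y) h' := by
  induction n with
  | zero => exact ⟨hns, rfl⟩
  | succ n ih =>
    obtain ⟨h1, e⟩ := ih
    obtain ⟨h2, e2⟩ := CM_some σ h _ _ h1
    simp only [pow_succ' σ]
    refine ⟨h2, ?_⟩
    rw [pow_succ']
    exact (congrArg (CM σ h) e).trans e2

lemma E3_fin {W : WeierstrassCurve (RatFunc k)} {D : k[X]} (hD : D ≠ 0)
    {d : ℕ} (hd : 0 < d) (hDd : ((E2F p k) ^ d) (algebraMap _ _ D) = algebraMap _ _ D)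
    {n : ℕ} (hn : 0 < n) (B : ℕ) :
    {P : W.toAffine.Point | ((E2F p k) ^ n) (P.xRep 0) = P.xRep 0 ∧ Bh hD P ≤ B}.Finite := by
  have hD' : (algebraMap k[X] (RatFunc k) D) ≠ 0 := by simpa using hD
  have h1 := (E2_fin (k := k) (p := p) (n := n * d) (by positivity) B).image
    (fun r => r / (algebraMap k[X] (RatFunc k) D) ^ 2)
  refine ((C_fin (W := W) h1).union (Set.finite_singleton 0)).subset ?_
  rintro P ⟨hP, hB⟩
  by_cases h0 : P = 0
  · exact Or.inr h0
  left
  have hR := (BR_ex hD P).choose_spec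
  have hB' : ∀ i, ((BR_ex hD P).choose i).natDegree ≤ B := fun i => (B_le _ i).trans hB
  generalize (BR_ex hD P).choose = q at hR hB'
  obtain ⟨-, c, hc, e0, e1⟩ := hR
  rw [C_rep1 h0] at e1
  have hq : q 1 ≠ 0 := by rintro h; simp [h] at e1
  have hq' : (algebraMap k[X] (RatFunc k) (q 1)) ≠ 0 := by simpa using hq
  have e3 : (algebraMap k[X] (RatFunc k) D) ^ 2 * P.xRep 0 =
      algebraMap _ _ (q 0) / algebraMap _ _ (q 1) := by
    rw [e0, eq_div_iff hq']
    linear_combination -(algebraMap k[X] (RatFunc k) (q 0)) * e1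
  obtain ⟨g1, g2⟩ := E2_deg hq e3
  refine ⟨_, ⟨?_, g1.trans (hB' 0), g2.trans (hB' 1)⟩, ?_⟩
  · rw [map_mul, map_pow, E2_mul _ hP, mul_comm n, E2_mul _ hDd]
  · field_simp

lemma E3_ht {G : Type*} [AddCommGroup G] {h : G → ℕ} {c : ℕ}
    (H : ∀ P Q, h (P + Q) + h (P - Q) ≤ 2 * h P + 2 * h Q + c ∧
      2 * h P + 2 * h Q ≤ h (P + Q) + h (P - Q) + c) :
    (∃ c' : G → ℕ, ∀ g x, h x ≤ 2 * h (g + x) + c' g) ∧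
    (∃ c₀, ∀ x, 4 * h x ≤ h (2 • x) + c₀) ∧ (∃ c₀, ∀ x, 4 * h x ≤ h (3 • x) + c₀) := by
  have h2 : ∀ x, 4 * h x ≤ h (2 • x) + (h 0 + c) := fun x => by
    have := (H x x).2
    rw [sub_self, show x + x = 2 • x from (two_nsmul x).symm] at this; omega
  refine ⟨⟨fun g => 2 * h g + c, fun g x => ?_⟩, ⟨_, h2⟩, ⟨2 * (h 0 + c) + c, fun x => ?_⟩⟩
  · have := (H (g + x) g).1
    rw [add_sub_cancel_left] at this; show _ ≤ _ + (2 * h g + c); omega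
  · have := (H (2 • x) x).2
    rw [show 2 • x + x = 3 • x by rw [succ_nsmul x 2], 
      show 2 • x - x = x by rw [two_nsmul, add_sub_cancel_right]] at this
    have := h2 x; omega

theorem E3_main [IsAlgClosed k] [Algebra (ZMod p) k] [Algebra.IsAlgebraic (ZMod p) k]
    {W : WeierstrassCurve (RatFunc k)} (hΔ : W.Δ ≠ 0)
    (hj : ∀ c : k, algebraMap k (RatFunc k) c ≠ W.c₄ ^ 3 / W.Δ)  :
    AddGroup.FG W.toAffine.Point := by
  obtain ⟨Wt, D, hM⟩ := BM_ex W hΔ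
  obtain ⟨c, hc⟩ := B_par hM
  obtain ⟨⟨c', H2⟩, ⟨u2, H3⟩, ⟨u3, H3'⟩⟩ := E3_ht hc
  obtain ⟨d, hd, hDd⟩ := E2_per (p := p) (algebraMap k[X] (RatFunc k) D)
  obtain ⟨n1, p1, f1⟩ := E2_per (p := p) W.a₁
  obtain ⟨n2, p2, f2⟩ := E2_per (p := p) W.a₂
  obtain ⟨n3, p3, f3⟩ := E2_per (p := p) W.a₃
  obtain ⟨n4, p4, f4⟩ := E2_per (p := p) W.a₄
  obtain ⟨n6, p6, f6⟩ := E2_per (p := p) W.a₆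
  obtain ⟨a, ha, e⟩ : ∃ a : ℕ, 0 < a ∧ W.map ((E2F p k) ^ a) = W := by
    refine ⟨n1 * n2 * n3 * n4 * n6, by positivity, WeierstrassCurve.ext ?_ ?_ ?_ ?_ ?_⟩
    · rw [show n1 * n2 * n3 * n4 * n6 = n1 * (n2 * n3 * n4 * n6) by ring]; exact E2_mul _ f1 _
    · rw [show n1 * n2 * n3 * n4 * n6 = n2 * (n1 * n3 * n4 * n6) by ring]; exact E2_mul _ f2 _
    · rw [show n1 * n2 * n3 * n4 * n6 = n3 * (n2 * n1 * n4 * n6) by ring]; exact E2_mul _ f3 _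
    · rw [show n1 * n2 * n3 * n4 * n6 = n4 * (n2 * n3 * n1 * n6) by ring]; exact E2_mul _ f4 _
    · rw [show n1 * n2 * n3 * n4 * n6 = n6 * (n2 * n3 * n4 * n1) by ring]; exact E2_mul _ f6 _
  set σ := (E2F p k) ^ a with hσ
  have H0 : ∀ P : W.toAffine.Point,
      ∃ n : ℕ, 0 < n ∧ ((CE σ e) ^ n) P = P := by
    rintro (_ | ⟨x, y, hns⟩)
    · exact ⟨1, one_pos, map_zero _⟩
    obtain ⟨n, hn, h⟩ := E2_per (p := p) x
    obtain ⟨m, hm, h'⟩ := E2_per (p := p) y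
    refine ⟨n * m, by positivity, ?_⟩
    obtain ⟨h'', E⟩ := E3_pow σ e (n * m) x y hns
    rw [E]
    have q1 : (σ ^ (n * m)) x = x := by
      rw [hσ, ← pow_mul, show a * (n * m) = n * (a * m) by ring]; exact E2_mul _ h _
    have q2 : (σ ^ (n * m)) y = y := by
      rw [hσ, ← pow_mul, show a * (n * m) = m * (a * n) by ring]; exact E2_mul _ h' _
    simp only [q1, q2]
  have H1 : ∀ m : ℕ, 0 < m → ∀ B : ℕ, {P : W.toAffine.Point |
      ((CE σ e) ^ m) P = P ∧ Bh hM.D0 P ≤ B}.Finite := by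
    intro m hm B
    refine (E3_fin (p := p) hM.D0 hd hDd (n := a * m) (by positivity) B).subset ?_
    rintro P ⟨hP, hB⟩
    refine ⟨?_, hB⟩
    rcases P with _ | ⟨x, y, hns⟩
    · exact map_one _
    · obtain ⟨h'', E⟩ := E3_pow σ e m x y hns
      rw [E] at hP
      simp only [Point.some.injEq, hσ, ← pow_mul] at hP
      simpa using hP.1
  have h0 : p = 2 → W.a₁ ≠ 0 := by
    rintro rfl h
    have c2 : (2 : RatFunc k) = 0 := by
      have : (2 : k) = 0 := by exact_mod_cast CharP.cast_eq_zero k 2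
      rw [← map_ofNat (algebraMap k (RatFunc k)) 2, this, map_zero]
    apply hj 0
    have : W.c₄ = 0 := by
      rw [WeierstrassCurve.c₄, WeierstrassCurve.b₂, h]
      linear_combination (8 * W.a₂ ^ 2 - 12 * W.b₄) * c2
    rw [this]; simp
  by_cases hp : p = 2
  · subst hp
    have hu := h0 rfl
    have c2 : CharP (RatFunc k) 2 :=
      charP_of_injective_algebraMap (algebraMap k (RatFunc k)).injective 2
    have hb : W.b₂ ≠ 0 := by rw [D3N.b2]; exact pow_ne_zero _ hu
    exact E1_main (l := 3) (by norm_num) (C4_T 2 hΔ (Or.inr hb) hj) H0 H1 (D4 hΔ hu) H2 H3'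
  · have h2 : (2 : k) ≠ 0 := by
      intro h
      have : p ∣ 2 := (CharP.cast_eq_zero_iff k p 2).1 (by exact_mod_cast h)
      exact hp ((Nat.prime_dvd_prime_iff_eq Fact.out Nat.prime_two).1 this)
    have h4 : (4 : RatFunc k) ≠ 0 := by
      rw [← map_ofNat (algebraMap k (RatFunc k)) 4]
      refine (_root_.map_ne_zero _).2 ?_
      rw [show (4 : k) = 2 * 2 by norm_num]; exact mul_ne_zero h2 h2
    exact E1_main (l := 2) le_rfl (C4_T p hΔ (Or.inl h4) hj) H0 H1 (D2 h2 hΔ) H2 H3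
end E3


end ME3

/-- Let `k` be an algebraic closure of `𝔽_p`, `K = k(t)`, and `E` a non-isotrivial elliptic
curve over `K` (its `j`-invariant `c₄³/Δ` is transcendental over `𝔽_p`).  Then `E(K)` is a
finitely generated abelian group. -/
theorem mwln_nonisotrivial_over_algebraic_closure
    (p : ℕ) [Fact p.Prime]
    (k : Type*) [Field k] [Algebra (ZMod p) k] [IsAlgClosure (ZMod p) k]
    (W : WeierstrassCurve (RatFunc k)) (hΔ : W.Δ ≠ 0)
    (hj : Transcendental (ZMod p) (W.c₄ ^ 3 / W.Δ)) :
    open Classical in AddGroup.FG W.toAffine.Point := by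
  have h1 : IsAlgClosed k := IsAlgClosure.isAlgClosed (ZMod p)
  have h2 : Algebra.IsAlgebraic (ZMod p) k := IsAlgClosure.isAlgebraic
  have h3 : CharP k p := charP_of_injective_algebraMap (algebraMap (ZMod p) k).injective p
  refine E3_main (p := p) hΔ fun c hc => hj ?_
  rw [← hc]
  exact (Algebra.IsAlgebraic.isAlgebraic c).algebraMap
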